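/- arXiv:1308.6596 — 2 statements merged into one kernel-verified Lean document; each statement's English description precedes it below -/
import Mathlib

section
/- Let d = 3 and let δ be the Weitzenböck derivation of F_3 with δ(x_1) = 0, δ(x_2) = x_1, δ(x_3) = x_2, extended to K[U_3,V_3] by δ(u_1) = δ(v_1) = 0, δ(u_2) = u_1, δ(u_3) = u_2, δ(v_2) = v_1, δ(v_3) = v_2. Then the K[U_3,V_3]^δ-module (F_3')^δ is generated by the five elements c_1 = [x_2,x_1], c_2 = [x_3,x_1,x_1] − [x_2,x_1,x_2], c_3 = x_1[x_3,x_1] − x_2[x_2,x_1], c_4 = x_1[x_3,x_2] − x_2[x_3,x_1] + x_3[x_2,x_1], and c_5 = [x_3,x_1]·u_3v_1 − [x_3,x_1]·u_1v_3 + [x_3,x_2]·u_1v_2 − [x_3,x_2]·u_2v_1 − [x_2,x_1]·u_3v_2 + [x_2,x_1]·u_2v_3. -/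
noncomputable section

/-- The metabelian relation on the free associative algebra:
products of two commutators are identified with zero. -/
def MetabRel (K : Type*) [CommRing K] (d : ℕ) (p q : FreeAlgebra K (Fin d)) : Prop :=
  q = 0 ∧ ∃ a b c e : FreeAlgebra K (Fin d), p = (a * b - b * a) * (c * e - e * c)

/-- The free metabelian associative algebra `F_d = A_d/(A_d')²`. -/
abbrev FreeMetab (K : Type*) [CommRing K] (d : ℕ) := RingQuot (MetabRel K d)

/-- The free generators `x_i` of `F_d`. -/
def xg (K : Type*) [CommRing K] (d : ℕ) (i : Fin d) : FreeMetab K d :=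
  RingQuot.mkAlgHom K (MetabRel K d) (FreeAlgebra.ι K i)

/-- The commutator ideal `F_d'`: the two-sided ideal generated by all commutators. -/
def commIdeal (K : Type*) [CommRing K] (d : ℕ) : Ideal (FreeMetab K d) :=
  Ideal.span {z | ∃ a f g b : FreeMetab K d, z = a * (f * g - g * f) * b}

/-- `K[U_d,V_d]`. -/
abbrev PolyUV (K : Type*) [CommRing K] (d : ℕ) := MvPolynomial (Fin d ⊕ Fin d) K

def uP (K : Type*) [CommRing K] (d : ℕ) (i : Fin d) : PolyUV K d := MvPolynomial.X (Sum.inl i)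
def vP (K : Type*) [CommRing K] (d : ℕ) (i : Fin d) : PolyUV K d := MvPolynomial.X (Sum.inr i)

/-- Action of a monomial of `K[U_d,V_d]` on `F_d`, implementing
`f·u_i = x_i f` and `f·v_i = [f,x_i]` (on the commutator ideal all the
individual operators commute, so the fixed order of composition is immaterial). -/
def monAct (K : Type*) [CommRing K] (d : ℕ) (m : (Fin d ⊕ Fin d) →₀ ℕ) :
    Module.End K (FreeMetab K d) :=
  (List.ofFn fun i : Fin d =>
      (LinearMap.mulLeft K (xg K d i) : Module.End K (FreeMetab K d)) ^ m (Sum.inl i)).prod *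
  (List.ofFn fun i : Fin d =>
      (LinearMap.mulRight K (xg K d i) - LinearMap.mulLeft K (xg K d i) :
        Module.End K (FreeMetab K d)) ^ m (Sum.inr i)).prod

/-- The action of `K[U_d,V_d]` on the commutator ideal of `F_d`. -/
def act (K : Type*) [CommRing K] (d : ℕ) (p : PolyUV K d) (w : FreeMetab K d) : FreeMetab K d :=
  ∑ m ∈ p.support, p.coeff m • (monAct K d m w)

/-- The commutator `[f,g] = fg - gf` in `F₃`. -/
def brk (K : Type*) [CommRing K] (f g : FreeMetab K 3) : FreeMetab K 3 := f * g - g * f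

/-- `c₁ = [x₂,x₁]`. -/
def c1 (K : Type*) [CommRing K] : FreeMetab K 3 := brk K (xg K 3 1) (xg K 3 0)
/-- `c₂ = [x₃,x₁,x₁] - [x₂,x₁,x₂]`. -/
def c2 (K : Type*) [CommRing K] : FreeMetab K 3 :=
  brk K (brk K (xg K 3 2) (xg K 3 0)) (xg K 3 0)
    - brk K (brk K (xg K 3 1) (xg K 3 0)) (xg K 3 1)
/-- `c₃ = x₁[x₃,x₁] - x₂[x₂,x₁]`. -/
def c3 (K : Type*) [CommRing K] : FreeMetab K 3 :=
  xg K 3 0 * brk K (xg K 3 2) (xg K 3 0) - xg K 3 1 * brk K (xg K 3 1) (xg K 3 0)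
/-- `c₄ = x₁[x₃,x₂] - x₂[x₃,x₁] + x₃[x₂,x₁]`. -/
def c4 (K : Type*) [CommRing K] : FreeMetab K 3 :=
  xg K 3 0 * brk K (xg K 3 2) (xg K 3 1) - xg K 3 1 * brk K (xg K 3 2) (xg K 3 0)
    + xg K 3 2 * brk K (xg K 3 1) (xg K 3 0)
/-- `c₅ = [x₃,x₁]u₃v₁ - [x₃,x₁]u₁v₃ + [x₃,x₂]u₁v₂ - [x₃,x₂]u₂v₁ - [x₂,x₁]u₃v₂ + [x₂,x₁]u₂v₃`,
written out via `w·u_iv_j = x_i[w,x_j]`. -/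
def c5 (K : Type*) [CommRing K] : FreeMetab K 3 :=
  xg K 3 2 * brk K (brk K (xg K 3 2) (xg K 3 0)) (xg K 3 0)
    - xg K 3 0 * brk K (brk K (xg K 3 2) (xg K 3 0)) (xg K 3 2)
    + xg K 3 0 * brk K (brk K (xg K 3 2) (xg K 3 1)) (xg K 3 1)
    - xg K 3 1 * brk K (brk K (xg K 3 2) (xg K 3 1)) (xg K 3 0)
    - xg K 3 2 * brk K (brk K (xg K 3 1) (xg K 3 0)) (xg K 3 1)
    + xg K 3 1 * brk K (brk K (xg K 3 1) (xg K 3 0)) (xg K 3 2)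

section sl2part

set_option linter.unusedSectionVars false

variable {K V : Type*} [Field K] [CharZero K] [AddCommGroup V] [Module K V]

/-- Pointwise `sl2` relations, with locally nilpotent `E`, `F`. -/
structure SlT (E F H : Module.End K V) : Prop where
  ef : ∀ v, E (F v) = F (E v) + H v
  he : ∀ v, H (E v) = E (H v) + (2 : K) • E v
  hf : ∀ v, H (F v) = F (H v) - (2 : K) • F v
  en : ∀ v, ∃ n : ℕ, (E ^ n) v = 0
  fn : ∀ v, ∃ n : ℕ, (F ^ n) v = 0

theorem SlT.swap {E F H : Module.End K V} (h : SlT E F H) : SlT F E (-H) where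
  ef v := by simp [h.ef v]
  he v := by simp [h.hf v]; abel
  hf v := by simp [h.he v]; abel
  en := h.fn
  fn := h.en

theorem SlT.wt {E F H : Module.End K V} (h : SlT E F H) {μ : K} {v : V} (hv : H v = μ • v) (n : ℕ) :
    H ((E ^ n) v) = (μ + 2 * n) • (E ^ n) v := by
  induction n with
  | zero => simp [hv]
  | succ n ih =>
    rw [pow_succ', Module.End.mul_apply, h.he, ih, map_smul, ← add_smul]
    congr 1; push_cast; ring

theorem SlT.comm {E F H : Module.End K V} (h : SlT E F H) {μ : K} {v : V} (hv : H v = μ • v)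
    (n : ℕ) : (E ^ (n + 1)) (F v) = F ((E ^ (n + 1)) v) + ((n + 1) * (μ + n) : K) • (E ^ n) v := by
  induction n with
  | zero => simp [h.ef, hv]
  | succ n ih =>
    have e1 : ∀ (k : ℕ) (w : V), (E ^ (k + 1)) w = E ((E ^ k) w) := fun k w => by
      rw [pow_succ', Module.End.mul_apply]
    rw [e1 (n + 1), ih, map_add, h.ef, h.wt hv, map_smul, ← e1, ← e1, add_assoc, ← add_smul]
    congr 2; push_cast; ring

theorem SlT.commF {E F H : Module.End K V} (h : SlT E F H) {μ : K} {v : V} (hv : H v = μ • v)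
    (n : ℕ) : (F ^ (n + 1)) (E v) = E ((F ^ (n + 1)) v) + ((n + 1) * (-μ + n) : K) • (F ^ n) v :=
  h.swap.comm (by simp [hv]) n

theorem SlT.wtEF {E F H : Module.End K V} (h : SlT E F H) {μ : K} {v : V} (hv : H v = μ • v) :
    H (E (F v)) = μ • E (F v) := by
  rw [h.he, h.hf, hv]; simp

theorem nat_succ_ne (n : ℕ) : (n + 1 : K) ≠ 0 := by exact_mod_cast Nat.succ_ne_zero n

theorem SlT.surj1 {E F H : Module.End K V} (h : SlT E F H) {μ : K} (hμ : ∀ n : ℕ, μ + n ≠ 0)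
    (n : ℕ) : ∀ v : V, H v = μ • v → (E ^ n) v = 0 → v ∈ LinearMap.range E := by
  induction n with
  | zero => intro v _ h0; simp at h0; simp [h0]
  | succ n ih =>
    intro v hv h0
    have hc : ((n + 1) * (μ + n) : K) ≠ 0 := mul_ne_zero (nat_succ_ne n) (hμ n)
    set c : K := (n + 1) * (μ + n)
    have h1 := h.comm hv n
    rw [h0, map_zero, zero_add] at h1
    have h2 := ih (v - c⁻¹ • E (F v)) (by rw [map_sub, map_smul, h.wtEF hv, hv, smul_sub, smul_comm])
      (by rw [map_sub, map_smul, ← Module.End.mul_apply, ← pow_succ, h1, smul_smul,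
        inv_mul_cancel₀ hc, one_smul, sub_self])
    have h3 : v = (v - c⁻¹ • E (F v)) + E (c⁻¹ • F v) := by simp
    rw [h3]
    exact add_mem h2 ⟨_, rfl⟩

theorem SlT.surj2 {E F H : Module.End K V} (h : SlT E F H) {μ : K} (m : ℕ) (hμ : μ = -m)
    (n : ℕ) : ∀ v : V, H v = μ • v → (F ^ (n + 1)) v = 0 →
      v ∈ LinearMap.range E ⊔ LinearMap.ker F := by
  induction n with
  | zero => intro v _ h0; exact Submodule.mem_sup_right (by simpa using h0)
  | succ n ih =>
    intro v hv h0
    have hc : ((n + 1) * (-(μ - 2) + n) : K) ≠ 0 := by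
      refine mul_ne_zero (nat_succ_ne n) ?_
      rw [hμ]
      have : (-(-(m:K) - 2) + n : K) = ((m + 1 + n : ℕ) : K) + 1 := by push_cast; ring
      rw [this]; exact nat_succ_ne _
    set c : K := (n + 1) * (-(μ - 2) + n)
    have h1 := h.commF (v := F v) (μ := μ - 2) (by rw [h.hf, hv, map_smul, sub_smul]) n
    rw [← Module.End.mul_apply (F ^ (n + 1)) F, ← pow_succ, h0, map_zero, zero_add,
      ← Module.End.mul_apply (F ^ n) F, ← pow_succ] at h1
    have h2 := ih (v - c⁻¹ • E (F v)) (by rw [map_sub, map_smul, h.wtEF hv, hv, smul_sub, smul_comm])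
      (by rw [map_sub, map_smul, h1, smul_smul, inv_mul_cancel₀ hc, one_smul, sub_self])
    have h3 : v = (v - c⁻¹ • E (F v)) + E (c⁻¹ • F v) := by simp
    rw [h3]
    exact add_mem h2 (Submodule.mem_sup_left ⟨_, rfl⟩)

theorem SlT.surj {E F H : Module.End K V} (h : SlT E F H) (hH : ⨆ μ, H.eigenspace μ = ⊤) :
    LinearMap.range E ⊔ LinearMap.ker F = ⊤ := by
  rw [eq_top_iff, ← hH]
  refine iSup_le fun μ v hv => ?_
  rw [Module.End.mem_eigenspace_iff] at hv
  by_cases hμ : ∀ n : ℕ, μ + n ≠ 0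
  · obtain ⟨n, hn⟩ := h.en v
    exact Submodule.mem_sup_left (h.surj1 hμ n v hv hn)
  · push Not at hμ
    obtain ⟨m, hm⟩ := hμ
    obtain ⟨n, hn⟩ := h.fn v
    exact h.surj2 m (eq_neg_of_add_eq_zero_left hm) n v hv
      (by rw [pow_succ', Module.End.mul_apply, hn, map_zero])

theorem eigsum {H : Module.End K V} (v : K → V) (hv : ∀ μ, H (v μ) = μ • v μ) (s : Finset K) :
    ∀ c : K → K, ∑ μ ∈ s, c μ • v μ = 0 → ∀ μ ∈ s, c μ • v μ = 0 := by
  classical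
  induction s using Finset.induction_on with
  | empty => simp
  | insert a s ha ih =>
    intro c hs
    rw [Finset.sum_insert ha] at hs
    have h1 := congrArg H hs
    rw [map_add, map_sum, map_smul, hv, map_zero] at h1
    have h2 : ∑ μ ∈ s, (c μ * (μ - a)) • v μ = 0 := by
      have h3 := congrArg (fun x => a • x) hs
      simp only [smul_add, smul_zero, Finset.smul_sum] at h3
      have : ∑ μ ∈ s, (c μ * (μ - a)) • v μ = ∑ μ ∈ s, H (c μ • v μ) - ∑ μ ∈ s, a • c μ • v μ := by
        rw [← Finset.sum_sub_distrib]
        refine Finset.sum_congr rfl fun μ _ => ?_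
        rw [map_smul, hv, smul_smul, smul_smul, ← sub_smul]; congr 1; ring
      rw [this, sub_eq_zero]
      rw [smul_comm] at h3
      exact add_left_cancel (h1.trans h3.symm)
    have h4 : ∀ μ ∈ s, c μ • v μ = 0 := by
      intro μ hμ
      have h5 := ih _ h2 μ hμ
      have h6 : μ - a ≠ 0 := by
        rw [sub_ne_zero]; rintro rfl; exact ha hμ
      rw [mul_comm, mul_smul, smul_eq_zero] at h5
      exact h5.resolve_left h6
    rw [Finset.sum_eq_zero h4, add_zero] at hs
    intro μ hμ
    rcases Finset.mem_insert.1 hμ with rfl | hμ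
    · exact hs
    · exact h4 μ hμ

/-- A linear map commuting with a diagonalizable `H`: its kernel is spanned by eigenvectors. -/
theorem ker_le_of_eig {H T : Module.End K V} (hH : ⨆ μ, H.eigenspace μ = ⊤)
    (hc : ∀ v, H (T v) = T (H v)) (S : Submodule K V)
    (hS : ∀ (μ : K) (v : V), H v = μ • v → T v = 0 → v ∈ S) (v : V) (hv : T v = 0) : v ∈ S := by
  have hv' : v ∈ ⨆ μ, H.eigenspace μ := by rw [hH]; trivial
  obtain ⟨f, hf, rfl⟩ := (Submodule.mem_iSup_iff_exists_finsupp _ _).1 hv'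
  have hf' : ∀ μ, H (f μ) = μ • f μ := fun μ => Module.End.mem_eigenspace_iff.1 (hf μ)
  have := eigsum (H := H) (fun μ => T (f μ)) (fun μ => by rw [hc, hf', map_smul]) f.support
    (fun _ => 1) (by simpa [Finsupp.sum, map_sum] using hv)
  refine Submodule.sum_mem _ fun μ hμ => hS μ _ (hf' μ) (by simpa using this μ hμ)

theorem desc {E : Module.End K V} (v : V) (h : ∀ n, (E ^ (n + 1)) v = 0 → (E ^ n) v = 0)
    (n : ℕ) (hn : (E ^ n) v = 0) : v = 0 := by
  induction n with
  | zero => simpa using hn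
  | succ n ih => exact ih (h n hn)

theorem SlT.inj {E F H : Module.End K V} (h : SlT E F H) (hH : ⨆ μ, H.eigenspace μ = ⊤)
    (v : V) (hv : F (E v) = 0) : E v = 0 := by
  refine ker_le_of_eig (T := F * E) hH ?_ (LinearMap.ker E) ?_ v hv
  · intro x
    simp only [Module.End.mul_apply, h.hf, h.he, map_add, map_smul]
    abel
  intro μ x hx2 hx1
  replace hx1 : F (E x) = 0 := hx1
  rw [LinearMap.mem_ker]
  by_cases hμ : ∀ n : ℕ, (μ + 2) + n ≠ 0
  · obtain ⟨n, hn⟩ := h.en (E x)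
    refine desc (E := E) _ (fun k hk => ?_) n hn
    have := h.comm (v := E x) (μ := μ + 2) (by rw [h.he, hx2, map_smul, add_smul]) k
    rw [hx1, hk, map_zero, map_zero, zero_add, eq_comm, smul_eq_zero] at this
    exact this.resolve_left (mul_ne_zero (nat_succ_ne k) (hμ k))
  · push Not at hμ
    obtain ⟨m, hm⟩ := hμ
    obtain ⟨n, hn⟩ := h.fn x
    have : x = 0 := by
      refine desc (E := F) _ (fun k hk => ?_) n hn
      have := h.commF hx2 k
      rw [pow_succ, Module.End.mul_apply, hx1, map_zero, ← pow_succ, hk, map_zero, zero_add,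
        eq_comm, smul_eq_zero] at this
      refine this.resolve_left (mul_ne_zero (nat_succ_ne k) ?_)
      have e : (-μ + k : K) = ((m + k + 1 : ℕ) : K) + 1 := by
        push_cast; linear_combination (-1 : K) * hm
      rw [e]; exact nat_succ_ne _
    rw [this, map_zero]

end sl2part

section polypart

set_option linter.unusedSectionVars false

variable {K σ : Type*} [Field K] [CharZero K]

open MvPolynomial

theorem der_nilp_mul (D : Derivation K (MvPolynomial σ K) (MvPolynomial σ K)) (n : ℕ) :
    ∀ (a b : ℕ) (f g : MvPolynomial σ K), a + b = n →
      ((D : Module.End K (MvPolynomial σ K)) ^ a) f = 0 →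
      ((D : Module.End K (MvPolynomial σ K)) ^ b) g = 0 →
      ((D : Module.End K (MvPolynomial σ K)) ^ n) (f * g) = 0 := by
  induction n with
  | zero =>
    intro a b f g hab hf hg
    have : a = 0 := by omega
    subst this
    simp at hf
    simp [hf]
  | succ n ih =>
    intro a b f g hab hf hg
    rcases a with _ | a
    · simp at hf; simp [hf]
    rcases b with _ | b
    · simp at hg; simp [hg]
    rw [pow_succ, Module.End.mul_apply] at hf hg ⊢
    have e : (D : Module.End K (MvPolynomial σ K)) (f * g) = f * D g + D f * g := by
      simp [mul_comm]
    rw [e, map_add, ih (a + 1) b f (D g) (by omega) (by rw [pow_succ, Module.End.mul_apply]; exact hf) hg,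
      ih a (b + 1) (D f) g (by omega) hf (by rw [pow_succ, Module.End.mul_apply]; exact hg), add_zero]

theorem end_pow_zero_le {V : Type*} [AddCommGroup V] [Module K V] (D : Module.End K V) {n m : ℕ}
    (h : n ≤ m) {v : V} (hv : (D ^ n) v = 0) : (D ^ m) v = 0 := by
  obtain ⟨k, rfl⟩ := Nat.exists_eq_add_of_le h
  rw [add_comm, pow_add, Module.End.mul_apply, hv, map_zero]

theorem der_nilp (D : Derivation K (MvPolynomial σ K) (MvPolynomial σ K))
    (hX : ∀ i, D (D (D (X i))) = 0) (f : MvPolynomial σ K) :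
    ∃ n : ℕ, ((D : Module.End K (MvPolynomial σ K)) ^ n) f = 0 := by
  induction f using MvPolynomial.induction_on with
  | C a => exact ⟨1, by simp⟩
  | add p q hp hq =>
    obtain ⟨n, hn⟩ := hp
    obtain ⟨m, hm⟩ := hq
    exact ⟨max n m, by
      rw [map_add, end_pow_zero_le _ (le_max_left n m) hn, end_pow_zero_le _ (le_max_right n m) hm,
        add_zero]⟩
  | mul_X p i hp =>
    obtain ⟨n, hn⟩ := hp
    exact ⟨n + 3, der_nilp_mul D _ n 3 _ _ rfl hn (by simp [pow_succ, hX])⟩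

theorem der_eig (H : Derivation K (MvPolynomial σ K) (MvPolynomial σ K))
    (hX : ∀ i, ∃ μ : K, H (X i) = μ • X i) :
    ⨆ μ, Module.End.eigenspace (H : Module.End K (MvPolynomial σ K)) μ = ⊤ := by
  rw [eq_top_iff]
  rintro f -
  induction f using MvPolynomial.induction_on with
  | C a =>
    refine Submodule.mem_iSup_of_mem 0 ?_
    rw [Module.End.mem_eigenspace_iff]; simp
  | add p q hp hq => exact add_mem hp hq
  | mul_X p i hp =>
    obtain ⟨ν, hν⟩ := hX i
    refine Submodule.iSup_induction _ (motive := fun p => p * X i ∈ ⨆ μ,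
      Module.End.eigenspace (H : Module.End K (MvPolynomial σ K)) μ) hp ?_ (by simp) ?_
    · intro μ x hx
      rw [Module.End.mem_eigenspace_iff] at hx
      refine Submodule.mem_iSup_of_mem (μ + ν) ?_
      rw [Module.End.mem_eigenspace_iff]
      have hx' : H x = μ • x := hx
      change H (x * X i) = _
      rw [Derivation.leibniz, hx', hν, smul_eq_mul, smul_eq_mul, mul_smul_comm, mul_smul_comm,
        add_smul, mul_comm (X i) x, add_comm]
    · intro x y hx hy
      rw [add_mul]; exact add_mem hx hy

theorem der_slt (E F H : Derivation K (MvPolynomial σ K) (MvPolynomial σ K))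
    (h1 : ∀ i, E (F (X i)) = F (E (X i)) + H (X i))
    (h2 : ∀ i, H (E (X i)) = E (H (X i)) + (2 : K) • E (X i))
    (h3 : ∀ i, H (F (X i)) = F (H (X i)) - (2 : K) • F (X i))
    (hE : ∀ i, E (E (E (X i))) = 0) (hF : ∀ i, F (F (F (X i))) = 0) :
    SlT (E : Module.End K (MvPolynomial σ K)) (F : Module.End K (MvPolynomial σ K))
      (H : Module.End K (MvPolynomial σ K)) where
  ef v := by
    have : ⁅E, F⁆ = H := MvPolynomial.derivation_ext fun i => by
      rw [Derivation.commutator_apply, h1]; simp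
    have := congrArg (fun D => D v) this
    simp only [Derivation.commutator_apply] at this
    change E (F v) = F (E v) + H v
    rw [← this]; simp
  he v := by
    have : ⁅H, E⁆ = (2 : K) • E := MvPolynomial.derivation_ext fun i => by
      rw [Derivation.commutator_apply, h2]; simp
    have := congrArg (fun D => D v) this
    simp only [Derivation.commutator_apply, Derivation.smul_apply] at this
    change H (E v) = E (H v) + (2 : K) • E v
    rw [← this]; simp
  hf v := by
    have : ⁅H, F⁆ = -((2 : K) • F) := MvPolynomial.derivation_ext fun i => by
      rw [Derivation.commutator_apply, h3]; simp
    have := congrArg (fun D => D v) this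
    simp only [Derivation.commutator_apply, Derivation.smul_apply, Derivation.neg_apply] at this
    change H (F v) = F (H v) - (2 : K) • F v
    rw [sub_eq_add_neg, ← this]; simp
  en := der_nilp E hE
  fn := der_nilp F hF

theorem der_surj (E F H : Derivation K (MvPolynomial σ K) (MvPolynomial σ K))
    (hs : SlT (E : Module.End K (MvPolynomial σ K)) (F : Module.End K (MvPolynomial σ K))
      (H : Module.End K (MvPolynomial σ K)))
    (hX : ∀ i, ∃ μ : K, H (X i) = μ • X i) (g : MvPolynomial σ K) :
    ∃ h g0, g = E h + g0 ∧ F g0 = 0 := by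
  have := hs.surj (der_eig H hX)
  have hg : g ∈ (⊤ : Submodule K (MvPolynomial σ K)) := trivial
  rw [← this, Submodule.mem_sup] at hg
  obtain ⟨_, ⟨h, rfl⟩, z, hz, rfl⟩ := hg
  exact ⟨h, z, rfl, hz⟩

theorem der_inj (E F H : Derivation K (MvPolynomial σ K) (MvPolynomial σ K))
    (hs : SlT (E : Module.End K (MvPolynomial σ K)) (F : Module.End K (MvPolynomial σ K))
      (H : Module.End K (MvPolynomial σ K)))
    (hX : ∀ i, ∃ μ : K, H (X i) = μ • X i) (p : MvPolynomial σ K) (h : F (E p) = 0) : E p = 0 :=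
  hs.inj (der_eig H hX) p h

end polypart

section setup

set_option linter.unusedSectionVars false

variable (K : Type*) [Field K]

open MvPolynomial

def fE {R : Type*} [CommRing R] (a : Fin 3 → R) : Fin 3 → R := ![0, a 0, a 1]
def fF {R : Type*} [CommRing R] (a : Fin 3 → R) : Fin 3 → R := ![2 * a 1, 2 * a 2, 0]
def fH {R : Type*} [CommRing R] (a : Fin 3 → R) : Fin 3 → R := ![2 * a 0, 0, -(2 * a 2)]

def dE : Derivation K (PolyUV K 3) (PolyUV K 3) := mkDerivation K (Sum.elim (fE (uP K 3)) (fE (vP K 3)))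
def dF : Derivation K (PolyUV K 3) (PolyUV K 3) := mkDerivation K (Sum.elim (fF (uP K 3)) (fF (vP K 3)))
def dH : Derivation K (PolyUV K 3) (PolyUV K 3) := mkDerivation K (Sum.elim (fH (uP K 3)) (fH (vP K 3)))

theorem dE_u (i : Fin 3) : dE K (uP K 3 i) = fE (uP K 3) i := by simp [dE, uP, mkDerivation_X]
theorem dE_v (i : Fin 3) : dE K (vP K 3 i) = fE (vP K 3) i := by simp [dE, vP, mkDerivation_X]
theorem dF_u (i : Fin 3) : dF K (uP K 3 i) = fF (uP K 3) i := by simp [dF, uP, mkDerivation_X]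
theorem dF_v (i : Fin 3) : dF K (vP K 3 i) = fF (vP K 3) i := by simp [dF, vP, mkDerivation_X]
theorem dH_u (i : Fin 3) : dH K (uP K 3 i) = fH (uP K 3) i := by simp [dH, uP, mkDerivation_X]
theorem dH_v (i : Fin 3) : dH K (vP K 3 i) = fH (vP K 3) i := by simp [dH, vP, mkDerivation_X]

@[simp] theorem dE_u0 : dE K (uP K 3 0) = 0 := dE_u K 0
@[simp] theorem dE_u1 : dE K (uP K 3 1) = uP K 3 0 := dE_u K 1
@[simp] theorem dE_u2 : dE K (uP K 3 2) = uP K 3 1 := dE_u K 2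
@[simp] theorem dE_v0 : dE K (vP K 3 0) = 0 := dE_v K 0
@[simp] theorem dE_v1 : dE K (vP K 3 1) = vP K 3 0 := dE_v K 1
@[simp] theorem dE_v2 : dE K (vP K 3 2) = vP K 3 1 := dE_v K 2
@[simp] theorem dF_u0 : dF K (uP K 3 0) = 2 * uP K 3 1 := dF_u K 0
@[simp] theorem dF_u1 : dF K (uP K 3 1) = 2 * uP K 3 2 := dF_u K 1
@[simp] theorem dF_u2 : dF K (uP K 3 2) = 0 := dF_u K 2
@[simp] theorem dF_v0 : dF K (vP K 3 0) = 2 * vP K 3 1 := dF_v K 0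
@[simp] theorem dF_v1 : dF K (vP K 3 1) = 2 * vP K 3 2 := dF_v K 1
@[simp] theorem dF_v2 : dF K (vP K 3 2) = 0 := dF_v K 2

theorem der_two_mul {σ : Type*} (D : Derivation K (MvPolynomial σ K) (MvPolynomial σ K))
    (p : MvPolynomial σ K) : D (2 * p) = 2 * D p := by
  rw [two_mul, map_add, ← two_mul]

theorem two_smul_poly {σ : Type*} (p : MvPolynomial σ K) : (2 : K) • p = 2 * p := by
  rw [two_smul, two_mul]

/-- Generic verification of the `sl2` relations on a triple of variables. -/
theorem trip {σ : Type*} (E F H : Derivation K (MvPolynomial σ K) (MvPolynomial σ K))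
    (a : Fin 3 → MvPolynomial σ K) (hE : ∀ i, E (a i) = fE a i) (hF : ∀ i, F (a i) = fF a i)
    (hH : ∀ i, H (a i) = fH a i) (i : Fin 3) :
    E (F (a i)) = F (E (a i)) + H (a i) ∧ H (E (a i)) = E (H (a i)) + (2 : K) • E (a i) ∧
    H (F (a i)) = F (H (a i)) - (2 : K) • F (a i) ∧ E (E (E (a i))) = 0 ∧ F (F (F (a i))) = 0 ∧
    ∃ μ : K, H (a i) = μ • a i := by
  have e0 : E (a 0) = 0 := hE 0
  have e1 : E (a 1) = a 0 := hE 1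
  have e2 : E (a 2) = a 1 := hE 2
  have f0 : F (a 0) = 2 * a 1 := hF 0
  have f1 : F (a 1) = 2 * a 2 := hF 1
  have f2 : F (a 2) = 0 := hF 2
  have h0 : H (a 0) = 2 * a 0 := hH 0
  have h1 : H (a 1) = 0 := hH 1
  have h2 : H (a 2) = -(2 * a 2) := hH 2
  fin_cases i <;>
    simp only [Fin.zero_eta, Fin.mk_one, Fin.reduceFinMk, e0, e1, e2, f0, f1, f2, h0, h1, h2, der_two_mul, map_zero, map_neg,
      two_smul_poly]
  · exact ⟨by ring, by ring, by ring, by first | trivial | ring, by first | trivial | ring, 2, by rw [two_smul_poly]⟩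
  · exact ⟨by ring, by ring, by ring, by first | trivial | ring, by first | trivial | ring, 0, by simp⟩
  · exact ⟨by ring, by ring, by ring, by first | trivial | ring, by first | trivial | ring, -2, by rw [neg_smul, two_smul_poly]⟩

variable [CharZero K]

theorem P_slt : SlT (dE K : Module.End K (PolyUV K 3)) (dF K : Module.End K (PolyUV K 3))
    (dH K : Module.End K (PolyUV K 3)) := by
  have hu := trip K (dE K) (dF K) (dH K) (uP K 3) (dE_u K) (dF_u K) (dH_u K)
  have hv := trip K (dE K) (dF K) (dH K) (vP K 3) (dE_v K) (dF_v K) (dH_v K)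
  refine der_slt _ _ _ ?_ ?_ ?_ ?_ ?_ <;> rintro (i | i)
  · exact (hu i).1
  · exact (hv i).1
  · exact (hu i).2.1
  · exact (hv i).2.1
  · exact (hu i).2.2.1
  · exact (hv i).2.2.1
  · exact (hu i).2.2.2.1
  · exact (hv i).2.2.2.1
  · exact (hu i).2.2.2.2.1
  · exact (hv i).2.2.2.2.1

theorem P_eig : ∀ i, ∃ μ : K, dH K (X i) = μ • X i := by
  have hu := trip K (dE K) (dF K) (dH K) (uP K 3) (dE_u K) (dF_u K) (dH_u K)
  have hv := trip K (dE K) (dF K) (dH K) (vP K 3) (dE_v K) (dF_v K) (dH_v K)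
  rintro (i | i)
  · exact (hu i).2.2.2.2.2
  · exact (hv i).2.2.2.2.2

theorem P_surj (g : PolyUV K 3) : ∃ h g0, g = dE K h + g0 ∧ dF K g0 = 0 :=
  der_surj _ _ _ (P_slt K) (P_eig K) g

theorem P_inj (p : PolyUV K 3) (h : dF K (dE K p) = 0) : dE K p = 0 :=
  der_inj _ _ _ (P_slt K) (P_eig K) p h

abbrev PQ := MvPolynomial (Fin 3 × Fin 3) K
def qX (j i : Fin 3) : PQ K := X (j, i)
def qE : Derivation K (PQ K) (PQ K) := mkDerivation K (fun t => fE (qX K t.1) t.2)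
def qF : Derivation K (PQ K) (PQ K) := mkDerivation K (fun t => fF (qX K t.1) t.2)
def qH : Derivation K (PQ K) (PQ K) := mkDerivation K (fun t => fH (qX K t.1) t.2)

theorem qE_X (j i : Fin 3) : qE K (qX K j i) = fE (qX K j) i := by simp [qE, qX, mkDerivation_X]
theorem qF_X (j i : Fin 3) : qF K (qX K j i) = fF (qX K j) i := by simp [qF, qX, mkDerivation_X]
theorem qH_X (j i : Fin 3) : qH K (qX K j i) = fH (qX K j) i := by simp [qH, qX, mkDerivation_X]

theorem Q_inj (p : PQ K) (h : qF K (qE K p) = 0) : qE K p = 0 := by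
  have hu := fun j => trip K (qE K) (qF K) (qH K) (qX K j) (qE_X K j) (qF_X K j) (qH_X K j)
  refine der_inj (qE K) (qF K) (qH K) (der_slt _ _ _ ?_ ?_ ?_ ?_ ?_) ?_ p h <;> rintro ⟨j, i⟩
  · exact (hu j i).1
  · exact (hu j i).2.1
  · exact (hu j i).2.2.1
  · exact (hu j i).2.2.2.1
  · exact (hu j i).2.2.2.2.1
  · exact (hu j i).2.2.2.2.2

/-- embedding `K[U,V] → K[U,V,W]` -/
def emb : PolyUV K 3 →ₐ[K] PQ K := rename (Sum.elim (fun i => (0, i)) (fun i => (1, i)))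

theorem emb_inj : Function.Injective (emb K) := by
  refine rename_injective _ ?_
  rintro (i | i) (j | j) h <;> simp at h <;> simp [h]

theorem emb_u (i : Fin 3) : emb K (uP K 3 i) = qX K 0 i := by simp [emb, uP, qX]
theorem emb_v (i : Fin 3) : emb K (vP K 3 i) = qX K 1 i := by simp [emb, vP, qX]

theorem emb_der (D : Derivation K (PolyUV K 3) (PolyUV K 3)) (D' : Derivation K (PQ K) (PQ K))
    (hu : ∀ i, D' (qX K 0 i) = emb K (D (uP K 3 i)))
    (hv : ∀ i, D' (qX K 1 i) = emb K (D (vP K 3 i))) (p : PolyUV K 3) :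
    D' (emb K p) = emb K (D p) := by
  induction p using MvPolynomial.induction_on with
  | C a =>
    rw [← MvPolynomial.algebraMap_eq, AlgHom.commutes, Derivation.map_algebraMap,
      Derivation.map_algebraMap, map_zero]
  | add p q hp hq => simp only [map_add, hp, hq]
  | mul_X p i hp =>
    rw [map_mul, Derivation.leibniz, Derivation.leibniz, hp, map_add, smul_eq_mul, smul_eq_mul,
      smul_eq_mul, smul_eq_mul, map_mul, map_mul]
    rcases i with i | i
    · have := hu i
      rw [← emb_u] at this
      change _ + emb K (X _) * _ = _ + emb K (X _) * _
      exact congrArg (fun z => emb K p * z + _) this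
    · have := hv i
      rw [← emb_v] at this
      change _ + emb K (X _) * _ = _ + emb K (X _) * _
      exact congrArg (fun z => emb K p * z + _) this

theorem emb_E (p : PolyUV K 3) : qE K (emb K p) = emb K (dE K p) := by
  refine emb_der K _ _ ?_ ?_ p
  · intro i
    rw [qE_X, dE_u]
    fin_cases i <;> simp [fE, emb_u]
  · intro i
    rw [qE_X, dE_v]
    fin_cases i <;> simp [fE, emb_v]

theorem emb_F (p : PolyUV K 3) : qF K (emb K p) = emb K (dF K p) := by
  refine emb_der K _ _ ?_ ?_ p
  · intro i
    rw [qF_X, dF_u]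
    fin_cases i <;> simp [fF, emb_u, two_mul]
  · intro i
    rw [qF_X, dF_v]
    fin_cases i <;> simp [fF, emb_v, two_mul]

theorem Q_key (p1 p2 p3 g : PolyUV K 3) (h1 : dE K p1 + p2 = g * vP K 3 2)
    (h2 : dE K p2 + p3 = -(g * vP K 3 1)) (h3 : dE K p3 = g * vP K 3 0) (hg : dF K g = 0) :
    g = 0 := by
  have e0 : qE K (qX K 2 0) = 0 := qE_X K 2 0
  have e1 : qE K (qX K 2 1) = qX K 2 0 := qE_X K 2 1
  have e2 : qE K (qX K 2 2) = qX K 2 1 := qE_X K 2 2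
  have f0 : qF K (qX K 2 0) = 2 * qX K 2 1 := qF_X K 2 0
  have f1 : qF K (qX K 2 1) = 2 * qX K 2 2 := qF_X K 2 1
  have f2 : qF K (qX K 2 2) = 0 := qF_X K 2 2
  have g0 : qF K (qX K 1 0) = 2 * qX K 1 1 := qF_X K 1 0
  have g1 : qF K (qX K 1 1) = 2 * qX K 1 2 := qF_X K 1 1
  have g2 : qF K (qX K 1 2) = 0 := qF_X K 1 2
  have k1 := congrArg (emb K) h1
  have k2 := congrArg (emb K) h2
  have k3 := congrArg (emb K) h3
  simp only [map_add, map_mul, map_neg, emb_v, ← emb_E] at k1 k2 k3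
  have kg : qF K (emb K g) = 0 := by rw [emb_F, hg, map_zero]
  set ρ : PQ K := qX K 2 0 * qX K 1 2 - qX K 2 1 * qX K 1 1 + qX K 2 2 * qX K 1 0 with hρ
  have hE : qE K (emb K p1 * qX K 2 0 + emb K p2 * qX K 2 1 + emb K p3 * qX K 2 2)
      = emb K g * ρ := by
    simp only [map_add, Derivation.leibniz, smul_eq_mul, e0, e1, e2, hρ]
    linear_combination qX K 2 0 * k1 + qX K 2 1 * k2 + qX K 2 2 * k3
  have hF : qF K (emb K g * ρ) = 0 := by
    simp only [hρ, map_add, map_sub, Derivation.leibniz, smul_eq_mul, f0, f1, f2, g0, g1, g2, kg]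
    ring
  have h0 := Q_inj K _ (by rw [hE]; exact hF)
  rw [hE] at h0
  have hρ0 : ρ ≠ 0 := by
    intro h
    have := congrArg (aeval (fun t : Fin 3 × Fin 3 => if t = (2, 0) ∨ t = (1, 2) then (1 : K) else 0)) h
    simp [hρ, qX] at this
  exact emb_inj K (by rw [(mul_eq_zero.1 h0).resolve_right hρ0, map_zero])

end setup

section kerpart

set_option linter.unusedSectionVars false

variable (K : Type*) [Field K] [CharZero K]

open MvPolynomial

local notation "u₀" => uP K 3 0
local notation "u₁" => uP K 3 1
local notation "u₂" => uP K 3 2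
local notation "v₀" => vP K 3 0
local notation "v₁" => vP K 3 1
local notation "v₂" => vP K 3 2

def pJ : PolyUV K 3 := u₀ * v₁ - u₁ * v₀
def pDU : PolyUV K 3 := u₁ ^ 2 - 2 * (u₀ * u₂)
def pDM : PolyUV K 3 := u₀ * v₂ - u₁ * v₁ + u₂ * v₀
def pDV : PolyUV K 3 := v₁ ^ 2 - 2 * (v₀ * v₂)
def pT : PolyUV K 3 := u₁ * v₂ - u₂ * v₁

@[simp] theorem dE_J : dE K (pJ K) = 0 := by
  simp [pJ, Derivation.leibniz]; ring
@[simp] theorem dE_DU : dE K (pDU K) = 0 := by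
  rw [pDU, map_sub, der_two_mul]
  simp [Derivation.leibniz, Derivation.leibniz_pow]; try ring
@[simp] theorem dE_DM : dE K (pDM K) = 0 := by
  simp [pDM, Derivation.leibniz]; ring
@[simp] theorem dE_DV : dE K (pDV K) = 0 := by
  rw [pDV, map_sub, der_two_mul]
  simp [Derivation.leibniz, Derivation.leibniz_pow]; try ring
@[simp] theorem dF_DU : dF K (pDU K) = 0 := by
  rw [pDU, map_sub, der_two_mul]
  simp [Derivation.leibniz, Derivation.leibniz_pow]; try ring
@[simp] theorem dF_DM : dF K (pDM K) = 0 := by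
  simp [pDM, Derivation.leibniz]; ring
@[simp] theorem dF_DV : dF K (pDV K) = 0 := by
  rw [pDV, map_sub, der_two_mul]
  simp [Derivation.leibniz, Derivation.leibniz_pow]; try ring
theorem dE_T : dE K (pT K) = u₀ * v₂ - u₂ * v₀ := by
  simp [pT, Derivation.leibniz]; ring
theorem dE_dE_T : dE K (dE K (pT K)) = pJ K := by
  rw [dE_T]; simp [pJ, Derivation.leibniz]; ring

theorem hom_u (i : Fin 3) : (uP K 3 i).IsHomogeneous 1 := isHomogeneous_X _ _
theorem hom_v (i : Fin 3) : (vP K 3 i).IsHomogeneous 1 := isHomogeneous_X _ _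
theorem hom_two (p : PolyUV K 3) (n : ℕ) (h : p.IsHomogeneous n) : (2 * p).IsHomogeneous n := by
  rw [two_mul]; exact h.add h
theorem hom_J : (pJ K).IsHomogeneous 2 := ((hom_u K 0).mul (hom_v K 1)).sub ((hom_u K 1).mul (hom_v K 0))
theorem hom_T : (pT K).IsHomogeneous 2 := ((hom_u K 1).mul (hom_v K 2)).sub ((hom_u K 2).mul (hom_v K 1))
theorem hom_DU : (pDU K).IsHomogeneous 2 := 
  ((hom_u K 1).pow 2).sub (hom_two K _ _ ((hom_u K 0).mul (hom_u K 2)))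
theorem hom_DV : (pDV K).IsHomogeneous 2 :=
  ((hom_v K 1).pow 2).sub (hom_two K _ _ ((hom_v K 0).mul (hom_v K 2)))
theorem hom_DM : (pDM K).IsHomogeneous 2 :=
  (((hom_u K 0).mul (hom_v K 2)).sub ((hom_u K 1).mul (hom_v K 1))).add ((hom_u K 2).mul (hom_v K 0))

def bm (a b c d e k : ℕ) : PolyUV K 3 :=
  u₀ ^ a * v₀ ^ b * pJ K ^ c * pDU K ^ d * pDM K ^ e * pDV K ^ k

def Bset (n : ℕ) : Set (PolyUV K 3) :=
  {f | ∃ a b c d e k : ℕ, a + b + 2 * c + 2 * d + 2 * e + 2 * k = n ∧ f = bm K a b c d e k}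

/-- Degree `n` part of the algebra generated by the six basic invariants. -/
def Bn (n : ℕ) : Submodule K (PolyUV K 3) := Submodule.span K (Bset K n)

theorem bm_mem (a b c d e k n : ℕ) (h : a + b + 2 * c + 2 * d + 2 * e + 2 * k = n) :
    bm K a b c d e k ∈ Bn K n := Submodule.subset_span ⟨a, b, c, d, e, k, h, rfl⟩

theorem Bn_mul {n m : ℕ} {x y : PolyUV K 3} (hx : x ∈ Bn K n) (hy : y ∈ Bn K m) :
    x * y ∈ Bn K (n + m) := by
  have h := Submodule.mul_mem_mul hx hy
  rw [Bn, Bn, Submodule.span_mul_span] at h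
  refine Submodule.span_mono ?_ h
  rintro _ ⟨_, ⟨a, b, c, d, e, k, h, rfl⟩, _, ⟨a', b', c', d', e', k', h', rfl⟩, rfl⟩
  refine ⟨a + a', b + b', c + c', d + d', e + e', k + k', by omega, ?_⟩
  simp only [bm, pow_add]; ring

theorem Bn_ker {n : ℕ} {x : PolyUV K 3} (hx : x ∈ Bn K n) : dE K x = 0 := by
  refine Submodule.span_induction (p := fun x _ => dE K x = 0) ?_ (by simp) ?_ ?_ hx
  · rintro _ ⟨a, b, c, d, e, k, h, rfl⟩
    simp [bm, Derivation.leibniz, Derivation.leibniz_pow]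
  · intro x y _ _ hx hy; rw [map_add, hx, hy, add_zero]
  · intro a x _ hx; rw [Derivation.map_smul, hx, smul_zero]

theorem Bn_hom {n : ℕ} {x : PolyUV K 3} (hx : x ∈ Bn K n) : x.IsHomogeneous n := by
  suffices Bn K n ≤ homogeneousSubmodule _ K n from this hx
  refine Submodule.span_le.2 ?_
  rintro _ ⟨a, b, c, d, e, k, h, rfl⟩
  have := (((((hom_u K 0).pow a).mul ((hom_v K 0).pow b)).mul ((hom_J K).pow c)).mul
    ((hom_DU K).pow d)).mul ((hom_DM K).pow e) |>.mul ((hom_DV K).pow k)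
  have e : 1 * a + 1 * b + 2 * c + 2 * d + 2 * e + 2 * k = n := by omega
  rw [e] at this
  exact this

theorem u0_mem : u₀ ∈ Bn K 1 := by simpa [bm] using bm_mem K 1 0 0 0 0 0 1 rfl
theorem v0_mem : v₀ ∈ Bn K 1 := by simpa [bm] using bm_mem K 0 1 0 0 0 0 1 rfl
theorem J_mem : pJ K ∈ Bn K 2 := by simpa [bm] using bm_mem K 0 0 1 0 0 0 2 rfl
theorem DU_mem : pDU K ∈ Bn K 2 := by simpa [bm] using bm_mem K 0 0 0 1 0 0 2 rfl
theorem DM_mem : pDM K ∈ Bn K 2 := by simpa [bm] using bm_mem K 0 0 0 0 1 0 2 rfl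
theorem DV_mem : pDV K ∈ Bn K 2 := by simpa [bm] using bm_mem K 0 0 0 0 0 1 2 rfl
theorem one_mem_B : (1 : PolyUV K 3) ∈ Bn K 0 := by simpa [bm] using bm_mem K 0 0 0 0 0 0 0 rfl

inductive Gen : ℕ → PolyUV K 3 → Prop
  | one : Gen 0 1
  | u1 : Gen 1 u₁
  | v1 : Gen 1 v₁
  | u2 : Gen 1 u₂
  | v2 : Gen 1 v₂
  | t : Gen 2 (pT K)

def Gn (n : ℕ) : Submodule K (PolyUV K 3) :=
  Submodule.span K {f | ∃ m k g t, m + k = n ∧ g ∈ Bn K m ∧ Gen K k t ∧ f = g * t}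

theorem Gn_mem {n m k : ℕ} {g t : PolyUV K 3} (hg : g ∈ Bn K m) (ht : Gen K k t) (h : m + k = n) :
    g * t ∈ Gn K n := Submodule.subset_span ⟨m, k, g, t, h, hg, ht, rfl⟩

theorem Gn_hom {n : ℕ} {x : PolyUV K 3} (hx : x ∈ Gn K n) : x.IsHomogeneous n := by
  suffices Gn K n ≤ homogeneousSubmodule _ K n from this hx
  refine Submodule.span_le.2 ?_
  rintro _ ⟨m, k, g, t, rfl, hg, ht, rfl⟩
  refine (Bn_hom K hg).mul ?_
  cases ht
  · exact isHomogeneous_one _ _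
  · exact hom_u K 1
  · exact hom_v K 1
  · exact hom_u K 2
  · exact hom_v K 2
  · exact hom_T K

theorem dE_Bmul {n : ℕ} {g : PolyUV K 3} (hg : g ∈ Bn K n) (t : PolyUV K 3) :
    dE K (g * t) = g * dE K t := by
  rw [Derivation.leibniz, Bn_ker K hg]; simp

theorem tU {n : ℕ} {r : PolyUV K 3} (hr : r ∈ Gn K n) :
    u₀ * r - u₁ * dE K r + u₂ * dE K (dE K r) ∈ Bn K (n + 1) := by
  refine Submodule.span_induction
    (p := fun r _ => u₀ * r - u₁ * dE K r + u₂ * dE K (dE K r) ∈ Bn K (n + 1)) ?_ (by simp) ?_ ?_ hr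
  · rintro _ ⟨m, k, g, t, rfl, hg, ht, rfl⟩
    have e : u₀ * (g * t) - u₁ * dE K (g * t) + u₂ * dE K (dE K (g * t)) =
        g * (u₀ * t - u₁ * dE K t + u₂ * dE K (dE K t)) := by
      rw [dE_Bmul K hg, dE_Bmul K hg]; ring
    rw [e, add_assoc]
    refine Bn_mul K hg ?_
    cases ht
    · simpa using u0_mem K
    · convert zero_mem (Bn K 2) using 1; simp; ring
    · convert J_mem K using 1; simp [pJ]
    · convert neg_mem (DU_mem K) using 1; simp [pDU]; ring
    · convert DM_mem K using 1; simp [pDM]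
    · convert zero_mem (Bn K 3) using 1; rw [dE_dE_T, dE_T, pT, pJ]; ring
  · intro x y _ _ hx hy
    convert add_mem hx hy using 1
    simp only [map_add]; ring
  · intro a x _ hx
    convert Submodule.smul_mem _ a hx using 1
    simp only [Derivation.map_smul, mul_smul_comm, smul_add, smul_sub]

theorem tV {n : ℕ} {r : PolyUV K 3} (hr : r ∈ Gn K n) :
    v₀ * r - v₁ * dE K r + v₂ * dE K (dE K r) ∈ Bn K (n + 1) := by
  refine Submodule.span_induction
    (p := fun r _ => v₀ * r - v₁ * dE K r + v₂ * dE K (dE K r) ∈ Bn K (n + 1)) ?_ (by simp) ?_ ?_ hr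
  · rintro _ ⟨m, k, g, t, rfl, hg, ht, rfl⟩
    have e : v₀ * (g * t) - v₁ * dE K (g * t) + v₂ * dE K (dE K (g * t)) =
        g * (v₀ * t - v₁ * dE K t + v₂ * dE K (dE K t)) := by
      rw [dE_Bmul K hg, dE_Bmul K hg]; ring
    rw [e, add_assoc]
    refine Bn_mul K hg ?_
    cases ht
    · simpa using v0_mem K
    · convert neg_mem (J_mem K) using 1; simp [pJ]; ring
    · convert zero_mem (Bn K 2) using 1; simp; ring
    · convert DM_mem K using 1; simp [pDM]; ring
    · convert neg_mem (DV_mem K) using 1; simp [pDV]; ring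
    · convert zero_mem (Bn K 3) using 1; rw [dE_dE_T, dE_T, pT, pJ]; ring
  · intro x y _ _ hx hy
    convert add_mem hx hy using 1
    simp only [map_add]; ring
  · intro a x _ hx
    convert Submodule.smul_mem _ a hx using 1
    simp only [Derivation.map_smul, mul_smul_comm, smul_add, smul_sub]

theorem Bset_cases {n : ℕ} {f : PolyUV K 3} (hf : f ∈ Bset K n) :
    dF K f = 0 ∨ (∃ m, ∃ g ∈ Bn K m, m + 1 = n ∧ f = g * u₀) ∨
    (∃ m, ∃ g ∈ Bn K m, m + 1 = n ∧ f = g * v₀) ∨ (∃ m, ∃ g ∈ Bn K m, m + 2 = n ∧ f = g * pJ K) := by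
  obtain ⟨a, b, c, d, e, k, h, rfl⟩ := hf
  rcases a with _ | a
  · rcases b with _ | b
    · rcases c with _ | c
      · left
        simp [bm, Derivation.leibniz, Derivation.leibniz_pow]
      · right; right; right
        exact ⟨_, _, bm_mem K 0 0 c d e k _ rfl, by omega, by simp only [bm, pow_succ]; ring⟩
    · right; right; left
      exact ⟨_, _, bm_mem K 0 b c d e k _ rfl, by omega, by simp only [bm, pow_succ]; ring⟩
  · right; left
    exact ⟨_, _, bm_mem K a b c d e k _ rfl, by omega, by simp only [bm, pow_succ]; ring⟩

theorem lift2 {n : ℕ} {f : PolyUV K 3} (hf : f ∈ Bn K n) :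
    ∃ i r, dF K i = 0 ∧ r ∈ Gn K n ∧ f = i + dE K (dE K r) := by
  refine Submodule.span_induction
    (p := fun f _ => ∃ i r, dF K i = 0 ∧ r ∈ Gn K n ∧ f = i + dE K (dE K r)) ?_ ?_ ?_ ?_ hf
  · intro f hf
    rcases Bset_cases K hf with h | ⟨m, g, hg, h, rfl⟩ | ⟨m, g, hg, h, rfl⟩ | ⟨m, g, hg, h, rfl⟩
    · exact ⟨f, 0, h, zero_mem _, by simp⟩
    · exact ⟨0, g * u₂, by simp, Gn_mem K hg Gen.u2 h, by simp [dE_Bmul K hg]⟩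
    · exact ⟨0, g * v₂, by simp, Gn_mem K hg Gen.v2 h, by simp [dE_Bmul K hg]⟩
    · exact ⟨0, g * pT K, by simp, Gn_mem K hg Gen.t h, by rw [dE_Bmul K hg, dE_Bmul K hg, dE_dE_T, zero_add]⟩
  · exact ⟨0, 0, by simp, zero_mem _, by simp⟩
  · rintro x y _ _ ⟨i, r, h1, h2, rfl⟩ ⟨i', r', h1', h2', rfl⟩
    exact ⟨i + i', r + r', by simp [h1, h1'], add_mem h2 h2', by simp only [map_add]; ring⟩
  · rintro a x _ ⟨i, r, h1, h2, rfl⟩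
    exact ⟨a • i, a • r, by simp [h1], Submodule.smul_mem _ _ h2, by simp⟩

theorem lift1 {n : ℕ} {f : PolyUV K 3} (hf : f ∈ Bn K n) :
    ∃ i r, dF K i = 0 ∧ r ∈ Gn K n ∧ f = i + dE K r := by
  refine Submodule.span_induction
    (p := fun f _ => ∃ i r, dF K i = 0 ∧ r ∈ Gn K n ∧ f = i + dE K r) ?_ ?_ ?_ ?_ hf
  · intro f hf
    rcases Bset_cases K hf with h | ⟨m, g, hg, h, rfl⟩ | ⟨m, g, hg, h, rfl⟩ | ⟨m, g, hg, h, rfl⟩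
    · exact ⟨f, 0, h, zero_mem _, by simp⟩
    · exact ⟨0, g * u₁, by simp, Gn_mem K hg Gen.u1 h, by simp [dE_Bmul K hg]⟩
    · exact ⟨0, g * v₁, by simp, Gn_mem K hg Gen.v1 h, by simp [dE_Bmul K hg]⟩
    · refine ⟨0, (g * u₀) * v₂ - (g * v₀) * u₂, by simp, sub_mem
        (Gn_mem K (Bn_mul K hg (u0_mem K)) Gen.v2 h) (Gn_mem K (Bn_mul K hg (v0_mem K)) Gen.u2 h), ?_⟩
      rw [map_sub, dE_Bmul K (Bn_mul K hg (u0_mem K)), dE_Bmul K (Bn_mul K hg (v0_mem K))]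
      simp [pJ]; ring
  · exact ⟨0, 0, by simp, zero_mem _, by simp⟩
  · rintro x y _ _ ⟨i, r, h1, h2, rfl⟩ ⟨i', r', h1', h2', rfl⟩
    exact ⟨i + i', r + r', by simp [h1, h1'], add_mem h2 h2', by simp only [map_add]; ring⟩
  · rintro a x _ ⟨i, r, h1, h2, rfl⟩
    exact ⟨a • i, a • r, by simp [h1], Submodule.smul_mem _ _ h2, by simp⟩

theorem dE_expand (f : PolyUV K 3) : dE K f =
    u₀ * pderiv (Sum.inl 1) f + u₁ * pderiv (Sum.inl 2) f +
    (v₀ * pderiv (Sum.inr 1) f + v₁ * pderiv (Sum.inr 2) f) := by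
  have : dE K = u₀ • pderiv (Sum.inl 1) + u₁ • pderiv (Sum.inl 2) +
    (v₀ • pderiv (Sum.inr 1) + v₁ • pderiv (Sum.inr 2)) := by
    refine derivation_ext ?_
    rintro (i | i)
    · change dE K (uP K 3 i) = _
      rw [dE_u]
      fin_cases i <;> simp [fE, pderiv_X, Pi.single_apply]
    · change dE K (vP K 3 i) = _
      rw [dE_v]
      fin_cases i <;> simp [fE, pderiv_X, Pi.single_apply]
  rw [this]; simp

theorem dE_hom {n : ℕ} {f : PolyUV K 3} (hf : f.IsHomogeneous n) : (dE K f).IsHomogeneous n := by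
  rcases n with _ | n
  · rw [← totalDegree_zero_iff_isHomogeneous, totalDegree_eq_zero_iff_eq_C] at hf
    rw [hf, derivation_C]; apply isHomogeneous_zero
  · rw [dE_expand]
    have h : ∀ i, (pderiv i f).IsHomogeneous n := fun i => hf.pderiv
    rw [add_comm n 1]
    exact (((hom_u K 0).mul (h _)).add ((hom_u K 1).mul (h _))).add
      (((hom_v K 0).mul (h _)).add ((hom_v K 1).mul (h _)))

theorem pd_comm {i j : Fin 3 ⊕ Fin 3} (h : ∀ k, pderiv i (dE K (X k)) = pderiv j (X k))
    {f : PolyUV K 3} (hf : dE K f = 0) : dE K (pderiv i f) = -pderiv j f := by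
  have : ⁅pderiv i, dE K⁆ = pderiv j := derivation_ext fun k => by
    rw [Derivation.commutator_apply, h, pderiv_X]
    rw [sub_eq_self]
    rcases eq_or_ne k i with rfl | hk
    · simp
    · simp [hk]
  have := congrArg (fun D => D f) this
  simp only [Derivation.commutator_apply, hf, map_zero, zero_sub] at this
  rw [← this, neg_neg]

theorem pd_comm0 {i : Fin 3 ⊕ Fin 3} (h : ∀ k, pderiv i (dE K (X k)) = 0)
    {f : PolyUV K 3} (hf : dE K f = 0) : dE K (pderiv i f) = 0 := by
  have : ⁅pderiv i, dE K⁆ = 0 := derivation_ext fun k => by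
    rw [Derivation.commutator_apply, h, pderiv_X]
    rcases eq_or_ne k i with rfl | hk
    · simp
    · simp [hk]
  have := congrArg (fun D => D f) this
  simp only [Derivation.commutator_apply, hf, map_zero, zero_sub] at this
  simpa using this

theorem dE_X_cases (k : Fin 3 ⊕ Fin 3) : dE K (X k) = Sum.elim (fE (uP K 3)) (fE (vP K 3)) k := by
  simp [dE, mkDerivation_X]

theorem stepA {n : ℕ} (hB : ∀ q : PolyUV K 3, q.IsHomogeneous n → dE K (dE K (dE K q)) = 0 → q ∈ Gn K n)
    {f : PolyUV K 3} (hf : f.IsHomogeneous (n + 1)) (h0 : dE K f = 0) : f ∈ Bn K (n + 1) := by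
  have a0 : dE K (pderiv (Sum.inl 0) f) = -pderiv (Sum.inl 1) f := pd_comm K (by
    rintro (k | k) <;> rw [dE_X_cases] <;> fin_cases k <;> simp [fE, uP, vP, pderiv_X, Pi.single_apply]) h0
  have a1 : dE K (pderiv (Sum.inl 1) f) = -pderiv (Sum.inl 2) f := pd_comm K (by
    rintro (k | k) <;> rw [dE_X_cases] <;> fin_cases k <;> simp [fE, uP, vP, pderiv_X, Pi.single_apply]) h0
  have a2 : dE K (pderiv (Sum.inl 2) f) = 0 := pd_comm0 K (by
    rintro (k | k) <;> rw [dE_X_cases] <;> fin_cases k <;> simp [fE, uP, vP, pderiv_X, Pi.single_apply]) h0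
  have b0 : dE K (pderiv (Sum.inr 0) f) = -pderiv (Sum.inr 1) f := pd_comm K (by
    rintro (k | k) <;> rw [dE_X_cases] <;> fin_cases k <;> simp [fE, uP, vP, pderiv_X, Pi.single_apply]) h0
  have b1 : dE K (pderiv (Sum.inr 1) f) = -pderiv (Sum.inr 2) f := pd_comm K (by
    rintro (k | k) <;> rw [dE_X_cases] <;> fin_cases k <;> simp [fE, uP, vP, pderiv_X, Pi.single_apply]) h0
  have b2 : dE K (pderiv (Sum.inr 2) f) = 0 := pd_comm0 K (by
    rintro (k | k) <;> rw [dE_X_cases] <;> fin_cases k <;> simp [fE, uP, vP, pderiv_X, Pi.single_apply]) h0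
  have hU := tU K (hB (pderiv (Sum.inl 0) f) hf.pderiv (by rw [a0, map_neg, a1, neg_neg, a2]))
  have hV := tV K (hB (pderiv (Sum.inr 0) f) hf.pderiv (by rw [b0, map_neg, b1, neg_neg, b2]))
  rw [a0, map_neg, a1, neg_neg] at hU
  rw [b0, map_neg, b1, neg_neg] at hV
  have he := hf.sum_X_mul_pderiv
  rw [Fintype.sum_sum_type, Fin.sum_univ_three, Fin.sum_univ_three] at he
  have hm := add_mem hU hV
  have e : u₀ * pderiv (Sum.inl 0) f - u₁ * -pderiv (Sum.inl 1) f + u₂ * pderiv (Sum.inl 2) f +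
    (v₀ * pderiv (Sum.inr 0) f - v₁ * -pderiv (Sum.inr 1) f + v₂ * pderiv (Sum.inr 2) f)
    = (n + 1 : K) • f := by
    have : (n + 1 : K) • f = (n + 1) • f := by
      rw [← Nat.cast_smul_eq_nsmul K]; push_cast; rfl
    rw [this, ← he, uP, uP, uP, vP, vP, vP]; ring
  rw [e] at hm
  exact (Submodule.smul_mem_iff _ (nat_succ_ne n)).1 hm

theorem stepB {n : ℕ} (hA : ∀ f : PolyUV K 3, f.IsHomogeneous n → dE K f = 0 → f ∈ Bn K n)
    {q : PolyUV K 3} (hq : q.IsHomogeneous n) (h0 : dE K (dE K (dE K q)) = 0) : q ∈ Gn K n := by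
  obtain ⟨i, r, hi, hr, h⟩ := lift2 K (hA _ (dE_hom K (dE_hom K hq)) h0)
  have hi0 : i = dE K (dE K (q - r)) := by rw [map_sub, map_sub, h]; ring
  have hi1 : dE K (dE K (q - r)) = 0 := P_inj K _ (by rw [← hi0, hi])
  obtain ⟨i', r', hi', hr', h'⟩ := lift1 K (hA _ (dE_hom K (hq.sub (Gn_hom K hr))) hi1)
  have hj0 : i' = dE K (q - r - r') := by rw [map_sub, h']; ring
  have hj1 : dE K (q - r - r') = 0 := P_inj K _ (by rw [← hj0, hi'])
  have h2 := hA _ ((hq.sub (Gn_hom K hr)).sub (Gn_hom K hr')) hj1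
  have h3 : q - r - r' ∈ Gn K n := by
    have := Gn_mem K h2 Gen.one (n := n) rfl
    rwa [mul_one] at this
  have : q = (q - r - r') + r' + r := by ring
  rw [this]
  exact add_mem (add_mem h3 hr') hr

theorem AB (n : ℕ) : ∀ f : PolyUV K 3, f.IsHomogeneous n → dE K f = 0 → f ∈ Bn K n := by
  induction n with
  | zero =>
    intro f hf _
    rw [← totalDegree_zero_iff_isHomogeneous, totalDegree_eq_zero_iff_eq_C] at hf
    rw [hf, C_eq_smul_one]
    exact Submodule.smul_mem _ _ (one_mem_B K)
  | succ n ih =>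
    intro f hf h0
    exact stepA K (fun q hq h => stepB K ih hq h) hf h0

theorem comp_dE (n : ℕ) (q : PolyUV K 3) :
    homogeneousComponent n (dE K q) = dE K (homogeneousComponent n q) := by
  conv_lhs => rw [← sum_homogeneousComponent q]
  rw [map_sum, map_sum]
  have : ∀ i, homogeneousComponent n (dE K (homogeneousComponent i q)) =
      if i = n then dE K (homogeneousComponent n q) else 0 := by
    intro i
    rw [homogeneousComponent_of_mem (dE_hom K (homogeneousComponent_isHomogeneous i q))]
    split_ifs with h1 h2 h2
    · rw [h2]
    · exact absurd h1.symm h2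
    · exact absurd h2.symm h1
    · rfl
  simp only [this, Finset.sum_ite_eq', Finset.mem_range]
  split_ifs with h
  · rfl
  · rw [homogeneousComponent_eq_zero _ _ (by omega), map_zero]

theorem ker3 (q : PolyUV K 3) (h0 : dE K (dE K (dE K q)) = 0) :
    ∃ a b c d e g, dE K a = 0 ∧ dE K b = 0 ∧ dE K c = 0 ∧ dE K d = 0 ∧ dE K e = 0 ∧ dE K g = 0 ∧
      q = a + b * u₁ + c * v₁ + d * u₂ + e * v₂ + g * pT K := by
  let S : Submodule K (PolyUV K 3) :=
    { carrier := {q | ∃ a b c d e g, dE K a = 0 ∧ dE K b = 0 ∧ dE K c = 0 ∧ dE K d = 0 ∧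
        dE K e = 0 ∧ dE K g = 0 ∧ q = a + b * u₁ + c * v₁ + d * u₂ + e * v₂ + g * pT K}
      zero_mem' := ⟨0, 0, 0, 0, 0, 0, by simp⟩
      add_mem' := by
        rintro _ _ ⟨a, b, c, d, e, g, h1, h2, h3, h4, h5, h6, rfl⟩
          ⟨a', b', c', d', e', g', h1', h2', h3', h4', h5', h6', rfl⟩
        exact ⟨a + a', b + b', c + c', d + d', e + e', g + g', by simp [h1, h1'], by simp [h2, h2'],
          by simp [h3, h3'], by simp [h4, h4'], by simp [h5, h5'], by simp [h6, h6'], by ring⟩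
      smul_mem' := by
        rintro k _ ⟨a, b, c, d, e, g, h1, h2, h3, h4, h5, h6, rfl⟩
        exact ⟨k • a, k • b, k • c, k • d, k • e, k • g, by simp [h1], by simp [h2],
          by simp [h3], by simp [h4], by simp [h5], by simp [h6],
          by simp only [smul_add, smul_mul_assoc]⟩ }
  suffices q ∈ S from this
  have hG : ∀ n, Gn K n ≤ S := by
    intro n
    refine Submodule.span_le.2 ?_
    rintro _ ⟨m, k, g, t, rfl, hg, ht, rfl⟩
    have h := Bn_ker K hg
    cases ht
    · exact ⟨g, 0, 0, 0, 0, 0, by simp [h]⟩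
    · exact ⟨0, g, 0, 0, 0, 0, by simp [h]⟩
    · exact ⟨0, 0, g, 0, 0, 0, by simp [h]⟩
    · exact ⟨0, 0, 0, g, 0, 0, by simp [h]⟩
    · exact ⟨0, 0, 0, 0, g, 0, by simp [h]⟩
    · exact ⟨0, 0, 0, 0, 0, g, by simp [h]⟩
  rw [← sum_homogeneousComponent q]
  refine sum_mem fun n _ => hG n (stepB K (AB K n) (homogeneousComponent_isHomogeneous n q) ?_)
  rw [← comp_dE, ← comp_dE, ← comp_dE, h0, map_zero]

end kerpart

section struct

theorem exists_comm_aeval {K A σ : Type*} [Field K] [Semiring A] [Algebra K A]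
    (o : σ → A) (h : ∀ k l, o k * o l = o l * o k) :
    ∃ P : MvPolynomial σ K →ₐ[K] A, ∀ k, P (MvPolynomial.X k) = o k := by
  letI : CommSemiring (Algebra.adjoin K (Set.range o)) :=
    { (inferInstance : Semiring (Algebra.adjoin K (Set.range o))) with
      mul_comm := by
        have := Algebra.isMulCommutative_adjoin K (s := Set.range o)
          (by rintro _ ⟨k, rfl⟩ _ ⟨l, rfl⟩; exact h k l)
        exact this.is_comm.comm }
  let g : σ → Algebra.adjoin K (Set.range o) := fun k => ⟨o k, Algebra.subset_adjoin ⟨k, rfl⟩⟩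
  refine ⟨(Algebra.adjoin K (Set.range o)).val.comp (MvPolynomial.aeval g), fun k => ?_⟩
  simp [g]

variable (K : Type*) [Field K]

theorem mk_surj (y : FreeMetab K 3) :
    ∃ a : FreeAlgebra K (Fin 3), RingQuot.mkAlgHom K (MetabRel K 3) a = y :=
  RingQuot.mkAlgHom_surjective K (MetabRel K 3) y

theorem metab_rel (a b c e : FreeMetab K 3) : (a * b - b * a) * (c * e - e * c) = 0 := by
  obtain ⟨a, rfl⟩ := mk_surj K a
  obtain ⟨b, rfl⟩ := mk_surj K b
  obtain ⟨c, rfl⟩ := mk_surj K c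
  obtain ⟨e, rfl⟩ := mk_surj K e
  have h : MetabRel K 3 ((a * b - b * a) * (c * e - e * c)) 0 := ⟨rfl, a, b, c, e, rfl⟩
  have := RingQuot.mkAlgHom_rel K h
  simpa only [map_mul, map_sub, map_zero] using this

theorem metab_rel' (a b y c e : FreeMetab K 3) :
    (a * b - b * a) * y * (c * e - e * c) = 0 := by
  have h1 := metab_rel K a (b * y) c e
  have h2 := metab_rel K a y c e
  have : (a * b - b * a) * y = (a * (b * y) - b * y * a) - b * (a * y - y * a) := by
    simp only [mul_sub, sub_mul, mul_assoc]; abel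
  rw [this, sub_mul, h1, mul_assoc, h2]; simp

theorem comm_mem (f g : FreeMetab K 3) : f * g - g * f ∈ commIdeal K 3 :=
  Ideal.subset_span ⟨1, f, g, 1, by simp⟩

theorem comm_mul {w : FreeMetab K 3} (hw : w ∈ commIdeal K 3) (f g : FreeMetab K 3) :
    (f * g - g * f) * w = 0 := by
  have : ∀ y, (f * g - g * f) * y * w = 0 := by
    refine Submodule.span_induction (p := fun w _ => ∀ y, (f * g - g * f) * y * w = 0) ?_ ?_ ?_ ?_ hw
    · rintro _ ⟨a, c, e, b, rfl⟩ y
      have := metab_rel' K f g (y * a) c e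
      calc (f * g - g * f) * y * (a * (c * e - e * c) * b)
          = ((f * g - g * f) * (y * a) * (c * e - e * c)) * b := by simp only [mul_assoc]
        _ = 0 := by rw [this, zero_mul]
    · simp
    · intro x y _ _ hx hy z; rw [mul_add, hx, hy, add_zero]
    · intro a x _ hx y
      rw [smul_eq_mul, ← mul_assoc, mul_assoc _ y a]; exact hx _
  simpa using this 1

theorem mul_commutator {w : FreeMetab K 3} (hw : w ∈ commIdeal K 3) (f g : FreeMetab K 3) :
    w * (f * g - g * f) = 0 := by
  refine Submodule.span_induction (p := fun w _ => w * (f * g - g * f) = 0) ?_ ?_ ?_ ?_ hw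
  · rintro _ ⟨a, c, e, b, rfl⟩
    have := metab_rel' K c e b f g
    calc a * (c * e - e * c) * b * (f * g - g * f) = a * ((c * e - e * c) * b * (f * g - g * f)) := by
          simp only [mul_assoc]
      _ = 0 := by rw [this, mul_zero]
  · simp
  · intro x y _ _ hx hy; rw [add_mul, hx, hy, add_zero]
  · intro a x _ hx
    rw [smul_eq_mul, mul_assoc, hx, mul_zero]

theorem mem_mul_right {w : FreeMetab K 3} (hw : w ∈ commIdeal K 3) (y : FreeMetab K 3) :
    w * y ∈ commIdeal K 3 := by
  refine Submodule.span_induction (p := fun w _ => w * y ∈ commIdeal K 3) ?_ ?_ ?_ ?_ hw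
  · rintro _ ⟨a, c, e, b, rfl⟩
    exact Ideal.subset_span ⟨a, c, e, b * y, by simp only [mul_assoc]⟩
  · simp
  · intro x y _ _ hx hy; rw [add_mul]; exact add_mem hx hy
  · intro a x _ hx
    rw [smul_eq_mul, mul_assoc]; exact Ideal.mul_mem_left _ _ hx

theorem mem_mul_left {w : FreeMetab K 3} (hw : w ∈ commIdeal K 3) (y : FreeMetab K 3) :
    y * w ∈ commIdeal K 3 := Ideal.mul_mem_left _ _ hw

/-- The commutator ideal as a vector space. -/
def CS : Submodule K (FreeMetab K 3) := (commIdeal K 3).restrictScalars K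

theorem mem_CS {w : FreeMetab K 3} : w ∈ CS K ↔ w ∈ commIdeal K 3 :=
  Submodule.restrictScalars_mem K (commIdeal K 3) w

def opL (i : Fin 3) : Module.End K (FreeMetab K 3) := LinearMap.mulLeft K (xg K 3 i)
def opD (i : Fin 3) : Module.End K (FreeMetab K 3) :=
  LinearMap.mulRight K (xg K 3 i) - LinearMap.mulLeft K (xg K 3 i)

def opF (k : Fin 3 ⊕ Fin 3) : Module.End K (FreeMetab K 3) := Sum.elim (opL K) (opD K) k

theorem opF_inl (i : Fin 3) (w : FreeMetab K 3) : opF K (Sum.inl i) w = xg K 3 i * w := rfl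
theorem opF_inr (i : Fin 3) (w : FreeMetab K 3) :
    opF K (Sum.inr i) w = w * xg K 3 i - xg K 3 i * w := rfl

theorem opF_mem (k : Fin 3 ⊕ Fin 3) (w : FreeMetab K 3) (hw : w ∈ CS K) : opF K k w ∈ CS K := by
  rw [mem_CS] at *
  rcases k with i | i
  · rw [opF_inl]; exact mem_mul_left K hw _
  · rw [opF_inr]; exact sub_mem (mem_mul_right K hw _) (mem_mul_left K hw _)

def opC (k : Fin 3 ⊕ Fin 3) : Module.End K (CS K) := (opF K k).restrict (opF_mem K k)

theorem opC_coe (k : Fin 3 ⊕ Fin 3) (w : CS K) : ((opC K k w : CS K) : FreeMetab K 3) = opF K k w := rfl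

theorem opC_pow_coe (k : Fin 3 ⊕ Fin 3) (n : ℕ) (w : CS K) :
    (((opC K k ^ n) w : CS K) : FreeMetab K 3) = (opF K k ^ n) w := by
  induction n with
  | zero => simp
  | succ n ih => rw [pow_succ', pow_succ', Module.End.mul_apply, Module.End.mul_apply, opC_coe, ih]

theorem opC_comm (k l : Fin 3 ⊕ Fin 3) : opC K k * opC K l = opC K l * opC K k := by
  ext w
  simp only [Module.End.mul_apply, opC_coe]
  obtain ⟨w, hw⟩ := w
  rw [mem_CS] at hw
  have h1 : ∀ f g, f * g * w = g * f * w := fun f g => by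
    have := comm_mul K hw f g
    rwa [sub_mul, sub_eq_zero] at this
  have h2 : ∀ f g, w * (f * g) = w * (g * f) := fun f g => by
    have := mul_commutator K hw f g
    rwa [mul_sub, sub_eq_zero] at this
  rcases k with i | i <;> rcases l with j | j <;> simp only [opF_inl, opF_inr]
  · rw [← mul_assoc, ← mul_assoc, h1]
  · rw [mul_sub, ← mul_assoc (xg K 3 i) (xg K 3 j) w, h1]; simp only [mul_assoc]
  · rw [mul_sub, ← mul_assoc (xg K 3 j) (xg K 3 i) w, h1]; simp only [mul_assoc]
  · have e1 := h1 (xg K 3 i) (xg K 3 j)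
    have e2 := h2 (xg K 3 i) (xg K 3 j)
    simp only [mul_sub, sub_mul, mul_assoc] at *
    rw [e1, e2]; abel

def Phi : PolyUV K 3 →ₐ[K] Module.End K (CS K) := (exists_comm_aeval (opC K) (opC_comm K)).choose

theorem Phi_X (k : Fin 3 ⊕ Fin 3) : Phi K (MvPolynomial.X k) = opC K k :=
  (exists_comm_aeval (opC K) (opC_comm K)).choose_spec k

theorem act_subset (p : PolyUV K 3) (w : FreeMetab K 3) (S : Finset ((Fin 3 ⊕ Fin 3) →₀ ℕ))
    (hS : p.support ⊆ S) : act K 3 p w = ∑ m ∈ S, p.coeff m • (monAct K 3 m w) := by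
  unfold act
  refine Finset.sum_subset hS ?_
  intro m _ hm
  rw [MvPolynomial.notMem_support_iff.1 hm, zero_smul]

theorem act_add (p q : PolyUV K 3) (w : FreeMetab K 3) :
    act K 3 (p + q) w = act K 3 p w + act K 3 q w := by
  classical
  rw [act_subset K p w (p.support ∪ q.support) Finset.subset_union_left,
    act_subset K q w (p.support ∪ q.support) Finset.subset_union_right,
    act_subset K (p + q) w (p.support ∪ q.support) MvPolynomial.support_add,
    ← Finset.sum_add_distrib]
  simp only [MvPolynomial.coeff_add, add_smul]

theorem act_monomial (m : (Fin 3 ⊕ Fin 3) →₀ ℕ) (c : K) (w : FreeMetab K 3) :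
    act K 3 (MvPolynomial.monomial m c) w = c • monAct K 3 m w := by
  rw [act_subset K _ w {m} MvPolynomial.support_monomial_subset]
  simp

theorem act_eq_Phi (p : PolyUV K 3) (w : CS K) :
    act K 3 p (w : FreeMetab K 3) = ((Phi K p) w : CS K) := by
  induction p using MvPolynomial.induction_on' with
  | monomial m c =>
    rw [act_monomial, MvPolynomial.monomial_eq, Finsupp.prod_fintype _ _ (by simp),
      Fintype.prod_sum_type, Fin.prod_univ_three, Fin.prod_univ_three,
      ← MvPolynomial.algebraMap_eq]
    simp only [monAct, List.ofFn_succ, List.ofFn_zero, List.prod_cons, List.prod_nil, mul_one]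
    simp only [map_mul, map_pow, AlgHom.commutes, Phi_X, Module.End.mul_apply,
      Module.algebraMap_end_apply, Submodule.coe_smul, opC_pow_coe]
    rfl
  | add p q hp hq =>
    rw [act_add, hp, hq, map_add]; rfl

theorem act_mul (p q : PolyUV K 3) {w : FreeMetab K 3} (hw : w ∈ commIdeal K 3) :
    act K 3 (p * q) w = act K 3 p (act K 3 q w) := by
  rw [act_eq_Phi K q ⟨w, (mem_CS K).2 hw⟩, act_eq_Phi K (p * q) ⟨w, (mem_CS K).2 hw⟩, act_eq_Phi, map_mul]; rfl

theorem act_mem (p : PolyUV K 3) {w : FreeMetab K 3} (hw : w ∈ commIdeal K 3) :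
    act K 3 p w ∈ commIdeal K 3 := by
  rw [act_eq_Phi K p ⟨w, (mem_CS K).2 hw⟩]; exact (mem_CS K).1 (Subtype.property _)

theorem act_C (c : K) {w : FreeMetab K 3} (hw : w ∈ commIdeal K 3) :
    act K 3 (MvPolynomial.C c) w = c • w := by
  rw [act_eq_Phi K _ ⟨w, (mem_CS K).2 hw⟩, ← MvPolynomial.algebraMap_eq, AlgHom.commutes]; rfl

theorem act_one {w : FreeMetab K 3} (hw : w ∈ commIdeal K 3) : act K 3 1 w = w := by
  rw [act_eq_Phi K _ ⟨w, (mem_CS K).2 hw⟩, map_one]; rfl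

theorem act_zero (w : FreeMetab K 3) : act K 3 0 w = 0 := by simp [act]

theorem act_u (i : Fin 3) {w : FreeMetab K 3} (hw : w ∈ commIdeal K 3) :
    act K 3 (uP K 3 i) w = xg K 3 i * w := by
  rw [act_eq_Phi K _ ⟨w, (mem_CS K).2 hw⟩, uP, Phi_X]; rfl

theorem act_v (i : Fin 3) {w : FreeMetab K 3} (hw : w ∈ commIdeal K 3) :
    act K 3 (vP K 3 i) w = w * xg K 3 i - xg K 3 i * w := by
  rw [act_eq_Phi K _ ⟨w, (mem_CS K).2 hw⟩, vP, Phi_X]; rfl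

theorem act_neg (p : PolyUV K 3) (w : FreeMetab K 3) : act K 3 (-p) w = - act K 3 p w := by
  rw [eq_neg_iff_add_eq_zero, ← act_add, neg_add_cancel, act_zero]

theorem act_sub (p q : PolyUV K 3) (w : FreeMetab K 3) :
    act K 3 (p - q) w = act K 3 p w - act K 3 q w := by
  rw [sub_eq_add_neg, act_add, act_neg, sub_eq_add_neg]

/-- linearity in the second argument -/
def actLin (p : PolyUV K 3) : FreeMetab K 3 →ₗ[K] FreeMetab K 3 where
  toFun := act K 3 p
  map_add' x y := by simp only [act, map_add, smul_add, Finset.sum_add_distrib]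
  map_smul' c x := by
    simp only [act, map_smul, Finset.smul_sum, RingHom.id_apply]
    exact Finset.sum_congr rfl fun m _ => smul_comm _ _ _

theorem act_add_r (p : PolyUV K 3) (x y : FreeMetab K 3) :
    act K 3 p (x + y) = act K 3 p x + act K 3 p y := (actLin K p).map_add x y
theorem act_sub_r (p : PolyUV K 3) (x y : FreeMetab K 3) :
    act K 3 p (x - y) = act K 3 p x - act K 3 p y := (actLin K p).map_sub x y
theorem act_zero_r (p : PolyUV K 3) : act K 3 p 0 = 0 := (actLin K p).map_zero
theorem act_smul_r (p : PolyUV K 3) (c : K) (x : FreeMetab K 3) :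
    act K 3 p (c • x) = c • act K 3 p x := (actLin K p).map_smul c x

end struct

section gen

variable (K : Type*) [Field K]

/-- An induction principle for the free metabelian algebra. -/
theorem fm_induction {P : FreeMetab K 3 → Prop} (hs : ∀ r : K, P (algebraMap K _ r))
    (hx : ∀ i, P (xg K 3 i)) (hm : ∀ a b, P a → P b → P (a * b)) (ha : ∀ a b, P a → P b → P (a + b))
    (y : FreeMetab K 3) : P y := by
  obtain ⟨a, rfl⟩ := mk_surj K y
  induction a using FreeAlgebra.induction with
  | grade0 r => rw [AlgHom.commutes]; exact hs r
  | grade1 i => exact hx i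
  | mul a b h1 h2 => rw [map_mul]; exact hm _ _ h1 h2
  | add a b h1 h2 => rw [map_add]; exact ha _ _ h1 h2

def w1 : FreeMetab K 3 := brk K (xg K 3 1) (xg K 3 0)
def w2 : FreeMetab K 3 := brk K (xg K 3 2) (xg K 3 0)
def w3 : FreeMetab K 3 := brk K (xg K 3 2) (xg K 3 1)

theorem w1_mem : w1 K ∈ commIdeal K 3 := comm_mem K _ _
theorem w2_mem : w2 K ∈ commIdeal K 3 := comm_mem K _ _
theorem w3_mem : w3 K ∈ commIdeal K 3 := comm_mem K _ _

theorem jacobi : act K 3 (vP K 3 2) (w1 K) - act K 3 (vP K 3 1) (w2 K)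
    + act K 3 (vP K 3 0) (w3 K) = 0 := by
  rw [act_v K _ (w1_mem K), act_v K _ (w2_mem K), act_v K _ (w3_mem K)]
  simp only [w1, w2, w3, brk, mul_sub, sub_mul, mul_assoc]
  abel

def cmb (p q r : PolyUV K 3) : FreeMetab K 3 :=
  act K 3 p (w1 K) + act K 3 q (w2 K) + act K 3 r (w3 K)

theorem cmb_mem (p q r : PolyUV K 3) : cmb K p q r ∈ commIdeal K 3 :=
  add_mem (add_mem (act_mem K _ (w1_mem K)) (act_mem K _ (w2_mem K))) (act_mem K _ (w3_mem K))

theorem cmb_add (p q r p' q' r' : PolyUV K 3) :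
    cmb K (p + p') (q + q') (r + r') = cmb K p q r + cmb K p' q' r' := by
  simp only [cmb, act_add]; abel

theorem cmb_neg (p q r : PolyUV K 3) : cmb K (-p) (-q) (-r) = - cmb K p q r := by
  simp only [cmb, act_neg]; abel

theorem cmb_zero : cmb K 0 0 0 = 0 := by simp only [cmb, act_zero]; simp

theorem act_cmb (s p q r : PolyUV K 3) : act K 3 s (cmb K p q r) = cmb K (s * p) (s * q) (s * r) := by
  simp only [cmb, act_add_r, act_mul K _ _ (w1_mem K), act_mul K _ _ (w2_mem K),
    act_mul K _ _ (w3_mem K)]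

theorem cmb_jacobi (h : PolyUV K 3) :
    cmb K (h * vP K 3 2) (-(h * vP K 3 1)) (h * vP K 3 0) = 0 := by
  have : cmb K (vP K 3 2) (-(vP K 3 1)) (vP K 3 0) = 0 := by
    rw [cmb, act_neg, ← sub_eq_add_neg, jacobi]
  rw [← mul_neg, ← act_cmb, this, act_zero_r]

def GenW (w : FreeMetab K 3) : Prop := ∃ p q r, w = cmb K p q r

variable {K}

theorem GenW.zero : GenW K 0 := ⟨0, 0, 0, (cmb_zero K).symm⟩

theorem GenW.add {a b : FreeMetab K 3} (ha : GenW K a) (hb : GenW K b) : GenW K (a + b) := by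
  obtain ⟨p, q, r, rfl⟩ := ha
  obtain ⟨p', q', r', rfl⟩ := hb
  exact ⟨_, _, _, (cmb_add K _ _ _ _ _ _).symm⟩

theorem GenW.neg {a : FreeMetab K 3} (ha : GenW K a) : GenW K (-a) := by
  obtain ⟨p, q, r, rfl⟩ := ha
  exact ⟨_, _, _, (cmb_neg K _ _ _).symm⟩

theorem GenW.actG {a : FreeMetab K 3} (ha : GenW K a) (s : PolyUV K 3) : GenW K (act K 3 s a) := by
  obtain ⟨p, q, r, rfl⟩ := ha
  exact ⟨_, _, _, act_cmb K _ _ _ _⟩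

theorem GenW.mem {a : FreeMetab K 3} (ha : GenW K a) : a ∈ commIdeal K 3 := by
  obtain ⟨p, q, r, rfl⟩ := ha
  exact cmb_mem K _ _ _

theorem GenW.left (y : FreeMetab K 3) : ∀ {a : FreeMetab K 3}, GenW K a → GenW K (y * a) := by
  refine fm_induction K (P := fun y => ∀ {a : FreeMetab K 3}, GenW K a → GenW K (y * a)) ?_ ?_ ?_ ?_ y
  · intro r a ha
    rw [← Algebra.smul_def, ← act_C K r ha.mem]; exact ha.actG _
  · intro i a ha
    rw [← act_u K i ha.mem]; exact ha.actG _
  · intro x y hx hy a ha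
    rw [mul_assoc]; exact hx (hy ha)
  · intro x y hx hy a ha
    rw [add_mul]; exact (hx ha).add (hy ha)

theorem GenW.right (y : FreeMetab K 3) : ∀ {a : FreeMetab K 3}, GenW K a → GenW K (a * y) := by
  refine fm_induction K (P := fun y => ∀ {a : FreeMetab K 3}, GenW K a → GenW K (a * y)) ?_ ?_ ?_ ?_ y
  · intro r a ha
    rw [← Algebra.commutes, ← Algebra.smul_def, ← act_C K r ha.mem]; exact ha.actG _
  · intro i a ha
    have : a * xg K 3 i = act K 3 (vP K 3 i) a + act K 3 (uP K 3 i) a := by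
      rw [act_v K i ha.mem, act_u K i ha.mem]; abel
    rw [this]; exact (ha.actG _).add (ha.actG _)
  · intro x y hx hy a ha
    rw [← mul_assoc]; exact hy (hx ha)
  · intro x y hx hy a ha
    rw [mul_add]; exact (hx ha).add (hy ha)

theorem gen_w1 : GenW K (w1 K) := ⟨1, 0, 0, by simp [cmb, act_zero, act_one K (w1_mem K)]⟩
theorem gen_w2 : GenW K (w2 K) := ⟨0, 1, 0, by simp [cmb, act_zero, act_one K (w2_mem K)]⟩
theorem gen_w3 : GenW K (w3 K) := ⟨0, 0, 1, by simp [cmb, act_zero, act_one K (w3_mem K)]⟩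

theorem gen_xx (i j : Fin 3) : GenW K (xg K 3 i * xg K 3 j - xg K 3 j * xg K 3 i) := by
  have a1 := gen_w1 (K := K)
  have a2 := gen_w2 (K := K)
  have a3 := gen_w3 (K := K)
  have b1 := a1.neg
  have b2 := a2.neg
  have b3 := a3.neg
  simp only [w1, w2, w3, brk, neg_sub] at *
  fin_cases i <;> fin_cases j
  · simpa using GenW.zero
  · exact b1
  · exact b2
  · exact a1
  · simpa using GenW.zero
  · exact b3
  · exact a2
  · exact a3
  · simpa using GenW.zero

theorem gen_comm (f g : FreeMetab K 3) : GenW K (f * g - g * f) := by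
  refine fm_induction K (P := fun f => GenW K (f * g - g * f)) ?_ ?_ ?_ ?_ f
  · intro r
    rw [Algebra.commutes, sub_self]; exact GenW.zero
  · intro i
    refine fm_induction K (P := fun g => GenW K (xg K 3 i * g - g * xg K 3 i)) ?_ ?_ ?_ ?_ g
    · intro r
      rw [Algebra.commutes, sub_self]; exact GenW.zero
    · exact gen_xx i
    · intro a b ha hb
      have : xg K 3 i * (a * b) - a * b * xg K 3 i =
          (xg K 3 i * a - a * xg K 3 i) * b + a * (xg K 3 i * b - b * xg K 3 i) := by
        simp only [mul_sub, sub_mul, mul_assoc]; abel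
      rw [this]; exact (ha.right _).add (hb.left _)
    · intro a b ha hb
      have : xg K 3 i * (a + b) - (a + b) * xg K 3 i =
          (xg K 3 i * a - a * xg K 3 i) + (xg K 3 i * b - b * xg K 3 i) := by
        rw [mul_add, add_mul]; abel
      rw [this]; exact ha.add hb
  · intro a b ha hb
    have : a * b * g - g * (a * b) = (a * g - g * a) * b + a * (b * g - g * b) := by
      simp only [mul_sub, sub_mul, mul_assoc]; abel
    rw [this]; exact (ha.right _).add (hb.left _)
  · intro a b ha hb
    have : (a + b) * g - g * (a + b) = (a * g - g * a) + (b * g - g * b) := by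
      rw [mul_add, add_mul]; abel
    rw [this]; exact ha.add hb

theorem gen_all {w : FreeMetab K 3} (hw : w ∈ commIdeal K 3) : GenW K w := by
  refine Submodule.span_induction (p := fun w _ => GenW K w) ?_ ?_ ?_ ?_ hw
  · rintro _ ⟨a, f, g, b, rfl⟩
    exact ((gen_comm f g).left a).right b
  · exact GenW.zero
  · intro x y _ _ hx hy; exact hx.add hy
  · intro a x _ hx; exact hx.left a

section delta

set_option linter.unusedVariables false

theorem d_act
    (δ : FreeMetab K 3 →ₗ[K] FreeMetab K 3)
    (hleib : ∀ a b : FreeMetab K 3, δ (a * b) = δ a * b + a * δ b)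
    (h1 : δ (xg K 3 0) = 0) (h2 : δ (xg K 3 1) = xg K 3 0) (h3 : δ (xg K 3 2) = xg K 3 1)
    (p : PolyUV K 3) {w : FreeMetab K 3} (hw : w ∈ commIdeal K 3)
    (hd : δ w ∈ commIdeal K 3) : δ (act K 3 p w) = act K 3 (dE K p) w + act K 3 p (δ w) := by
  induction p using MvPolynomial.induction_on with
  | C a =>
    rw [act_C K a hw, act_C K a hd, map_smul, MvPolynomial.derivation_C, act_zero, zero_add]
  | add p q hp hq =>
    rw [act_add, map_add, map_add, hp, hq, act_add, act_add]; abel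
  | mul_X p k hp =>
    have hz := act_mem K p hw
    have hz1 := act_mem K (dE K p) hw
    have hz2 := act_mem K p hd
    rw [Derivation.leibniz, smul_eq_mul, smul_eq_mul, mul_comm p, mul_comm p, act_add,
      act_mul K _ _ hw, act_mul K _ _ hw, act_mul K _ _ hw, act_mul K _ _ hd]
    generalize act K 3 p w = z at *
    generalize act K 3 (dE K p) w = z1 at *
    generalize act K 3 p (δ w) = z2 at *
    rcases k with i | i
    · change δ (act K 3 (uP K 3 i) z) = act K 3 (dE K (uP K 3 i)) z + act K 3 (uP K 3 i) z1 +
        act K 3 (uP K 3 i) z2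
      rw [act_u K i hz, act_u K i hz1, act_u K i hz2, hleib, hp]
      fin_cases i
      · change δ (xg K 3 0) * _ + xg K 3 0 * _ = act K 3 (dE K (uP K 3 0)) z + xg K 3 0 * _ + xg K 3 0 * _
        rw [h1, dE_u0, act_zero, mul_add]; simp
      · change δ (xg K 3 1) * _ + xg K 3 1 * _ = act K 3 (dE K (uP K 3 1)) z + xg K 3 1 * _ + xg K 3 1 * _
        rw [h2, dE_u1, act_u K 0 hz, mul_add]; abel
      · change δ (xg K 3 2) * _ + xg K 3 2 * _ = act K 3 (dE K (uP K 3 2)) z + xg K 3 2 * _ + xg K 3 2 * _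
        rw [h3, dE_u2, act_u K 1 hz, mul_add]; abel
    · change δ (act K 3 (vP K 3 i) z) = act K 3 (dE K (vP K 3 i)) z + act K 3 (vP K 3 i) z1 +
        act K 3 (vP K 3 i) z2
      rw [act_v K i hz, act_v K i hz1, act_v K i hz2, map_sub, hleib, hleib, hp]
      have key : ∀ y t : FreeMetab K 3, act K 3 (dE K (vP K 3 i)) z = z * y - y * z →
          (z1 + z2) * t + z * y - (y * z + t * (z1 + z2)) =
            act K 3 (dE K (vP K 3 i)) z + (z1 * t - t * z1) + (z2 * t - t * z2) := by
        intro y t h; rw [h, add_mul, mul_add]; abel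
      apply key
      fin_cases i
      · change act K 3 (dE K (vP K 3 0)) z = z * δ (xg K 3 0) - δ (xg K 3 0) * z
        rw [h1, dE_v0, act_zero]; simp
      · change act K 3 (dE K (vP K 3 1)) z = z * δ (xg K 3 1) - δ (xg K 3 1) * z
        rw [h2, dE_v1, act_v K 0 hz]
      · change act K 3 (dE K (vP K 3 2)) z = z * δ (xg K 3 2) - δ (xg K 3 2) * z
        rw [h3, dE_v2, act_v K 1 hz]

theorem d_w1
    (δ : FreeMetab K 3 →ₗ[K] FreeMetab K 3)
    (hleib : ∀ a b : FreeMetab K 3, δ (a * b) = δ a * b + a * δ b)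
    (h1 : δ (xg K 3 0) = 0) (h2 : δ (xg K 3 1) = xg K 3 0) (h3 : δ (xg K 3 2) = xg K 3 1)
    : δ (w1 K) = 0 := by
  simp only [w1, brk, map_sub, hleib, h1, h2]; simp
theorem d_w2
    (δ : FreeMetab K 3 →ₗ[K] FreeMetab K 3)
    (hleib : ∀ a b : FreeMetab K 3, δ (a * b) = δ a * b + a * δ b)
    (h1 : δ (xg K 3 0) = 0) (h2 : δ (xg K 3 1) = xg K 3 0) (h3 : δ (xg K 3 2) = xg K 3 1)
    : δ (w2 K) = w1 K := by
  simp only [w1, w2, brk, map_sub, hleib, h1, h3]; simp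
theorem d_w3
    (δ : FreeMetab K 3 →ₗ[K] FreeMetab K 3)
    (hleib : ∀ a b : FreeMetab K 3, δ (a * b) = δ a * b + a * δ b)
    (h1 : δ (xg K 3 0) = 0) (h2 : δ (xg K 3 1) = xg K 3 0) (h3 : δ (xg K 3 2) = xg K 3 1)
    : δ (w3 K) = w2 K := by
  simp only [w2, w3, brk, map_sub, hleib, h2, h3]; abel

theorem d_cmb
    (δ : FreeMetab K 3 →ₗ[K] FreeMetab K 3)
    (hleib : ∀ a b : FreeMetab K 3, δ (a * b) = δ a * b + a * δ b)
    (h1 : δ (xg K 3 0) = 0) (h2 : δ (xg K 3 1) = xg K 3 0) (h3 : δ (xg K 3 2) = xg K 3 1)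
    (p q r : PolyUV K 3) :
    δ (cmb K p q r) = cmb K (dE K p + q) (dE K q + r) (dE K r) := by
  have e1 := d_w1 δ hleib h1 h2 h3
  have e2 := d_w2 δ hleib h1 h2 h3
  have e3 := d_w3 δ hleib h1 h2 h3
  have f1 := d_act δ hleib h1 h2 h3 p (w1_mem K) (e1 ▸ zero_mem _)
  have f2 := d_act δ hleib h1 h2 h3 q (w2_mem K) (e2 ▸ w1_mem K)
  have f3 := d_act δ hleib h1 h2 h3 r (w3_mem K) (e3 ▸ w2_mem K)
  rw [cmb, map_add, map_add, f1, f2, f3, e1, e2, e3, act_zero_r, cmb, act_add, act_add]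
  abel

end delta
end gen

section repr

variable (K : Type*) [Field K] (ε : Fin 3 → PolyUV K 3)

abbrev M2 := Matrix (Fin 2) (Fin 2) (PolyUV K 3)

def psi0 : FreeAlgebra K (Fin 3) →ₐ[K] M2 K :=
  FreeAlgebra.lift K (fun i => (!![uP K 3 i, ε i; 0, uP K 3 i + vP K 3 i] : M2 K))

theorem psi0_tri (a : FreeAlgebra K (Fin 3)) : psi0 K ε a 1 0 = 0 := by
  induction a using FreeAlgebra.induction with
  | grade0 r => rw [AlgHom.commutes, Matrix.algebraMap_matrix_apply]; simp
  | grade1 i => rw [psi0, FreeAlgebra.lift_ι_apply]; rfl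
  | mul a b h1 h2 => rw [map_mul, Matrix.mul_apply, Fin.sum_univ_two, h1, h2]; simp
  | add a b h1 h2 => rw [map_add, Matrix.add_apply, h1, h2, add_zero]

theorem tri_comm {R : Type*} [CommRing R] (A B : Matrix (Fin 2) (Fin 2) R) (hA : A 1 0 = 0)
    (hB : B 1 0 = 0) : (A * B - B * A) 0 0 = 0 ∧ (A * B - B * A) 1 0 = 0 ∧ (A * B - B * A) 1 1 = 0 := by
  simp only [Matrix.sub_apply, Matrix.mul_apply, Fin.sum_univ_two, hA, hB]
  refine ⟨by ring, by ring, by ring⟩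

theorem psi0_rel {a b : FreeAlgebra K (Fin 3)} (h : MetabRel K 3 a b) :
    psi0 K ε a = psi0 K ε b := by
  obtain ⟨rfl, a, b, c, e, rfl⟩ := h
  obtain ⟨h1, h2, h3⟩ := tri_comm _ _ (psi0_tri K ε a) (psi0_tri K ε b)
  obtain ⟨g1, g2, g3⟩ := tri_comm _ _ (psi0_tri K ε c) (psi0_tri K ε e)
  rw [map_mul, map_sub, map_sub, map_mul, map_mul, map_mul, map_mul, map_zero]
  generalize psi0 K ε a * psi0 K ε b - psi0 K ε b * psi0 K ε a = A at *
  generalize psi0 K ε c * psi0 K ε e - psi0 K ε e * psi0 K ε c = B at *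
  ext i j
  rw [Matrix.mul_apply, Fin.sum_univ_two]
  fin_cases i <;> fin_cases j <;> simp [h1, h2, h3, g1, g2, g3]

def psi : FreeMetab K 3 →ₐ[K] M2 K :=
  RingQuot.liftAlgHom K ⟨psi0 K ε, fun {_ _} h => psi0_rel K ε h⟩

theorem psi_mk (a : FreeAlgebra K (Fin 3)) :
    psi K ε (RingQuot.mkAlgHom K (MetabRel K 3) a) = psi0 K ε a :=
  RingQuot.liftAlgHom_mkAlgHom_apply K (psi0 K ε) (fun {_ _} h => psi0_rel K ε h) a

theorem psi_x (i : Fin 3) :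
    psi K ε (xg K 3 i) = (!![uP K 3 i, ε i; 0, uP K 3 i + vP K 3 i] : M2 K) := by
  rw [xg, psi_mk, psi0, FreeAlgebra.lift_ι_apply]

theorem psi_tri (y : FreeMetab K 3) : psi K ε y 1 0 = 0 := by
  obtain ⟨a, rfl⟩ := mk_surj K y
  rw [psi_mk, psi0_tri]

theorem psi_C {w : FreeMetab K 3} (hw : w ∈ commIdeal K 3) :
    psi K ε w 0 0 = 0 ∧ psi K ε w 1 1 = 0 := by
  refine Submodule.span_induction (p := fun w _ => psi K ε w 0 0 = 0 ∧ psi K ε w 1 1 = 0)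
    ?_ ?_ ?_ ?_ hw
  · rintro _ ⟨a, f, g, b, rfl⟩
    obtain ⟨h1, h2, h3⟩ := tri_comm _ _ (psi_tri K ε f) (psi_tri K ε g)
    rw [map_mul, map_mul, map_sub, map_mul, map_mul]
    generalize psi K ε f * psi K ε g - psi K ε g * psi K ε f = A at *
    simp [Matrix.mul_apply, Fin.sum_univ_two, h1, h2, h3, psi_tri]
  · simp
  · rintro x y _ _ ⟨h1, h2⟩ ⟨h3, h4⟩
    rw [map_add, Matrix.add_apply, Matrix.add_apply, h1, h2, h3, h4]; simp
  · rintro a x _ ⟨h1, h2⟩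
    rw [smul_eq_mul, map_mul]
    simp [Matrix.mul_apply, Fin.sum_univ_two, h1, h2, psi_tri]

theorem psi_act (p : PolyUV K 3) {w : FreeMetab K 3} (hw : w ∈ commIdeal K 3) :
    psi K ε (act K 3 p w) 0 1 = p * psi K ε w 0 1 := by
  induction p using MvPolynomial.induction_on with
  | C a =>
    rw [act_C K a hw, map_smul, Matrix.smul_apply, MvPolynomial.smul_eq_C_mul]
  | add p q hp hq =>
    rw [act_add, map_add, Matrix.add_apply, hp, hq, add_mul]
  | mul_X p k hp =>
    have hz := act_mem K p hw
    rw [mul_comm p, act_mul K _ _ hw, mul_assoc, ← hp]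
    generalize act K 3 p w = z at *
    obtain ⟨h1, h2⟩ := psi_C K ε hz
    rcases k with i | i
    · change psi K ε (act K 3 (uP K 3 i) z) 0 1 = uP K 3 i * _
      rw [act_u K i hz, map_mul, Matrix.mul_apply, Fin.sum_univ_two, psi_x, h2]
      simp
    · change psi K ε (act K 3 (vP K 3 i) z) 0 1 = vP K 3 i * _
      rw [act_v K i hz, map_sub, Matrix.sub_apply, map_mul, map_mul, Matrix.mul_apply,
        Matrix.mul_apply, Fin.sum_univ_two, Fin.sum_univ_two, psi_x, h1, h2]
      simp
      ring

theorem psi_brk (i j : Fin 3) : psi K ε (brk K (xg K 3 i) (xg K 3 j)) 0 1 =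
    ε i * vP K 3 j - ε j * vP K 3 i := by
  rw [brk, map_sub, Matrix.sub_apply, map_mul, map_mul, Matrix.mul_apply, Matrix.mul_apply,
    Fin.sum_univ_two, Fin.sum_univ_two, psi_x, psi_x]
  simp
  ring

theorem psi_cmb (p q r : PolyUV K 3) (h : cmb K p q r = 0) :
    p * (ε 1 * vP K 3 0 - ε 0 * vP K 3 1) + q * (ε 2 * vP K 3 0 - ε 0 * vP K 3 2)
      + r * (ε 2 * vP K 3 1 - ε 1 * vP K 3 2) = 0 := by
  have := congrArg (fun z => psi K ε z 0 1) h
  simp only [cmb, map_add, Matrix.add_apply, psi_act K ε _ (w1_mem K), psi_act K ε _ (w2_mem K),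
    psi_act K ε _ (w3_mem K), map_zero, Matrix.zero_apply] at this
  simp only [w1, w2, w3, psi_brk] at this
  exact this

theorem syz (p q r : PolyUV K 3) (h : cmb K p q r = 0) :
    ∃ g, p = g * vP K 3 2 ∧ q = -(g * vP K 3 1) ∧ r = g * vP K 3 0 := by
  have e1 := psi_cmb K ![0, 1, 0] p q r h
  have e2 := psi_cmb K ![0, 0, 1] p q r h
  simp only [Matrix.cons_val_zero, Matrix.cons_val_one, Matrix.cons_val] at e1 e2
  have e1' : p * vP K 3 0 = r * vP K 3 2 := by linear_combination e1
  have e2' : q * vP K 3 0 = -(r * vP K 3 1) := by linear_combination e2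
  have hp : Prime (vP K 3 0) := MvPolynomial.X_prime
  have hnd : ¬ vP K 3 0 ∣ vP K 3 2 := by
    unfold vP
    rw [MvPolynomial.X_dvd_X]
    simp
  have hd : vP K 3 0 ∣ r := by
    rcases hp.dvd_or_dvd (Dvd.intro_left p e1') with h | h
    · exact h
    · exact absurd h hnd
  obtain ⟨g, rfl⟩ := hd
  refine ⟨g, mul_right_cancel₀ hp.ne_zero ?_, mul_right_cancel₀ hp.ne_zero ?_, mul_comm _ _⟩
  · rw [e1']; ring
  · rw [e2']; ring

end repr

section final

variable (K : Type*) [Field K]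

theorem c1_cmb : c1 K = cmb K 1 0 0 := by
  simp only [cmb, act_zero, act_one K (w1_mem K), add_zero]; rfl

theorem c2_cmb : c2 K = cmb K (-vP K 3 1) (vP K 3 0) 0 := by
  simp only [cmb, act_zero, act_neg, act_v K _ (w1_mem K), act_v K _ (w2_mem K), add_zero]
  rw [neg_add_eq_sub]; rfl

theorem c3_cmb : c3 K = cmb K (-uP K 3 1) (uP K 3 0) 0 := by
  simp only [cmb, act_zero, act_neg, act_u K _ (w1_mem K), act_u K _ (w2_mem K), add_zero]
  rw [neg_add_eq_sub]; rfl

theorem c4_cmb : c4 K = cmb K (uP K 3 2) (-uP K 3 1) (uP K 3 0) := by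
  simp only [cmb, act_neg, act_u K _ (w1_mem K), act_u K _ (w2_mem K), act_u K _ (w3_mem K)]
  simp only [c4, w1, w2, w3]
  abel

theorem c5_cmb : c5 K = cmb K (pT K) (-(uP K 3 0 * vP K 3 2 - uP K 3 2 * vP K 3 0)) (pJ K) := by
  have m1 := fun i => act_mem K (vP K 3 i) (w1_mem K)
  have m2 := fun i => act_mem K (vP K 3 i) (w2_mem K)
  have m3 := fun i => act_mem K (vP K 3 i) (w3_mem K)
  have e1 : ∀ i j, act K 3 (uP K 3 i * vP K 3 j) (w1 K) = xg K 3 i * brk K (w1 K) (xg K 3 j) :=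
    fun i j => by rw [act_mul K _ _ (w1_mem K), act_u K i (m1 j), act_v K j (w1_mem K)]; rfl
  have e2 : ∀ i j, act K 3 (uP K 3 i * vP K 3 j) (w2 K) = xg K 3 i * brk K (w2 K) (xg K 3 j) :=
    fun i j => by rw [act_mul K _ _ (w2_mem K), act_u K i (m2 j), act_v K j (w2_mem K)]; rfl
  have e3 : ∀ i j, act K 3 (uP K 3 i * vP K 3 j) (w3 K) = xg K 3 i * brk K (w3 K) (xg K 3 j) :=
    fun i j => by rw [act_mul K _ _ (w3_mem K), act_u K i (m3 j), act_v K j (w3_mem K)]; rfl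
  simp only [cmb, pT, pJ, act_neg, act_sub, e1, e2, e3]
  simp only [c5, w1, w2, w3]
  abel

theorem main_gen [CharZero K]
    (δ : FreeMetab K 3 →ₗ[K] FreeMetab K 3)
    (hleib : ∀ a b : FreeMetab K 3, δ (a * b) = δ a * b + a * δ b)
    (h1 : δ (xg K 3 0) = 0) (h2 : δ (xg K 3 1) = xg K 3 0) (h3 : δ (xg K 3 2) = xg K 3 1)
    (w : FreeMetab K 3) (hw : w ∈ commIdeal K 3) (hd : δ w = 0) :
    ∃ a b c d e : PolyUV K 3, dE K a = 0 ∧ dE K b = 0 ∧ dE K c = 0 ∧ dE K d = 0 ∧ dE K e = 0 ∧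
      w = act K 3 a (c1 K) + act K 3 b (c2 K) + act K 3 c (c3 K) + act K 3 d (c4 K)
        + act K 3 e (c5 K) := by
  obtain ⟨p, q, r, rfl⟩ := gen_all hw
  rw [d_cmb δ hleib h1 h2 h3] at hd
  obtain ⟨g, e1, e2, e3⟩ := syz K _ _ _ hd
  obtain ⟨h, g0, rfl, hg0⟩ := P_surj K g
  have hg : g0 = 0 := by
    refine Q_key K (p - h * vP K 3 2) (q + h * vP K 3 1) (r - h * vP K 3 0) g0 ?_ ?_ ?_ hg0
    · simp only [map_sub, Derivation.leibniz, dE_v2, smul_eq_mul]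
      linear_combination e1
    · simp only [map_add, Derivation.leibniz, dE_v1, smul_eq_mul]
      linear_combination e2
    · simp only [map_sub, Derivation.leibniz, dE_v0, smul_eq_mul]
      linear_combination e3
  subst hg
  obtain ⟨q1, hq1⟩ : ∃ q1, q1 = p - h * vP K 3 2 := ⟨_, rfl⟩
  have hq2 : dE K q1 = -(q + h * vP K 3 1) := by
    rw [hq1]
    simp only [map_sub, Derivation.leibniz, dE_v2, smul_eq_mul]
    linear_combination e1
  have hq3 : dE K (dE K q1) = r - h * vP K 3 0 := by
    rw [hq2]
    simp only [map_add, map_neg, Derivation.leibniz, dE_v1, smul_eq_mul]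
    linear_combination -e2
  have hq4 : dE K (dE K (dE K q1)) = 0 := by
    rw [hq3]
    simp only [map_sub, Derivation.leibniz, dE_v0, smul_eq_mul]
    linear_combination e3
  obtain ⟨a, b, c, d, e, k, ha, hb, hc, hdd, he, hk, hq⟩ := ker3 K q1 hq4
  refine ⟨a, -c, -b, d, k, ha, by simp [hc], by simp [hb], hdd, hk, ?_⟩
  rw [c1_cmb, c2_cmb, c3_cmb, c4_cmb, c5_cmb]
  simp only [act_cmb, ← cmb_add]
  have hD1 : dE K q1 = b * uP K 3 0 + c * vP K 3 0 + d * uP K 3 1 + e * vP K 3 1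
      + k * (uP K 3 0 * vP K 3 2 - uP K 3 2 * vP K 3 0) := by
    rw [hq]
    simp only [map_add, Derivation.leibniz, smul_eq_mul, dE_T, dE_u1, dE_u2, dE_v1, dE_v2,
      ha, hb, hc, hdd, he, hk]
    ring
  have hD2 : dE K (dE K q1) = d * uP K 3 0 + e * vP K 3 0 + k * pJ K := by
    have : dE K (uP K 3 0 * vP K 3 2 - uP K 3 2 * vP K 3 0) = pJ K := by
      rw [← dE_T, dE_dE_T]
    rw [hD1]
    simp only [map_add, Derivation.leibniz _ k, Derivation.leibniz _ b, Derivation.leibniz _ c,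
      Derivation.leibniz _ d, Derivation.leibniz _ e, smul_eq_mul, this, dE_u0, dE_u1, dE_v0, dE_v1,
      hb, hc, hdd, he, hk]
    ring
  have hj := cmb_jacobi K (h + e)
  rw [← add_zero (cmb K (a * 1 + _ + _ + _ + _) _ _), ← hj, ← cmb_add]
  congr 1
  · linear_combination hq - hq1
  · linear_combination hq2 - hD1
  · linear_combination hD2 - hq3
end final

/-- For `d = 3` and the Weitzenböck derivation with `δ(x₁) = 0`,
`δ(x₂) = x₁`, `δ(x₃) = x₂`, the `K[U₃,V₃]^δ`-module `(F₃')^δ` is generated by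
`c₁, c₂, c₃, c₄, c₅`. -/
theorem module_generators_d3_cell_3
    (K : Type*) [Field K] [CharZero K]
    (δ : FreeMetab K 3 →ₗ[K] FreeMetab K 3)
    (hleib : ∀ a b : FreeMetab K 3, δ (a * b) = δ a * b + a * δ b)
    (h1 : δ (xg K 3 0) = 0) (h2 : δ (xg K 3 1) = xg K 3 0) (h3 : δ (xg K 3 2) = xg K 3 1)
    (δ' : Derivation K (PolyUV K 3) (PolyUV K 3))
    (hu1 : δ' (uP K 3 0) = 0) (hu2 : δ' (uP K 3 1) = uP K 3 0) (hu3 : δ' (uP K 3 2) = uP K 3 1)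
    (hv1 : δ' (vP K 3 0) = 0) (hv2 : δ' (vP K 3 1) = vP K 3 0) (hv3 : δ' (vP K 3 2) = vP K 3 1) :
    ∀ w ∈ commIdeal K 3, δ w = 0 →
      ∃ (N : ℕ) (h : Fin N → PolyUV K 3) (sel : Fin N → Fin 5),
        (∀ r, δ' (h r) = 0) ∧
        w = ∑ r, act K 3 (h r) (![c1 K, c2 K, c3 K, c4 K, c5 K] (sel r)) := by
  intro w hw hd
  have hδ : δ' = dE K := by
    apply MvPolynomial.derivation_ext
    rintro (i | i) <;> fin_cases i
    · exact hu1.trans (dE_u0 K).symm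
    · exact hu2.trans (dE_u1 K).symm
    · exact hu3.trans (dE_u2 K).symm
    · exact hv1.trans (dE_v0 K).symm
    · exact hv2.trans (dE_v1 K).symm
    · exact hv3.trans (dE_v2 K).symm
  obtain ⟨a, b, c, d, e, ha, hb, hc, hdd, he, hsum⟩ := main_gen K δ hleib h1 h2 h3 w hw hd
  refine ⟨5, ![a, b, c, d, e], id, ?_, ?_⟩
  · rw [hδ]
    intro r
    fin_cases r
    · exact ha
    · exact hb
    · exact hc
    · exact hdd
    · exact he
  · rw [hsum, Fin.sum_univ_five]
    rfl
end
end

section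
/- Let d = 3 and let δ be the Weitzenböck derivation of F_3 with δ(x_1) = 0, δ(x_2) = x_1, δ(x_3) = x_2. With c_1 = [x_2,x_1], c_2 = [x_3,x_1,x_1] − [x_2,x_1,x_2], c_3 = x_1[x_3,x_1] − x_2[x_2,x_1], c_4 = x_1[x_3,x_2] − x_2[x_3,x_1] + x_3[x_2,x_1], c_5 = [x_3,x_1]·u_3v_1 − [x_3,x_1]·u_1v_3 + [x_3,x_2]·u_1v_2 − [x_3,x_2]·u_2v_1 − [x_2,x_1]·u_3v_2 + [x_2,x_1]·u_2v_3, and f_5 = u_1v_3 − u_2v_2 + u_3v_1, the algebra of constants F_3^δ is generated as a unital K-algebra by the set { x_1, x_2² − (x_1x_3 + x_3x_1) } ∪ { c_j·f_5^p : j = 1,…,5, p ≥ 0 }. -/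
noncomputable section

/-- The action of `f₅ = u₁v₃ - u₂v₂ + u₃v₁` on the commutator ideal of `F₃`:
`w ↦ x₁[w,x₃] - x₂[w,x₂] + x₃[w,x₁]`. -/
def f5Step (K : Type*) [CommRing K] (w : FreeMetab K 3) : FreeMetab K 3 :=
  xg K 3 0 * brk K w (xg K 3 2) - xg K 3 1 * brk K w (xg K 3 1) + xg K 3 2 * brk K w (xg K 3 0)

namespace MetabAux

open MvPolynomial

section slice

/-- The slice argument: constants that are polynomials in `s` over a ring of constants `D`
are already in `D`. -/
theorem slice_aux {K S : Type*} [Field K] [CharZero K] [CommRing S] [IsDomain S] [Algebra K S]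
    (d : Derivation K S S) (D : Subalgebra K S) (hD : ∀ x ∈ D, d x = 0) (s t : S)
    (hs : d s = t) (ht : t ≠ 0) (P : Polynomial D) (hP : d (Polynomial.aeval s P) = 0) :
    Polynomial.aeval s P ∈ D := by
  have hder : ∀ P : Polynomial D, d (Polynomial.aeval s P)
      = t * Polynomial.aeval s (Polynomial.derivative P) := by
    intro P
    induction P using Polynomial.induction_on' with
    | add p q hp hq => simp only [map_add, hp, hq, mul_add]
    | monomial n a =>
      rw [Polynomial.derivative_monomial, Polynomial.aeval_monomial, Polynomial.aeval_monomial]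
      have ha : d (algebraMap D S a) = 0 := hD _ a.2
      rw [Derivation.leibniz, ha, Derivation.leibniz_pow, hs]
      simp
      ring
  have : CharZero S := charZero_of_injective_algebraMap (algebraMap K S).injective
  have hinj : ∀ n : ℕ, ∀ P : Polynomial D, P.natDegree ≤ n → Polynomial.aeval s P = 0 → P = 0 := by
    intro n
    induction n with
    | zero =>
      intro P hP h0
      rw [Polynomial.eq_C_of_natDegree_le_zero hP] at h0 ⊢
      simp only [Polynomial.aeval_C] at h0
      have : P.coeff 0 = 0 := Subtype.ext h0
      simp [this]
    | succ n ih =>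
      intro P hP h0
      have h1 := hder P
      rw [h0, map_zero] at h1
      have h2 : Polynomial.aeval s (Polynomial.derivative P) = 0 := by
        rcases mul_eq_zero.mp h1.symm with h | h
        · exact absurd h ht
        · exact h
      have h3 := ih _ ((Polynomial.natDegree_derivative_le P).trans (by omega)) h2
      have h4 : P.natDegree = 0 := Polynomial.derivative_eq_zero.mp h3
      rw [Polynomial.eq_C_of_natDegree_le_zero h4.le] at h0 ⊢
      simp only [Polynomial.aeval_C] at h0
      have : P.coeff 0 = 0 := Subtype.ext h0
      simp [this]
  have h1 := hder P
  rw [hP] at h1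
  have h2 : Polynomial.aeval s (Polynomial.derivative P) = 0 := by
    rcases mul_eq_zero.mp h1.symm with h | h
    · exact absurd h ht
    · exact h
  have h3 := hinj _ _ le_rfl h2
  have h4 : P.natDegree = 0 := Polynomial.derivative_eq_zero.mp h3
  rw [Polynomial.eq_C_of_natDegree_le_zero h4.le]
  simp only [Polynomial.aeval_C]
  exact (P.coeff 0).2

end slice

/-- The polynomial ring `K[U_3,V_3]`. -/
abbrev SS (K : Type*) [CommRing K] := MvPolynomial (Fin 3 ⊕ Fin 3) K

variable {K : Type*} [Field K]

def U (i : Fin 3) : SS K := X (Sum.inl i)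
def V (i : Fin 3) : SS K := X (Sum.inr i)

/-- The Weitzenböck derivation of `K[U_3,V_3]`. -/
def dS : Derivation K (SS K) (SS K) :=
  mkDerivation K (Sum.elim ![0, U 0, U 1] ![0, V 0, V 1])

@[simp] theorem dS_U0 : dS (U 0 : SS K) = 0 := by simp [dS, U, mkDerivation_X]
@[simp] theorem dS_U1 : dS (U 1 : SS K) = U 0 := by simp [dS, U, mkDerivation_X]
@[simp] theorem dS_U2 : dS (U 2 : SS K) = U 1 := by simp [dS, U, mkDerivation_X]
@[simp] theorem dS_V0 : dS (V 0 : SS K) = 0 := by simp [dS, V, mkDerivation_X]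
@[simp] theorem dS_V1 : dS (V 1 : SS K) = V 0 := by simp [dS, V, mkDerivation_X]
@[simp] theorem dS_V2 : dS (V 2 : SS K) = V 1 := by simp [dS, V, mkDerivation_X]

/-- The invariants `f₁,f₂,f₄,f₅,f₆`. -/
def ff : Fin 5 → SS K :=
  ![U 0, V 0, U 1 * U 1 - (U 0 * U 2 + U 2 * U 0), U 0 * V 2 - U 1 * V 1 + U 2 * V 0,
    V 1 * V 1 - (V 0 * V 2 + V 0 * V 2)]

def f3 : SS K := U 0 * V 1 - U 1 * V 0

/-- First Magnus coordinates of `c₁,…,c₅`. -/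
def cc : Fin 5 → SS K :=
  ![- V 1, - V 0 * V 2 + V 1 * V 1, - U 0 * V 2 + U 1 * V 1, U 1 * V 2 - U 2 * V 1,
    - V 2 * (U 2 * V 0 - U 0 * V 2) - V 1 * (U 1 * V 2 - U 2 * V 1)]

theorem V0_ne : (V 0 : SS K) ≠ 0 := X_ne_zero _
theorem U0_ne : (U 0 : SS K) ≠ 0 := X_ne_zero _

theorem dS_ff (i : Fin 5) : dS (ff i : SS K) = 0 := by
  fin_cases i <;> simp [ff, Derivation.leibniz] <;> ring

theorem dS_f3 : dS (f3 : SS K) = 0 := by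
  simp [f3, Derivation.leibniz] ; ring

theorem f3_sq : (f3 : SS K) * f3 = aeval ff
    (X 0 ^ 2 * X 4 + X 1 ^ 2 * X 2 + (X 0 * X 1 * X 3 + X 0 * X 1 * X 3) : MvPolynomial (Fin 5) K) := by
  simp [ff, f3]; ring

/-- The algebra generated by `f₁,…,f₆`. -/
def DD : Subalgebra K (SS K) := Algebra.adjoin K (Set.range ff ∪ {f3})

theorem DD_const (x : SS K) (hx : x ∈ (DD : Subalgebra K (SS K))) : dS x = 0 := by
  induction hx using Algebra.adjoin_induction with
  | mem x hx =>
    rcases hx with ⟨i, rfl⟩ | rfl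
    · exact dS_ff i
    · exact dS_f3
  | algebraMap r => exact Derivation.map_algebraMap _ _
  | add x y _ _ hx hy => rw [map_add, hx, hy, add_zero]
  | mul x y _ _ hx hy => rw [Derivation.leibniz, hx, hy, smul_zero, smul_zero, add_zero]

theorem ff_mem (i : Fin 5) : (ff i : SS K) ∈ (DD : Subalgebra K (SS K)) :=
  Algebra.subset_adjoin (Or.inl ⟨i, rfl⟩)
theorem f3_mem : (f3 : SS K) ∈ (DD : Subalgebra K (SS K)) :=
  Algebra.subset_adjoin (Or.inr rfl)

theorem DD_form (x : SS K) (hx : x ∈ (DD : Subalgebra K (SS K))) :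
    ∃ r r' : MvPolynomial (Fin 5) K, x = aeval ff r + f3 * aeval ff r' := by
  induction hx using Algebra.adjoin_induction with
  | mem x hx =>
    rcases hx with ⟨i, rfl⟩ | rfl
    · exact ⟨X i, 0, by simp⟩
    · exact ⟨0, 1, by simp⟩
  | algebraMap r => exact ⟨C r, 0, by simp [algebraMap_eq]⟩
  | add x y _ _ hx hy =>
    obtain ⟨a, b, rfl⟩ := hx
    obtain ⟨c, e, rfl⟩ := hy
    exact ⟨a + c, b + e, by simp only [map_add]; ring⟩
  | mul x y _ _ hx hy =>
    obtain ⟨a, b, rfl⟩ := hx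
    obtain ⟨c, e, rfl⟩ := hy
    refine ⟨a * c + (X 0 ^ 2 * X 4 + X 1 ^ 2 * X 2 + (X 0 * X 1 * X 3 + X 0 * X 1 * X 3)) * b * e,
      a * e + b * c, ?_⟩
    have h := f3_sq (K := K)
    rw [map_add, map_mul (aeval ff) (_ * b), map_mul (aeval ff) _ b, ← h]
    simp only [map_add, map_mul]; ring

section local_arg
variable {D : Subalgebra K (SS K)}

/-- Elements which after multiplication by a power of `t` are polynomials in `s` over `D`. -/
def LocP (D : Subalgebra K (SS K)) (t s : SS K) (p : SS K) : Prop :=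
  ∃ N : ℕ, t ^ N * p ∈ (Polynomial.aeval (R := D) s).range

theorem LocP.add {t s p q : SS K} (ht : t ∈ D) (hp : LocP D t s p) (hq : LocP D t s q) :
    LocP D t s (p + q) := by
  obtain ⟨N, hN⟩ := hp
  obtain ⟨M, hM⟩ := hq
  have ht' : ∀ n, t ^ n ∈ (Polynomial.aeval (R := D) s).range := fun n =>
    pow_mem ((Polynomial.aeval (R := D) s).range.algebraMap_mem ⟨t, ht⟩) n
  refine ⟨N + M, ?_⟩
  have : t ^ (N + M) * (p + q) = t ^ M * (t ^ N * p) + t ^ N * (t ^ M * q) := by ring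
  rw [this]
  exact add_mem (mul_mem (ht' _) hN) (mul_mem (ht' _) hM)

theorem LocP.mul {t s p q : SS K} (hp : LocP D t s p) (hq : LocP D t s q) :
    LocP D t s (p * q) := by
  obtain ⟨N, hN⟩ := hp
  obtain ⟨M, hM⟩ := hq
  refine ⟨N + M, ?_⟩
  have : t ^ (N + M) * (p * q) = (t ^ N * p) * (t ^ M * q) := by ring
  rw [this]
  exact mul_mem hN hM

theorem LocP.of_mem {t s p : SS K} (hp : p ∈ D) : LocP D t s p :=
  ⟨0, by
    rw [pow_zero, one_mul]
    exact (Polynomial.aeval (R := D) s).range.algebraMap_mem ⟨p, hp⟩⟩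

theorem LocP.self {t s : SS K} : LocP D t s s :=
  ⟨0, by rw [pow_zero, one_mul]; exact ⟨Polynomial.X, by simp⟩⟩

theorem LocP.of_mul {t s p : SS K} (h : LocP D t s (t * p)) : LocP D t s p := by
  obtain ⟨N, hN⟩ := h
  exact ⟨N + 1, by rwa [pow_succ, mul_assoc]⟩

theorem LocP.sub {t s p q : SS K} (ht : t ∈ D) (hp : LocP D t s p) (hq : LocP D t s q) :
    LocP D t s (p - q) := by
  have h : p - q = p + (algebraMap K (SS K) (-1)) * q := by
    rw [map_neg, map_one]; ring
  rw [h]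
  exact hp.add ht ((LocP.of_mem (D.algebraMap_mem _)).mul hq)

theorem LocP.const [CharZero K] {t s p : SS K} (hD : ∀ x ∈ D, dS x = 0) (ht : t ∈ D) (hs : dS s = t)
    (h0 : t ≠ 0) (hp : LocP D t s p) (hc : dS p = 0) : ∃ N : ℕ, t ^ N * p ∈ D := by
  obtain ⟨N, P, hP⟩ := hp
  refine ⟨N, ?_⟩
  have h : dS (t ^ N * p) = 0 := by
    rw [Derivation.leibniz, hc, hD _ (pow_mem ht N)]; simp
  have hP' : Polynomial.aeval s P = t ^ N * p := hP
  rw [← hP'] at h ⊢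
  exact slice_aux dS D hD s t hs h0 P h

end local_arg

theorem half_mul [CharZero K] (x : SS K) : algebraMap K (SS K) (1/2) * (2 * x) = x := by
  rw [← mul_assoc]
  have : (2 : SS K) = algebraMap K (SS K) 2 := (map_ofNat _ 2).symm
  rw [this, ← map_mul]; norm_num

theorem loc_V [CharZero K] (p : SS K) : LocP DD (V 0) (V 1) p := by
  have ht : (V 0 : SS K) ∈ (DD : Subalgebra K (SS K)) := ff_mem (K := K) 1
  have hu0 : LocP DD (V 0 : SS K) (V 1) (U 0) := LocP.of_mem (ff_mem (K := K) 0)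
  have hv0 : LocP DD (V 0 : SS K) (V 1) (V 0) := LocP.of_mem ht
  have hv1 : LocP DD (V 0 : SS K) (V 1) (V 1) := LocP.self
  have hu1 : LocP DD (V 0 : SS K) (V 1) (U 1) := by
    apply LocP.of_mul
    have : V 0 * U 1 = U 0 * V 1 - (f3 : SS K) := by simp [f3]; ring
    rw [this]
    exact (hu0.mul hv1).sub ht (LocP.of_mem f3_mem)
  have hv2 : LocP DD (V 0 : SS K) (V 1) (V 2) := by
    apply LocP.of_mul
    have : V 0 * V 2 = algebraMap K (SS K) (1/2) * (V 1 * V 1 - ff 4 : SS K) := by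
      rw [← half_mul (V 0 * V 2)]; congr 1; simp [ff]; ring
    rw [this]
    exact (LocP.of_mem (DD.algebraMap_mem _)).mul ((hv1.mul hv1).sub ht (LocP.of_mem (ff_mem 4)))
  have hu2 : LocP DD (V 0 : SS K) (V 1) (U 2) := by
    apply LocP.of_mul
    have : V 0 * U 2 = ff 3 - U 0 * V 2 + (U 1 * V 1 : SS K) := by simp [ff]; ring
    rw [this]
    exact ((LocP.of_mem (ff_mem 3)).sub ht (hu0.mul hv2)).add ht (hu1.mul hv1)
  induction p using MvPolynomial.induction_on with
  | C a => exact LocP.of_mem (DD.algebraMap_mem a)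
  | add p q hp hq => exact hp.add ht hq
  | mul_X p i hp =>
    refine hp.mul ?_
    rcases i with i | i
    · fin_cases i
      · exact hu0
      · exact hu1
      · exact hu2
    · fin_cases i
      · exact hv0
      · exact hv1
      · exact hv2

theorem const_loc [CharZero K] (h : SS K) (hh : dS h = 0) :
    ∃ (N : ℕ) (r r' : MvPolynomial (Fin 5) K), V 0 ^ N * h = aeval ff r + f3 * aeval ff r' := by
  obtain ⟨N, hN⟩ := LocP.const (K := K) DD_const (ff_mem (K := K) 1) dS_V1 V0_ne (loc_V h) hh
  exact ⟨N, DD_form _ hN⟩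

/-- The `K[f₁,f₂,f₄,f₅,f₆]`-span of the `c_i`. -/
def InM (p : SS K) : Prop :=
  ∃ r : Fin 5 → MvPolynomial (Fin 5) K, p = ∑ i, aeval ff (r i) * cc i

theorem InM.add {p q : SS K} (hp : InM p) (hq : InM q) : InM (p + q) := by
  obtain ⟨r, rfl⟩ := hp
  obtain ⟨r', rfl⟩ := hq
  exact ⟨r + r', by simp [add_mul, Finset.sum_add_distrib]⟩

theorem InM.smul (a : MvPolynomial (Fin 5) K) {p : SS K} (hp : InM p) :
    InM (aeval ff a * p) := by
  obtain ⟨r, rfl⟩ := hp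
  exact ⟨fun i => a * r i, by simp [Finset.mul_sum, mul_assoc]⟩

theorem InM.c (i : Fin 5) : InM (cc i : SS K) := by
  refine ⟨Pi.single i 1, ?_⟩
  rw [Finset.sum_eq_single i]
  · simp
  · intro j _ hj; simp [hj]
  · simp

theorem f3_c0 : InM (f3 * cc 0 : SS K) := by
  have : (f3 * cc 0 : SS K) = aeval ff (X 1 : MvPolynomial (Fin 5) K) * cc 2
    + aeval ff (- X 0 : MvPolynomial (Fin 5) K) * cc 1 := by
    simp [f3, cc, ff]; ring
  rw [this]
  exact ((InM.c 2).smul _).add ((InM.c 1).smul _)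

theorem f3_c1 : InM (f3 * cc 1 : SS K) := by
  have : (f3 * cc 1 : SS K) = aeval ff (- X 4 * X 0 - X 3 * X 1 : MvPolynomial (Fin 5) K) * cc 0
    + aeval ff (X 1 * X 1 : MvPolynomial (Fin 5) K) * cc 3 := by
    simp [f3, cc, ff]; ring
  rw [this]
  exact ((InM.c 0).smul _).add ((InM.c 3).smul _)

theorem const_c [CharZero K] (h : SS K) (hh : dS h = 0) (j : Fin 5) (hj : InM (f3 * cc j : SS K)) :
    ∃ N : ℕ, InM (V 0 ^ N * (h * cc j)) := by
  obtain ⟨N, r, r', e⟩ := const_loc h hh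
  refine ⟨N, ?_⟩
  have : V 0 ^ N * (h * cc j) = aeval ff r * cc j + aeval ff r' * (f3 * cc j) := by
    rw [← mul_assoc, e]; ring
  rw [this]
  exact ((InM.c j).smul _).add (hj.smul _)

theorem InM.V0 {p : SS K} (N : ℕ) (h : InM p) : InM (V 0 ^ N * p) := by
  have := h.smul (X 1 ^ N)
  simpa [ff] using this

theorem M_loc [CharZero K] (p : SS K) (h3 : dS (dS (dS p)) = 0)
    (hr : V 0 * p - V 1 * dS p + V 2 * dS (dS p) = 0) : ∃ N : ℕ, InM (V 0 ^ N * p) := by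
  have hk : dS (-(V 0 * dS p - V 1 * dS (dS p))) = 0 := by
    simp [Derivation.leibniz, h3]; ring
  obtain ⟨N, hN⟩ := const_c _ hk 0 f3_c0
  obtain ⟨M, hM⟩ := const_c _ h3 1 f3_c1
  refine ⟨N + M + 2, ?_⟩
  have : V 0 ^ (N + M + 2) * p = V 0 ^ M * (V 0 ^ N * (-(V 0 * dS p - V 1 * dS (dS p)) * cc 0))
      + V 0 ^ N * (V 0 ^ M * (dS (dS p) * cc 1)) := by
    simp only [cc, Matrix.cons_val_zero, Matrix.cons_val_one]
    linear_combination (V 0 ^ (N + M + 1)) * hr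
  rw [this]
  exact (hN.V0 _).add (hM.V0 _)

/-- Setting the variable `X 1` (that is `f₂`) to zero. -/
def sg : MvPolynomial (Fin 5) K →ₐ[K] MvPolynomial (Fin 5) K :=
  aeval ![X 0, 0, X 2, X 3, X 4]

theorem sg_dvd (r : MvPolynomial (Fin 5) K) : ∃ r', r = sg r + X 1 * r' := by
  induction r using MvPolynomial.induction_on with
  | C a => exact ⟨0, by simp [sg, algebraMap_eq]⟩
  | add p q hp hq =>
    obtain ⟨a, ha⟩ := hp
    obtain ⟨b, hb⟩ := hq
    exact ⟨a + b, by rw [map_add]; linear_combination ha + hb⟩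
  | mul_X p i hp =>
    obtain ⟨a, ha⟩ := hp
    have hX : ∃ b : MvPolynomial (Fin 5) K, (X i : MvPolynomial (Fin 5) K) = sg (X i) + X 1 * b := by
      fin_cases i
      · exact ⟨0, by simp [sg]⟩
      · exact ⟨1, by simp [sg]⟩
      · exact ⟨0, by simp [sg]⟩
      · exact ⟨0, by simp [sg]⟩
      · exact ⟨0, by simp [sg]⟩
    obtain ⟨b, hb⟩ := hX
    refine ⟨a * X i + sg p * b, ?_⟩
    rw [map_mul]
    linear_combination (X i) * ha + sg p * hb

theorem eval_sg (x : Fin 5 → K) (r : MvPolynomial (Fin 5) K) :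
    eval x (sg r) = eval ![x 0, 0, x 2, x 3, x 4] r := by
  have : (MvPolynomial.aeval x).comp (sg (K := K)) = MvPolynomial.aeval ![x 0, 0, x 2, x 3, x 4] := by
    apply MvPolynomial.algHom_ext
    intro i
    fin_cases i <;> simp [sg]
  have h := DFunLike.congr_fun this r
  simpa [MvPolynomial.aeval_eq_eval] using h

theorem eval_ff (x : Fin 3 ⊕ Fin 3 → K) (r : MvPolynomial (Fin 5) K) :
    eval x (aeval ff r) = eval (fun i => eval x (ff i)) r := by
  have : (MvPolynomial.aeval x).comp (MvPolynomial.aeval (ff (K := K)))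
      = MvPolynomial.aeval (fun i => eval x (ff i)) := by
    apply MvPolynomial.algHom_ext
    intro i
    simp [MvPolynomial.aeval_eq_eval]
  have h := DFunLike.congr_fun this r
  simpa [MvPolynomial.aeval_eq_eval] using h

/-- The dense set of points. -/
def sset : Fin 5 → Set K :=
  ![{a | a ≠ 0}, Set.univ, Set.univ, Set.univ, {e | ∃ y : K, y ≠ 0 ∧ e = y ^ 2}]

theorem sset_inf [CharZero K] (i : Fin 5) : (sset (K := K) i).Infinite := by
  have h1 : (Set.univ : Set K).Infinite := Set.infinite_univ
  have h2 : {e : K | ∃ y : K, y ≠ 0 ∧ e = y ^ 2}.Infinite := by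
    have : Function.Injective (fun n : ℕ => ((n : K) + 1) ^ 2) := by
      intro a b h
      have h' : (((a + 1) ^ 2 : ℕ) : K) = (((b + 1) ^ 2 : ℕ) : K) := by push_cast; exact h
      have h'' := Nat.cast_injective h'
      have := Nat.pow_left_injective (n := 2) (by norm_num) h''
      omega
    refine (Set.infinite_range_of_injective this).mono ?_
    rintro _ ⟨n, rfl⟩
    exact ⟨(n : K) + 1, by exact_mod_cast Nat.succ_ne_zero n, rfl⟩
  have h0 : {a : K | a ≠ 0}.Infinite := by
    refine h2.mono ?_
    rintro _ ⟨y, hy, rfl⟩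
    exact pow_ne_zero _ hy
  fin_cases i
  · exact h0
  · exact h1
  · exact h1
  · exact h1
  · exact h2

theorem zero_of [CharZero K] (r : MvPolynomial (Fin 5) K)
    (h : ∀ a b c y : K, a ≠ 0 → y ≠ 0 → eval ![a, 0, b, c, y ^ 2] r = 0) : sg r = 0 := by
  apply MvPolynomial.funext_set sset sset_inf
  intro x hx
  have hx0 := hx 0 (Set.mem_univ _)
  obtain ⟨y, hy, e⟩ := hx 4 (Set.mem_univ _)
  rw [eval_sg, map_zero, e]
  exact h _ _ _ _ hx0 hy

theorem eval_point [CharZero K] (r : Fin 5 → MvPolynomial (Fin 5) K) (p : SS K)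
    (h : V 0 * p = ∑ i, aeval ff (r i) * cc i) (a b c y t : K) (ha : a ≠ 0) :
    let e := fun i => eval ![a, 0, b, c, y ^ 2] (r i)
    2 * a * (- e 0 * y + e 1 * y ^ 2 - e 2 * c) + e 3 * (y * t ^ 2 + 2 * c * t + y * b)
      + e 4 * (y ^ 2 * t ^ 2 + 2 * c * y * t + 2 * c ^ 2 - y ^ 2 * b) = 0 := by
  intro e
  let x : Fin 3 ⊕ Fin 3 → K := Sum.elim ![a, t, (t ^ 2 - b) / (2 * a)] ![0, y, (c + t * y) / a]
  have hff : (fun i => eval x (ff i)) = ![a, 0, b, c, y ^ 2] := by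
    funext i
    fin_cases i <;> simp [ff, U, V, x] <;> field_simp <;> ring
  have h' := congrArg (eval x) h
  rw [map_sum, map_mul] at h'
  simp only [map_mul, eval_ff, hff] at h'
  have hV : eval x (V 0) = 0 := by simp [V, x]
  rw [hV, zero_mul] at h'
  simp only [Fin.sum_univ_five] at h'
  change 0 = e 0 * _ + e 1 * _ + e 2 * _ + e 3 * _ + e 4 * _ at h'
  simp [cc, U, V, x] at h'
  field_simp at h'
  linear_combination -h'

theorem sg_syz [CharZero K] (r : Fin 5 → MvPolynomial (Fin 5) K) (p : SS K)
    (h : V 0 * p = ∑ i, aeval ff (r i) * cc i) :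
    sg (r 0) = 0 ∧ sg (r 3) = 0 ∧ sg (r 4) = 0 ∧ sg (r 1) * X 4 = sg (r 2) * X 3 := by
  have key : ∀ a b c y : K, a ≠ 0 → y ≠ 0 →
      eval ![a, 0, b, c, y ^ 2] (r 0) = 0 ∧ eval ![a, 0, b, c, y ^ 2] (r 3) = 0 ∧
      eval ![a, 0, b, c, y ^ 2] (r 4) = 0 ∧
      eval ![a, 0, b, c, y ^ 2] (r 1) * y ^ 2 = eval ![a, 0, b, c, y ^ 2] (r 2) * c := by
    intro a b c y ha hy
    have P : ∀ t, _ := fun t => eval_point r p h a b c y t ha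
    have Q : ∀ t, _ := fun t => eval_point r p h a b c (-y) t ha
    simp only [neg_sq] at P Q
    set e0 := eval ![a, 0, b, c, y ^ 2] (r 0)
    set e1 := eval ![a, 0, b, c, y ^ 2] (r 1)
    set e2 := eval ![a, 0, b, c, y ^ 2] (r 2)
    set e3 := eval ![a, 0, b, c, y ^ 2] (r 3)
    set e4 := eval ![a, 0, b, c, y ^ 2] (r 4)
    have A : 2 * y * (e3 + y * e4) = 0 := by
      linear_combination P 1 + P (-1) - 2 * P 0
    have B : 2 * (-y) * (e3 + (-y) * e4) = 0 := by
      linear_combination Q 1 + Q (-1) - 2 * Q 0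
    have A' : e3 + y * e4 = 0 := by
      rcases mul_eq_zero.mp A with h | h
      · exact absurd h (by simp [hy])
      · exact h
    have B' : e3 + (-y) * e4 = 0 := by
      rcases mul_eq_zero.mp B with h | h
      · exact absurd h (by simp [hy])
      · exact h
    have E3 : e3 = 0 := by
      have : 2 * e3 = 0 := by linear_combination A' + B'
      simpa using this
    have E4 : e4 = 0 := by
      have : y * e4 = 0 := by linear_combination A' - E3
      simpa [hy] using this
    have P0 := P 0
    have Q0 := Q 0
    rw [E3, E4] at P0 Q0
    have E0 : e0 = 0 := by
      have : (4 * a * y) * e0 = 0 := by linear_combination Q0 - P0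
      simpa [ha, hy] using this
    refine ⟨E0, E3, E4, ?_⟩
    have : (2 * a) * (e1 * y ^ 2 - e2 * c) = 0 := by
      rw [E0] at P0
      linear_combination P0
    have := (mul_eq_zero.mp this).resolve_left (by simp [ha])
    linear_combination this
  refine ⟨zero_of _ fun a b c y ha hy => (key a b c y ha hy).1,
    zero_of _ fun a b c y ha hy => (key a b c y ha hy).2.1,
    zero_of _ fun a b c y ha hy => (key a b c y ha hy).2.2.1, ?_⟩
  have : sg (r 1 * X 4 - r 2 * X 3) = 0 := by
    apply zero_of
    intro a b c y ha hy
    have := (key a b c y ha hy).2.2.2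
    simp [this]
  rw [map_sub, map_mul, map_mul] at this
  have h4 : sg (X 4 : MvPolynomial (Fin 5) K) = X 4 := by simp [sg]
  have h3 : sg (X 3 : MvPolynomial (Fin 5) K) = X 3 := by simp [sg]
  rw [h4, h3] at this
  exact sub_eq_zero.mp this

theorem InM.descent [CharZero K] {p : SS K} (h : InM (V 0 * p)) : InM p := by
  obtain ⟨r, hr⟩ := h
  obtain ⟨s0, s3, s4, s12⟩ := sg_syz r p hr
  have hd : (X 3 : MvPolynomial (Fin 5) K) ∣ sg (r 1) := by
    have : (X 3 : MvPolynomial (Fin 5) K) ∣ sg (r 1) * X 4 := ⟨sg (r 2), by rw [s12, mul_comm]⟩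
    rcases X_dvd_mul_iff.mp this with h | h
    · exact h
    · rw [X_dvd_X] at h; exact absurd h (by decide)
  obtain ⟨t, ht⟩ := hd
  have ht2 : sg (r 2) = X 4 * t := by
    have hX : (X 3 : MvPolynomial (Fin 5) K) ≠ 0 := X_ne_zero _
    apply mul_right_cancel₀ hX
    rw [← s12, ht]; ring
  choose q hq using fun i => sg_dvd (r i)
  have e : V 0 * p = V 0 * (∑ i, aeval ff (q i) * cc i + aeval ff t * cc 4) := by
    rw [hr]
    simp only [Fin.sum_univ_five]
    rw [hq 0, hq 1, hq 2, hq 3, hq 4, s0, s3, s4, ht, ht2]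
    simp only [map_add, map_mul, aeval_X, map_zero]
    simp [ff, cc]
    ring
  have e' := mul_left_cancel₀ V0_ne e
  rw [e']
  exact InM.add ⟨q, rfl⟩ ((InM.c 4).smul _)

/-- The description of the constants of the commutator ideal. -/
theorem M_main [CharZero K] (p : SS K) (h3 : dS (dS (dS p)) = 0)
    (hr : V 0 * p - V 1 * dS p + V 2 * dS (dS p) = 0) : InM p := by
  obtain ⟨N, hN⟩ := M_loc p h3 hr
  induction N with
  | zero => simpa using hN
  | succ n ih =>
    apply ih
    apply InM.descent
    rwa [← mul_assoc, ← pow_succ']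

/-! ### The commutative part -/

def gg : Fin 2 → SS K := ![U 0, U 1 * U 1 - (U 0 * U 2 + U 2 * U 0)]

/-- Setting the first variable to zero. -/
def sg2 : MvPolynomial (Fin 2) K →ₐ[K] MvPolynomial (Fin 2) K :=
  aeval ![0, X 1]

theorem sg2_dvd (r : MvPolynomial (Fin 2) K) : ∃ r', r = sg2 r + X 0 * r' := by
  induction r using MvPolynomial.induction_on with
  | C a => exact ⟨0, by simp [sg2, algebraMap_eq]⟩
  | add p q hp hq =>
    obtain ⟨a, ha⟩ := hp
    obtain ⟨b, hb⟩ := hq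
    exact ⟨a + b, by rw [map_add]; linear_combination ha + hb⟩
  | mul_X p i hp =>
    obtain ⟨a, ha⟩ := hp
    have hX : ∃ b : MvPolynomial (Fin 2) K,
        (X i : MvPolynomial (Fin 2) K) = sg2 (X i) + X 0 * b := by
      fin_cases i
      · exact ⟨1, by simp [sg2]⟩
      · exact ⟨0, by simp [sg2]⟩
    obtain ⟨b, hb⟩ := hX
    refine ⟨a * X i + sg2 p * b, ?_⟩
    rw [map_mul]
    linear_combination (X i) * ha + sg2 p * hb

theorem eval_sg2 (x : Fin 2 → K) (r : MvPolynomial (Fin 2) K) :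
    eval x (sg2 r) = eval ![0, x 1] r := by
  have : (MvPolynomial.aeval x).comp (sg2 (K := K)) = MvPolynomial.aeval ![0, x 1] := by
    apply MvPolynomial.algHom_ext
    intro i
    fin_cases i <;> simp [sg2]
  have h := DFunLike.congr_fun this r
  simpa [MvPolynomial.aeval_eq_eval] using h

theorem eval_gg (x : Fin 3 ⊕ Fin 3 → K) (r : MvPolynomial (Fin 2) K) :
    eval x (aeval gg r) = eval (fun i => eval x (gg i)) r := by
  have : (MvPolynomial.aeval x).comp (MvPolynomial.aeval (gg (K := K)))
      = MvPolynomial.aeval (fun i => eval x (gg i)) := by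
    apply MvPolynomial.algHom_ext
    intro i
    simp [MvPolynomial.aeval_eq_eval]
  have h := DFunLike.congr_fun this r
  simpa [MvPolynomial.aeval_eq_eval] using h

theorem comm_main [CharZero K] (h : SS K) (hU : h ∈ (aeval (R := K) (U (K := K))).range)
    (hh : dS h = 0) : ∃ g : MvPolynomial (Fin 2) K, h = aeval gg g := by
  have hc : ∀ x ∈ (aeval (R := K) (gg (K := K))).range, dS x = 0 := by
    rintro _ ⟨g, rfl⟩
    induction g using MvPolynomial.induction_on with
    | C a => simp
    | add p q hp hq => simp only [map_add] at *; rw [hp, hq, add_zero]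
    | mul_X p i hp =>
      simp only [AlgHom.toRingHom_eq_coe, RingHom.coe_coe] at hp ⊢
      rw [map_mul, Derivation.leibniz, hp, aeval_X, smul_zero, add_zero]
      have : dS (gg i : SS K) = 0 := by
        fin_cases i <;> simp [gg, Derivation.leibniz] <;> ring
      rw [this, smul_zero]
  have m0 : (U 0 : SS K) ∈ (aeval (R := K) (gg (K := K))).range := ⟨X 0, by simp [gg]⟩
  have m1 : (gg 1 : SS K) ∈ (aeval (R := K) (gg (K := K))).range := ⟨X 1, by simp⟩
  have l0 : LocP (aeval (R := K) (gg (K := K))).range (U 0) (U 1) (U 0) := LocP.of_mem m0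
  have l1 : LocP (aeval (R := K) (gg (K := K))).range (U 0) (U 1) (U 1) := LocP.self
  have l2 : LocP (aeval (R := K) (gg (K := K))).range (U 0) (U 1) (U 2) := by
    apply LocP.of_mul
    have : U 0 * U 2 = algebraMap K (SS K) (1/2) * (U 1 * U 1 - gg 1 : SS K) := by
      rw [← half_mul (U 0 * U 2)]; congr 1; simp [gg]; ring
    rw [this]
    exact (LocP.of_mem (Subalgebra.algebraMap_mem _ _)).mul ((l1.mul l1).sub m0 (LocP.of_mem m1))
  have hl : LocP (aeval (R := K) (gg (K := K))).range (U 0) (U 1) h := by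
    obtain ⟨f, rfl⟩ := hU
    clear hh
    simp only [AlgHom.toRingHom_eq_coe, RingHom.coe_coe]
    induction f using MvPolynomial.induction_on with
    | C a => rw [algHom_C]; exact LocP.of_mem (Subalgebra.algebraMap_mem _ a)
    | add p q hp hq => rw [map_add]; exact hp.add m0 hq
    | mul_X p i hp =>
      rw [map_mul, aeval_X]
      refine hp.mul ?_
      fin_cases i
      · exact l0
      · exact l1
      · exact l2
  obtain ⟨N, hN⟩ := LocP.const hc m0 dS_U1 U0_ne hl hh
  clear hl hU hh
  induction N with
  | zero =>
    obtain ⟨g, hg⟩ := hN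
    exact ⟨g, by simpa using hg.symm⟩
  | succ n ih =>
    apply ih
    obtain ⟨g, hg⟩ := hN
    have hg' : aeval gg g = U 0 ^ (n + 1) * h := hg
    obtain ⟨g', e⟩ := sg2_dvd g
    have h0 : sg2 g = 0 := by
      apply MvPolynomial.funext_set (fun i => sset ((![0, 4] : Fin 2 → Fin 5) i))
        (fun i => sset_inf _)
      intro x hx
      obtain ⟨y, hy, e4⟩ := hx 1 (Set.mem_univ _)
      have h1 := congrArg (eval (Sum.elim ![0, y, 0] ![0, 0, 0] : Fin 3 ⊕ Fin 3 → K)) hg'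
      rw [eval_gg] at h1
      have h2 : (fun i => eval (Sum.elim ![0, y, 0] ![0, 0, 0] : Fin 3 ⊕ Fin 3 → K) (gg i))
          = ![0, x 1] := by
        funext i
        fin_cases i
        · simp [gg, U]
        · simp [gg, U, e4]; ring
      rw [h2] at h1
      rw [eval_sg2, h1]
      simp [U]
    rw [h0, zero_add] at e
    refine ⟨g', ?_⟩
    change aeval gg g' = _
    apply mul_left_cancel₀ U0_ne
    rw [← mul_assoc, ← pow_succ', ← hg', e, map_mul, aeval_X]
    simp [gg]

end MetabAux
namespace MetabAux

open MvPolynomial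

/-- A copy of the free metabelian algebra with streamlined instances. -/
def FF (K : Type*) [Field K] : Type _ := FreeMetab K 3

instance instRingFF (K : Type*) [Field K] : Ring (FF K) :=
  inferInstanceAs (Ring (FreeMetab K 3))

instance instAlgFF (K : Type*) [Field K] : Algebra K (FF K) :=
  inferInstanceAs (@Algebra K (FreeMetab K 3) _ (RingQuot.instRing (MetabRel K 3)).toSemiring)

variable {K : Type*} [Field K]

def xx (K : Type*) [Field K] (i : Fin 3) : FF K := xg K 3 i

def mkF : FreeAlgebra K (Fin 3) →ₐ[K] FF K := RingQuot.mkAlgHom K (MetabRel K 3)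

theorem mkF_surj : Function.Surjective (mkF (K := K)) :=
  RingQuot.mkAlgHom_surjective K (MetabRel K 3)

theorem mkF_ι (i : Fin 3) : mkF (FreeAlgebra.ι K i) = xx K i := rfl

def liftF {B : Type*} [Semiring B] [Algebra K B] (f : FreeAlgebra K (Fin 3) →ₐ[K] B)
    (hf : ∀ a b c e, f ((a * b - b * a) * (c * e - e * c)) = 0) : FF K →ₐ[K] B :=
  RingQuot.liftAlgHom K (s := MetabRel K 3) ⟨f, by
    rintro p q ⟨rfl, a, b, c, e, rfl⟩
    rw [map_zero]; exact hf _ _ _ _⟩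

theorem liftF_mk {B : Type*} [Semiring B] [Algebra K B] (f : FreeAlgebra K (Fin 3) →ₐ[K] B)
    (hf : ∀ a b c e, f ((a * b - b * a) * (c * e - e * c)) = 0) (a : FreeAlgebra K (Fin 3)) :
    liftF f hf (mkF a) = f a := RingQuot.liftAlgHom_mkAlgHom_apply K f _ a

theorem F_ind {P : FF K → Prop} (hK : ∀ r : K, P (algebraMap K _ r))
    (hx : ∀ i, P (xx K i)) (hadd : ∀ a b, P a → P b → P (a + b))
    (hmul : ∀ a b, P a → P b → P (a * b)) (w : FF K) : P w := by
  obtain ⟨a, rfl⟩ := mkF_surj w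
  induction a using FreeAlgebra.induction with
  | grade0 r => rw [AlgHom.commutes]; exact hK r
  | grade1 i => exact hx i
  | mul a b ha hb => rw [map_mul]; exact hmul _ _ ha hb
  | add a b ha hb => rw [map_add]; exact hadd _ _ ha hb

theorem F_rel (a b c e : FF K) : (a * b - b * a) * (c * e - e * c) = 0 := by
  obtain ⟨a, rfl⟩ := mkF_surj a
  obtain ⟨b, rfl⟩ := mkF_surj b
  obtain ⟨c, rfl⟩ := mkF_surj c
  obtain ⟨e, rfl⟩ := mkF_surj e
  have : MetabRel K 3 ((a * b - b * a) * (c * e - e * c)) 0 := ⟨rfl, a, b, c, e, rfl⟩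
  have h : mkF _ = mkF _ := RingQuot.mkAlgHom_rel K this
  simpa only [map_mul, map_sub, map_zero] using h

/-- Maps into commutative algebras. -/
def comHom (f : Fin 3 → SS K) : FF K →ₐ[K] SS K :=
  liftF (FreeAlgebra.lift K f) (by
    intro a b c e
    simp only [map_mul, map_sub]; ring)

@[simp] theorem comHom_x (f : Fin 3 → SS K) (i : Fin 3) : comHom f (xx K i) = f i := by
  rw [comHom, ← mkF_ι, liftF_mk]; simp

def eL : FF K →ₐ[K] SS K := comHom U
def eR : FF K →ₐ[K] SS K := comHom (fun i => U i + V i)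

@[simp] theorem eL_x (i : Fin 3) : eL (xx K i) = U i := comHom_x _ _
@[simp] theorem eR_x (i : Fin 3) : eR (xx K i) = U i + V i := comHom_x _ _

/-- Magnus matrices, on the free algebra. -/
def mat0 (i : Fin 3) : FreeAlgebra K (Fin 3) →ₐ[K] Matrix (Fin 2) (Fin 2) (SS K) :=
  FreeAlgebra.lift K (fun j => !![U j, if i = j then 1 else 0; 0, U j + V j])

theorem mat0_low (i : Fin 3) (a : FreeAlgebra K (Fin 3)) : mat0 i a 1 0 = 0 := by
  induction a using FreeAlgebra.induction with
  | grade0 r => rw [AlgHom.commutes]; simp [Matrix.algebraMap_matrix_apply]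
  | grade1 j => simp [mat0]
  | mul a b ha hb => rw [map_mul, Matrix.mul_apply]; simp [ha, hb]
  | add a b ha hb => rw [map_add]; simp [ha, hb]

def mat (i : Fin 3) : FF K →ₐ[K] Matrix (Fin 2) (Fin 2) (SS K) :=
  liftF (mat0 i) (by
    intro a b c e
    simp only [map_mul, map_sub]
    have ha := mat0_low i a
    have hb := mat0_low i b
    have hc := mat0_low i c
    have he := mat0_low i e
    ext k l
    fin_cases k <;> fin_cases l <;>
      simp [Matrix.mul_apply, Fin.sum_univ_two, ha, hb, hc, he] <;> ring_nf <;> simp)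

theorem mat_x (i j : Fin 3) :
    mat i (xx K j) = !![U j, if i = j then 1 else 0; 0, U j + V j] := by
  rw [mat, ← mkF_ι, liftF_mk]; simp [mat0]

theorem mat_low (i : Fin 3) (w : FF K) : mat i w 1 0 = 0 := by
  induction w using F_ind with
  | hK r => rw [AlgHom.commutes]; simp [Matrix.algebraMap_matrix_apply]
  | hx j => simp [mat_x]
  | hmul a b ha hb => rw [map_mul, Matrix.mul_apply]; simp [ha, hb]
  | hadd a b ha hb => rw [map_add]; simp [ha, hb]

theorem mat_L (i : Fin 3) (w : FF K) : mat i w 0 0 = eL w := by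
  induction w using F_ind with
  | hK r => rw [AlgHom.commutes, AlgHom.commutes]; simp [Matrix.algebraMap_matrix_apply]
  | hx j => simp [mat_x]
  | hmul a b ha hb => rw [map_mul, Matrix.mul_apply, Fin.sum_univ_two, mat_low, ha, hb]; simp
  | hadd a b ha hb => rw [map_add]; simp [ha, hb]

theorem mat_R (i : Fin 3) (w : FF K) : mat i w 1 1 = eR w := by
  induction w using F_ind with
  | hK r => rw [AlgHom.commutes, AlgHom.commutes]; simp [Matrix.algebraMap_matrix_apply]
  | hx j => simp [mat_x]
  | hmul a b ha hb => rw [map_mul, Matrix.mul_apply, Fin.sum_univ_two, mat_low, ha, hb]; simp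
  | hadd a b ha hb => rw [map_add]; simp [ha, hb]

/-- Magnus (Fox) coordinates. -/
def DF (i : Fin 3) : FF K →ₗ[K] SS K where
  toFun w := mat i w 0 1
  map_add' a b := by simp
  map_smul' r a := by simp

theorem DF_mul (i : Fin 3) (a b : FF K) :
    DF i (a * b) = eL a * DF i b + DF i a * eR b := by
  change mat i (a * b) 0 1 = _ * mat i b 0 1 + mat i a 0 1 * _
  rw [map_mul, Matrix.mul_apply, Fin.sum_univ_two, mat_L, mat_R]

theorem DF_x (i j : Fin 3) : DF i (xx K j) = if i = j then 1 else 0 := by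
  change mat i (xx K j) 0 1 = _
  simp [mat_x]

theorem DF_alg (i : Fin 3) (r : K) : DF i (algebraMap K (FF K) r) = 0 := by
  change mat i _ 0 1 = _
  rw [AlgHom.commutes]; simp [Matrix.algebraMap_matrix_apply]

/-- The ideal on which the polynomial ring acts. -/
def J : Submodule K (FF K) where
  carrier := {z | eL z = 0 ∧ eR z = 0 ∧ ∀ a b, z * (a * b - b * a) = 0 ∧ (a * b - b * a) * z = 0}
  zero_mem' := by simp
  add_mem' := by
    rintro x y ⟨h1, h2, h3⟩ ⟨k1, k2, k3⟩
    refine ⟨by rw [map_add, h1, k1, add_zero], by rw [map_add, h2, k2, add_zero], fun a b => ?_⟩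
    rw [add_mul, mul_add, (h3 a b).1, (h3 a b).2, (k3 a b).1, (k3 a b).2]; simp
  smul_mem' := by
    rintro r x ⟨h1, h2, h3⟩
    refine ⟨by rw [map_smul, h1, smul_zero], by rw [map_smul, h2, smul_zero], fun a b => ?_⟩
    rw [smul_mul_assoc, mul_smul_comm, (h3 a b).1, (h3 a b).2]; simp

theorem J_left (c : FF K) {z : FF K} (hz : z ∈ J (K := K)) :
    c * z ∈ J (K := K) := by
  obtain ⟨h1, h2, h3⟩ := hz
  refine ⟨by rw [map_mul, h1, mul_zero], by rw [map_mul, h2, mul_zero], fun a b => ⟨?_, ?_⟩⟩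
  · rw [mul_assoc, (h3 a b).1, mul_zero]
  · have : (a * b - b * a) * (c * z)
        = (a * (b * c) - (b * c) * a) * z - b * ((a * c - c * a) * z) := by noncomm_ring
    rw [this, (h3 _ _).2, (h3 _ _).2]; simp

theorem J_right (c : FF K) {z : FF K} (hz : z ∈ J (K := K)) :
    z * c ∈ J (K := K) := by
  obtain ⟨h1, h2, h3⟩ := hz
  refine ⟨by rw [map_mul, h1, zero_mul], by rw [map_mul, h2, zero_mul], fun a b => ⟨?_, ?_⟩⟩
  · have : z * c * (a * b - b * a)
        = z * ((c * a) * b - b * (c * a)) - (z * (c * b - b * c)) * a := by noncomm_ring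
    rw [this, (h3 _ _).1, (h3 _ _).1]; simp
  · rw [← mul_assoc, (h3 a b).2, zero_mul]

theorem J_comm (a b : FF K) : a * b - b * a ∈ J (K := K) :=
  ⟨by rw [map_sub, map_mul, map_mul]; ring, by rw [map_sub, map_mul, map_mul]; ring,
    fun c e => ⟨F_rel _ _ _ _, F_rel _ _ _ _⟩⟩

/-- The operators `u_i`, `v_i`. -/
def op : Fin 3 ⊕ Fin 3 → Module.End K (J (K := K))
  | Sum.inl i => (LinearMap.mulLeft K (xx K i)).restrict (fun _ hz => J_left _ hz)
  | Sum.inr i => (LinearMap.mulRight K (xx K i) - LinearMap.mulLeft K (xx K i)).restrict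
      (fun _ hz => sub_mem (J_right _ hz) (J_left _ hz))

theorem op_l (i : Fin 3) (z : J (K := K)) : (op (Sum.inl i) z : FF K) = xx K i * z := rfl
theorem op_r (i : Fin 3) (z : J (K := K)) :
    (op (Sum.inr i) z : FF K) = z * xx K i - xx K i * z := rfl

theorem J_lcomm (a b : FF K) (z : J (K := K)) : a * (b * z) = b * (a * (z : FF K)) := by
  have h := (z.2.2.2 a b).2
  rw [sub_mul, sub_eq_zero] at h
  rw [← mul_assoc, h, mul_assoc]

theorem J_rcomm (a b : FF K) (z : J (K := K)) : z * a * b = (z : FF K) * b * a := by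
  have h := (z.2.2.2 a b).1
  rw [mul_sub, sub_eq_zero] at h
  rw [mul_assoc, h, mul_assoc]

theorem op_comm (i j : Fin 3 ⊕ Fin 3) : op (K := K) i * op j = op j * op i := by
  apply LinearMap.ext
  intro z
  apply Subtype.ext
  change (op i (op j z) : FF K) = op j (op i z)
  rcases i with i | i <;> rcases j with j | j <;>
    simp only [op_l, op_r, mul_sub, sub_mul, mul_assoc]
  · exact J_lcomm _ _ z
  · rw [J_lcomm (xx K i)]
  · rw [J_lcomm (xx K i)]
  · have h := J_rcomm (xx K i) (xx K j) z
    simp only [mul_assoc] at h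
    rw [h, J_lcomm (xx K i)]; abel

theorem exists_aeval {E σ : Type*} [Ring E] [Algebra K E] (f : σ → E)
    (hf : ∀ i j, f i * f j = f j * f i) :
    ∃ ρ : MvPolynomial σ K →ₐ[K] E, ∀ i, ρ (X i) = f i := by
  have hc : ∀ a ∈ Set.range f, ∀ b ∈ Set.range f, a * b = b * a := by
    rintro _ ⟨i, rfl⟩ _ ⟨j, rfl⟩
    exact hf i j
  let _ : CommRing (Algebra.adjoin K (Set.range f)) := Algebra.adjoinCommRingOfComm K hc
  refine ⟨(Algebra.adjoin K (Set.range f)).val.comp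
    (aeval (fun i => (⟨f i, Algebra.subset_adjoin ⟨i, rfl⟩⟩ : Algebra.adjoin K (Set.range f)))),
    fun i => ?_⟩
  simp

theorem exists_rho : ∃ ρ : SS K →ₐ[K] Module.End K (J (K := K)), ∀ i, ρ (X i) = op i := by
  exact exists_aeval op op_comm

/-- The action of `K[U_3,V_3]`. -/
def rho : SS K →ₐ[K] Module.End K (J (K := K)) := exists_rho.choose

theorem rho_X (i) : rho (X i : SS K) = op i := exists_rho.choose_spec i

theorem rho_U (i : Fin 3) (z : J (K := K)) : (rho (U i) z : FF K) = xx K i * z := by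
  rw [U, rho_X]; rfl
theorem rho_V (i : Fin 3) (z : J (K := K)) :
    (rho (V i) z : FF K) = z * xx K i - xx K i * z := by
  rw [V, rho_X]; rfl
theorem rho_mul (p q : SS K) (z : J (K := K)) : rho (p * q) z = rho p (rho q z) := by
  rw [map_mul]; rfl
theorem rho_add (p q : SS K) (z : J (K := K)) : rho (p + q) z = rho p z + rho q z := by
  rw [map_add]; rfl
theorem rho_sub (p q : SS K) (z : J (K := K)) : rho (p - q) z = rho p z - rho q z := by
  rw [map_sub]; rfl

theorem DF_rho (i : Fin 3) (p : SS K) (z : J (K := K)) :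
    DF i (rho p z : FF K) = p * DF i (z : FF K) := by
  induction p using MvPolynomial.induction_on generalizing z with
  | C a =>
    have : rho (C a : SS K) = algebraMap K _ a := rho.commutes a
    rw [this, Module.algebraMap_end_apply, Submodule.coe_smul, map_smul, MvPolynomial.smul_eq_C_mul]
  | add p q hp hq => rw [rho_add, Submodule.coe_add, map_add, hp, hq, add_mul]
  | mul_X p j hp =>
    rw [rho_mul, hp, mul_assoc]
    congr 1
    have h1 := z.2.1
    have h2 := z.2.2.1
    rcases j with j | j
    · have := rho_U j z
      rw [U] at this
      rw [this, DF_mul, h2, eL_x, U]; simp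
    · have := rho_V j z
      rw [V] at this
      rw [this, map_sub, DF_mul, DF_mul, h1, h2, eL_x, eR_x, V]; ring

def kk (i j : Fin 3) : J (K := K) := ⟨xx K i * xx K j - xx K j * xx K i, J_comm _ _⟩

theorem DF_kk (l i j : Fin 3) : DF l ((kk i j : J (K := K)) : FF K)
    = (if l = i then V j else 0) - (if l = j then V i else 0) := by
  simp only [kk, map_sub, DF_mul, DF_x, eL_x, eR_x]
  split_ifs <;> ring

theorem jacobi : rho (V 2) (kk 1 0) - rho (V 1) (kk 2 0) + rho (V 0) (kk 2 1) = (0 : J (K := K)) := by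
  apply Subtype.ext
  simp only [Submodule.coe_add, Submodule.coe_sub, rho_V, kk, Submodule.coe_zero]
  noncomm_ring

/-- Elements represented by three polynomials. -/
def rep (a b c : SS K) : J (K := K) := rho a (kk 1 0) + rho b (kk 2 0) + rho c (kk 2 1)

theorem rho_rep (p a b c : SS K) : rho p (rep a b c) = rep (p * a) (p * b) (p * c) := by
  simp only [rep, map_add, rho_mul]

theorem rep_add (a b c a' b' c' : SS K) :
    rep a b c + rep a' b' c' = rep (a + a') (b + b') (c + c') := by
  simp only [rep, rho_add]; abel

theorem DF_rep0 (a b c : SS K) : DF 0 (rep a b c : FF K) = - a * V 1 - b * V 2 := by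
  simp [rep, DF_rho, DF_kk]; ring
theorem DF_rep1 (a b c : SS K) : DF 1 (rep a b c : FF K) = a * V 0 - c * V 2 := by
  simp [rep, DF_rho, DF_kk]; ring
theorem DF_rep2 (a b c : SS K) : DF 2 (rep a b c : FF K) = b * V 0 + c * V 1 := by
  simp [rep, DF_rho, DF_kk]

theorem rep_inj (a b c : SS K) (h1 : DF 1 (rep a b c : FF K) = 0)
    (h2 : DF 2 (rep a b c : FF K) = 0) : rep a b c = 0 := by
  rw [DF_rep1] at h1
  rw [DF_rep2] at h2
  have hd : (V 0 : SS K) ∣ c := by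
    have : (V 0 : SS K) ∣ c * V 2 := ⟨a, by linear_combination -h1⟩
    rcases X_dvd_mul_iff.mp this with h | h
    · exact h
    · rw [V, X_dvd_X] at h; exact absurd h (by decide)
  obtain ⟨t, rfl⟩ := hd
  have ha : a = t * V 2 := mul_right_cancel₀ V0_ne (by linear_combination h1)
  have hb : b = t * (-V 1) := mul_right_cancel₀ V0_ne (by linear_combination h2)
  have hc : V 0 * t = t * V 0 := mul_comm _ _
  rw [ha, hb, hc, ← rho_rep]
  have : rep (V 2) (-V 1) (V 0) = (0 : J (K := K)) := by
    rw [← jacobi]; simp only [rep, map_neg, LinearMap.neg_apply]; abel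
  rw [this, map_zero]

/-- The set of represented elements. -/
def NN : Set (FF K) := {w | ∃ a b c : SS K, w = ((rep a b c : J (K := K)) : FF K)}

theorem NN_add {w w' : FF K} (h : w ∈ NN (K := K)) (h' : w' ∈ NN (K := K)) :
    w + w' ∈ NN (K := K) := by
  obtain ⟨a, b, c, rfl⟩ := h
  obtain ⟨a', b', c', rfl⟩ := h'
  exact ⟨a + a', b + b', c + c', by rw [← rep_add]; rfl⟩

theorem NN_rho (p : SS K) {z : J (K := K)} (h : (z : FF K) ∈ NN (K := K)) :
    (rho p z : FF K) ∈ NN (K := K) := by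
  obtain ⟨a, b, c, e⟩ := h
  have e' : z = rep a b c := Subtype.ext e
  rw [e', rho_rep]
  exact ⟨_, _, _, rfl⟩

theorem NN_J {w : FF K} (h : w ∈ NN (K := K)) : w ∈ J (K := K) := by
  obtain ⟨a, b, c, rfl⟩ := h
  exact (rep a b c).2

theorem NN_alg (r : K) {w : FF K} (h : w ∈ NN (K := K)) : r • w ∈ NN (K := K) := by
  have := NN_rho (C r) (z := ⟨w, NN_J h⟩) h
  have e : rho (C r : SS K) = algebraMap K _ r := rho.commutes r
  rw [e, Module.algebraMap_end_apply] at this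
  exact this

theorem NN_left (c : FF K) : ∀ {w : FF K}, w ∈ NN (K := K) → c * w ∈ NN (K := K) := by
  induction c using F_ind with
  | hK r => intro w h; rw [← Algebra.smul_def]; exact NN_alg r h
  | hx i => intro w h; rw [← rho_U i ⟨w, NN_J h⟩]; exact NN_rho _ h
  | hadd a b ha hb => intro w h; rw [add_mul]; exact NN_add (ha h) (hb h)
  | hmul a b ha hb => intro w h; rw [mul_assoc]; exact ha (hb h)

theorem NN_right (c : FF K) : ∀ {w : FF K}, w ∈ NN (K := K) → w * c ∈ NN (K := K) := by
  induction c using F_ind with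
  | hK r => intro w h; rw [← Algebra.commutes, ← Algebra.smul_def]; exact NN_alg r h
  | hx i =>
    intro w h
    have h1 := rho_U i ⟨w, NN_J h⟩
    have h2 := rho_V i ⟨w, NN_J h⟩
    have h3 := NN_add (NN_rho (U i) (z := ⟨w, NN_J h⟩) h) (NN_rho (V i) (z := ⟨w, NN_J h⟩) h)
    rw [h1, h2] at h3
    simpa using h3
  | hadd a b ha hb => intro w h; rw [mul_add]; exact NN_add (ha h) (hb h)
  | hmul a b ha hb => intro w h; rw [← mul_assoc]; exact hb (ha h)

theorem NN_zero : (0 : FF K) ∈ NN (K := K) := ⟨0, 0, 0, by simp [rep]⟩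

theorem NN_neg {w : FF K} (h : w ∈ NN (K := K)) : -w ∈ NN (K := K) := by
  have := NN_alg (-1) h
  simpa using this

theorem NN_kk (i j : Fin 3) : ((kk i j : J (K := K)) : FF K) ∈ NN (K := K) := by
  have e10 : ((kk 1 0 : J (K := K)) : FF K) ∈ NN (K := K) := ⟨1, 0, 0, by simp [rep]⟩
  have e20 : ((kk 2 0 : J (K := K)) : FF K) ∈ NN (K := K) := ⟨0, 1, 0, by simp [rep]⟩
  have e21 : ((kk 2 1 : J (K := K)) : FF K) ∈ NN (K := K) := ⟨0, 0, 1, by simp [rep]⟩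
  have hs : ∀ i j, ((kk i j : J (K := K)) : FF K) ∈ NN (K := K) → ((kk j i : J (K := K)) : FF K) ∈ NN (K := K) := by
    intro i j h
    have := NN_neg h
    simpa [kk] using this
  have h0 : ∀ i, ((kk i i : J (K := K)) : FF K) ∈ NN (K := K) := by
    intro i
    have := NN_zero (K := K)
    simpa [kk] using this
  fin_cases i <;> fin_cases j <;> first
    | exact h0 _ | exact e10 | exact e20 | exact e21 | exact hs _ _ e10 | exact hs _ _ e20
    | exact hs _ _ e21

theorem NN_comm (a b : FF K) : a * b - b * a ∈ NN (K := K) := by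
  induction a using F_ind with
  | hK r => rw [Algebra.commutes, sub_self]; exact NN_zero
  | hadd a a' ha ha' =>
    have : (a + a') * b - b * (a + a') = (a * b - b * a) + (a' * b - b * a') := by noncomm_ring
    rw [this]; exact NN_add ha ha'
  | hmul a a' ha ha' =>
    have : (a * a') * b - b * (a * a') = a * (a' * b - b * a') + (a * b - b * a) * a' := by
      noncomm_ring
    rw [this]; exact NN_add (NN_left _ ha') (NN_right _ ha)
  | hx i =>
    induction b using F_ind with
    | hK r => rw [Algebra.commutes, sub_self]; exact NN_zero
    | hx j => exact NN_kk i j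
    | hadd b b' hb hb' =>
      have : xx K i * (b + b') - (b + b') * xx K i
        = (xx K i * b - b * xx K i) + (xx K i * b' - b' * xx K i) := by noncomm_ring
      rw [this]; exact NN_add hb hb'
    | hmul b b' hb hb' =>
      have : xx K i * (b * b') - (b * b') * xx K i
        = (xx K i * b - b * xx K i) * b' + b * (xx K i * b' - b' * xx K i) := by
        noncomm_ring
      rw [this]; exact NN_add (NN_right _ hb) (NN_left _ hb')

def NI : TwoSidedIdeal (FF K) :=
  TwoSidedIdeal.mk' NN NN_zero NN_add NN_neg (fun {x _} h => NN_left x h) (fun {_ y} h => NN_right y h)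

theorem mem_NI (w : FF K) : w ∈ NI (K := K) ↔ w ∈ NN (K := K) := TwoSidedIdeal.mem_mk' ..

theorem ker_eL (w : FF K) (hw : eL w = 0) : w ∈ NN (K := K) := by
  let Q := (NI (K := K)).ringCon.Quotient
  let π : FF K →ₐ[K] Q := RingCon.mkₐ K (NI (K := K)).ringCon
  have hπ : ∀ a b, π a = π b ↔ a - b ∈ NN (K := K) := by
    intro a b
    rw [← mem_NI, ← TwoSidedIdeal.rel_iff]
    exact RingCon.eq _
  have hsurj : Function.Surjective π := Quotient.mk''_surjective
  let _ : CommRing Q := { (inferInstance : Ring Q) with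
    mul_comm := by
      intro x y
      obtain ⟨a, rfl⟩ := hsurj x
      obtain ⟨b, rfl⟩ := hsurj y
      have := (hπ (a * b) (b * a)).2 (NN_comm a b)
      rwa [map_mul, map_mul] at this }
  let ψ : SS K →ₐ[K] Q := aeval (Sum.elim (fun i => π (xx K i)) 0)
  have key : ∀ w, ψ (eL w) = π w := by
    intro w
    induction w using F_ind with
    | hK r => rw [AlgHom.commutes, AlgHom.commutes, AlgHom.commutes]
    | hx i => simp [ψ, U]
    | hadd a b ha hb => rw [map_add, map_add, map_add, ha, hb]
    | hmul a b ha hb => 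
      rw [map_mul, map_mul, map_mul, ha, hb]
  have h := key w
  rw [hw, map_zero] at h
  have h' := (hπ w 0).1 (by rw [← h, map_zero])
  simpa using h'

theorem eL_range (w : FF K) : eL w ∈ (aeval (R := K) (U (K := K))).range := by
  induction w using F_ind with
  | hK r => rw [AlgHom.commutes]; exact Subalgebra.algebraMap_mem _ _
  | hx i => rw [eL_x]; exact ⟨X i, by simp⟩
  | hadd a b ha hb => rw [map_add]; exact add_mem ha hb
  | hmul a b ha hb => rw [map_mul]; exact mul_mem ha hb

end MetabAux
namespace MetabAux

open MvPolynomial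

variable {K : Type*} [Field K]

theorem left_eq (c : FF K) : ∀ z : J (K := K), (rho (eL c) z : FF K) = c * z := by
  induction c using F_ind with
  | hK r =>
    intro z
    rw [AlgHom.commutes, AlgHom.commutes, Module.algebraMap_end_apply, Submodule.coe_smul,
      Algebra.smul_def]
  | hx i => intro z; rw [eL_x, rho_U]
  | hadd a b ha hb => intro z; rw [map_add, rho_add, Submodule.coe_add, ha, hb, add_mul]
  | hmul a b ha hb => intro z; rw [map_mul, rho_mul, ha, hb, mul_assoc]

theorem right_eq (c : FF K) : ∀ z : J (K := K), (rho (eR c) z : FF K) = z * c := by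
  induction c using F_ind with
  | hK r =>
    intro z
    rw [AlgHom.commutes, AlgHom.commutes, Module.algebraMap_end_apply, Submodule.coe_smul,
      Algebra.smul_def, Algebra.commutes]
  | hx i => intro z; rw [eR_x, rho_add, Submodule.coe_add, rho_U, rho_V]; abel
  | hadd a b ha hb => intro z; rw [map_add, rho_add, Submodule.coe_add, ha, hb, mul_add]
  | hmul a b ha hb =>
    intro z; rw [map_mul, mul_comm, rho_mul, hb, ha, mul_assoc]

/-- The quadratic generator. -/
def qF (K : Type*) [Field K] : FF K := xx K 1 * xx K 1 - (xx K 0 * xx K 2 + xx K 2 * xx K 0)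

theorem eL_q : eL (qF K) = ff 2 := by
  simp [qF, ff]

theorem eR_q : eR (qF K) = ff 2 + ff 4 - 2 * ff 3 := by
  simp [qF, ff]; ring

/-- The action of `f_5`. -/
def f5F (w : FF K) : FF K :=
  xx K 0 * (w * xx K 2 - xx K 2 * w) - xx K 1 * (w * xx K 1 - xx K 1 * w)
    + xx K 2 * (w * xx K 0 - xx K 0 * w)

theorem rho_f5 (z : J (K := K)) : (rho (ff 3) z : FF K) = f5F (z : FF K) := by
  have : (ff 3 : SS K) = U 0 * V 2 - U 1 * V 1 + U 2 * V 0 := by simp [ff]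
  rw [this, rho_add, rho_sub, rho_mul, rho_mul, rho_mul, Submodule.coe_add, Submodule.coe_sub,
    rho_U, rho_U, rho_U, rho_V, rho_V, rho_V, f5F]

theorem rho_f5_pow (p : ℕ) (z : J (K := K)) :
    (rho (ff 3 ^ p) z : FF K) = f5F^[p] (z : FF K) := by
  induction p with
  | zero => simp
  | succ p ih => rw [pow_succ', rho_mul, rho_f5, ih, Function.iterate_succ_apply']

/-- The five basic constants. -/
def cJ : Fin 5 → J (K := K) :=
  ![kk 1 0,
    rho (V 0) (kk 2 0) - rho (V 1) (kk 1 0),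
    rho (U 0) (kk 2 0) - rho (U 1) (kk 1 0),
    rho (U 0) (kk 2 1) - rho (U 1) (kk 2 0) + rho (U 2) (kk 1 0),
    rho (U 2 * V 0) (kk 2 0) - rho (U 0 * V 2) (kk 2 0) + rho (U 0 * V 1) (kk 2 1)
      - rho (U 1 * V 0) (kk 2 1) - rho (U 2 * V 1) (kk 1 0) + rho (U 1 * V 2) (kk 1 0)]

theorem DF_cJ (i : Fin 5) : DF 0 ((cJ i : J (K := K)) : FF K) = cc i := by
  fin_cases i <;> simp [cJ, cc, DF_rho, DF_kk] <;> ring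

theorem d_alg (δ : FF K →ₗ[K] FF K)
    (hleib : ∀ a b : FF K, δ (a * b) = δ a * b + a * δ b)
    (r : K) : δ (algebraMap K _ r) = 0 := by
  have h := hleib 1 1
  simp only [mul_one, one_mul] at h
  have h' : δ 1 = 0 := by simpa using h
  rw [Algebra.algebraMap_eq_smul_one, map_smul, h', smul_zero]

theorem d_cJ (δ : FF K →ₗ[K] FF K)
    (hleib : ∀ a b : FF K, δ (a * b) = δ a * b + a * δ b)
    (h1 : δ (xx K 0) = 0) (h2 : δ (xx K 1) = xx K 0) (h3 : δ (xx K 2) = xx K 1)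
    (i : Fin 5) : δ ((cJ i : J (K := K)) : FF K) = 0 := by
  fin_cases i <;>
  simp [cJ, rho_mul, rho_U, rho_V, kk, hleib, h1, h2, h3] <;> noncomm_ring

theorem d_f5 (δ : FF K →ₗ[K] FF K)
    (hleib : ∀ a b : FF K, δ (a * b) = δ a * b + a * δ b)
    (h1 : δ (xx K 0) = 0) (h2 : δ (xx K 1) = xx K 0) (h3 : δ (xx K 2) = xx K 1)
    (w : FF K) : δ (f5F w) = f5F (δ w) := by
  simp [f5F, hleib, h1, h2, h3]; noncomm_ring

theorem d_q (δ : FF K →ₗ[K] FF K)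
    (hleib : ∀ a b : FF K, δ (a * b) = δ a * b + a * δ b)
    (h1 : δ (xx K 0) = 0) (h2 : δ (xx K 1) = xx K 0) (h3 : δ (xx K 2) = xx K 1) : δ (qF K) = 0 := by
  simp [qF, hleib, h1, h2, h3]

theorem d_eL (δ : FF K →ₗ[K] FF K)
    (hleib : ∀ a b : FF K, δ (a * b) = δ a * b + a * δ b)
    (h1 : δ (xx K 0) = 0) (h2 : δ (xx K 1) = xx K 0) (h3 : δ (xx K 2) = xx K 1)
    (w : FF K) : eL (δ w) = dS (eL w) := by
  induction w using F_ind with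
  | hK r => rw [d_alg δ hleib, AlgHom.commutes, map_zero]; simp
  | hx i => fin_cases i <;> simp [h1, h2, h3]
  | hadd a b ha hb => rw [map_add, map_add, map_add, map_add, ha, hb]
  | hmul a b ha hb => rw [hleib, map_add, map_mul, map_mul, map_mul, ha, hb, Derivation.leibniz]; simp only [smul_eq_mul]; ring

theorem d_eR (δ : FF K →ₗ[K] FF K)
    (hleib : ∀ a b : FF K, δ (a * b) = δ a * b + a * δ b)
    (h1 : δ (xx K 0) = 0) (h2 : δ (xx K 1) = xx K 0) (h3 : δ (xx K 2) = xx K 1)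
    (w : FF K) : eR (δ w) = dS (eR w) := by
  induction w using F_ind with
  | hK r => rw [d_alg δ hleib, AlgHom.commutes, map_zero]; simp
  | hx i => fin_cases i <;> simp [h1, h2, h3]
  | hadd a b ha hb => rw [map_add, map_add, map_add, map_add, ha, hb]
  | hmul a b ha hb => rw [hleib, map_add, map_mul, map_mul, map_mul, ha, hb, Derivation.leibniz]; simp only [smul_eq_mul]; ring

theorem d_DF (δ : FF K →ₗ[K] FF K)
    (hleib : ∀ a b : FF K, δ (a * b) = δ a * b + a * δ b)
    (h1 : δ (xx K 0) = 0) (h2 : δ (xx K 1) = xx K 0) (h3 : δ (xx K 2) = xx K 1)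
    (w : FF K) : DF 0 (δ w) = dS (DF 0 w) + DF 1 w ∧ DF 1 (δ w) = dS (DF 1 w) + DF 2 w
    ∧ DF 2 (δ w) = dS (DF 2 w) := by
  induction w using F_ind with
  | hK r => rw [d_alg δ hleib]; simp only [DF_alg, map_zero]; simp
  | hx i => fin_cases i <;> simp [h1, h2, h3, DF_x]
  | hadd a b ha hb =>
    simp only [map_add, ha.1, hb.1, ha.2.1, hb.2.1, ha.2.2, hb.2.2]
    exact ⟨by ring, by ring, trivial⟩
  | hmul a b ha hb =>
    simp only [hleib, map_add, DF_mul, Derivation.leibniz, smul_eq_mul,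
      ha.1, hb.1, ha.2.1, hb.2.1, ha.2.2, hb.2.2, d_eL δ hleib h1 h2 h3, d_eR δ hleib h1 h2 h3]
    refine ⟨?_, ?_, ?_⟩ <;> ring

/-- The generating set. -/
def GG (K : Type*) [Field K] : Set (FF K) :=
  {xx K 0, qF K} ∪ {y : FF K | ∃ (j : Fin 5) (p : ℕ), y = f5F^[p] ((cJ j : J (K := K)) : FF K)}

theorem x0_mem : xx K 0 ∈ Algebra.adjoin K (GG K) :=
  Algebra.subset_adjoin (Or.inl (Or.inl rfl))

theorem q_mem : qF K ∈ Algebra.adjoin K (GG K) :=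
  Algebra.subset_adjoin (Or.inl (Or.inr rfl))

theorem rho_mem (r : MvPolynomial (Fin 5) K) : ∀ z : J (K := K),
    (∀ p : ℕ, (rho (ff 3 ^ p) z : FF K) ∈ Algebra.adjoin K (GG K)) →
    ∀ p : ℕ, (rho (ff 3 ^ p) (rho (aeval ff r) z) : FF K) ∈ Algebra.adjoin K (GG K) := by
  induction r using MvPolynomial.induction_on with
  | C a =>
    intro z hz p
    rw [MvPolynomial.aeval_C, AlgHom.commutes, Module.algebraMap_end_apply, map_smul,
      Submodule.coe_smul]
    exact Subalgebra.smul_mem _ (hz p) a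
  | add r s hr hs =>
    intro z hz p
    rw [map_add, rho_add, map_add, Submodule.coe_add]
    exact add_mem (hr z hz p) (hs z hz p)
  | mul_X r i hr =>
    intro z hz p
    rw [map_mul, rho_mul, aeval_X]
    refine hr _ ?_ p
    intro p
    have sw : ∀ t : SS K, rho (ff 3 ^ p) (rho t z) = rho t (rho (ff 3 ^ p) z) := by
      intro t; rw [← rho_mul, mul_comm, rho_mul]
    have hp := hz p
    have e0 : (rho (ff 0) (rho (ff 3 ^ p) z) : FF K) = xx K 0 * (rho (ff 3 ^ p) z : FF K) := by
      rw [show (ff 0 : SS K) = U 0 from rfl, rho_U]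
    have e1 : (rho (ff 1) (rho (ff 3 ^ p) z) : FF K)
        = (rho (ff 3 ^ p) z : FF K) * xx K 0 - xx K 0 * (rho (ff 3 ^ p) z : FF K) := by
      rw [show (ff 1 : SS K) = V 0 from rfl, rho_V]
    have e2 : (rho (ff 2) (rho (ff 3 ^ p) z) : FF K) = qF K * (rho (ff 3 ^ p) z : FF K) := by
      rw [← eL_q, left_eq]
    have e3 : rho (ff 3) (rho (ff 3 ^ p) z) = rho (ff 3 ^ (p + 1)) z := by
      rw [pow_succ', rho_mul]
    have e4 : (rho (ff 4) (rho (ff 3 ^ p) z) : FF K) = (rho (ff 3 ^ p) z : FF K) * qF K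
        - qF K * (rho (ff 3 ^ p) z : FF K)
        + ((rho (ff 3 ^ (p + 1)) z : FF K) + (rho (ff 3 ^ (p + 1)) z : FF K)) := by
      have : (ff 4 : SS K) = eR (qF K) - eL (qF K) + (ff 3 + ff 3) := by
        rw [eR_q, eL_q]; ring
      rw [this, rho_add, rho_sub, rho_add, e3, Submodule.coe_add, Submodule.coe_sub,
        Submodule.coe_add, left_eq, right_eq]
    rw [sw]
    fin_cases i
    · exact e0 ▸ mul_mem x0_mem hp
    · exact e1 ▸ sub_mem (mul_mem hp x0_mem) (mul_mem x0_mem hp)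
    · exact e2 ▸ mul_mem q_mem hp
    · exact e3 ▸ hz (p + 1)
    · exact e4 ▸ add_mem (sub_mem (mul_mem hp q_mem) (mul_mem q_mem hp))
        (add_mem (hz (p + 1)) (hz (p + 1)))

theorem cJ_mem (r : MvPolynomial (Fin 5) K) (i : Fin 5) :
    ((rho (aeval ff r) (cJ i) : J (K := K)) : FF K) ∈ Algebra.adjoin K (GG K) := by
  have := rho_mem r (cJ i) (fun p => ?_) 0
  · rwa [pow_zero, map_one] at this
  · rw [rho_f5_pow]
    exact Algebra.subset_adjoin (Or.inr ⟨i, p, rfl⟩)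

theorem gg_lift (g : MvPolynomial (Fin 2) K) :
    ∃ y ∈ Algebra.adjoin K (GG K), eL y = aeval gg g := by
  induction g using MvPolynomial.induction_on with
  | C a =>
    exact ⟨algebraMap K _ a, Subalgebra.algebraMap_mem _ _, by
      rw [AlgHom.commutes, MvPolynomial.aeval_C]⟩
  | add r s hr hs =>
    obtain ⟨y, hy, ey⟩ := hr
    obtain ⟨y', hy', ey'⟩ := hs
    exact ⟨y + y', add_mem hy hy', by rw [map_add, map_add, ey, ey']⟩
  | mul_X r i hr =>
    obtain ⟨y, hy, ey⟩ := hr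
    fin_cases i
    · exact ⟨y * xx K 0, mul_mem hy x0_mem, by rw [map_mul, map_mul, ey, eL_x, aeval_X]; rfl⟩
    · exact ⟨y * qF K, mul_mem hy q_mem, by rw [map_mul, map_mul, ey, eL_q, aeval_X]; rfl⟩

theorem main_FF [CharZero K] (δ : FF K →ₗ[K] FF K)
    (hleib : ∀ a b : FF K, δ (a * b) = δ a * b + a * δ b)
    (h1 : δ (xx K 0) = 0) (h2 : δ (xx K 1) = xx K 0) (h3 : δ (xx K 2) = xx K 1) :
    {w : FF K | δ w = 0} = ↑(Algebra.adjoin K (GG K)) := by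
  have hsub : ∀ y ∈ Algebra.adjoin K (GG K), δ y = 0 := by
    intro y hy
    induction hy using Algebra.adjoin_induction with
    | mem y hy =>
      rcases hy with (rfl | rfl) | ⟨j, p, rfl⟩
      · exact h1
      · exact d_q δ hleib h1 h2 h3
      · induction p with
        | zero => exact d_cJ δ hleib h1 h2 h3 j
        | succ p ih =>
          rw [Function.iterate_succ_apply', d_f5 δ hleib h1 h2 h3, ih]; simp [f5F]
    | algebraMap r => exact d_alg δ hleib r
    | add a b _ _ ha hb => rw [map_add, ha, hb, add_zero]
    | mul a b _ _ ha hb => rw [hleib, ha, hb, zero_mul, mul_zero, add_zero]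
  apply Set.Subset.antisymm
  · intro w hw
    have hw : δ w = 0 := hw
    have hd : dS (eL w) = 0 := by rw [← d_eL δ hleib h1 h2 h3, hw, map_zero]
    obtain ⟨g, hg⟩ := comm_main (eL w) (eL_range w) hd
    obtain ⟨y, hy, ey⟩ := gg_lift g
    have hk : eL (w - y) = 0 := by rw [map_sub, ey, hg, sub_self]
    have hδ : δ (w - y) = 0 := by rw [map_sub, hw, hsub y hy, sub_zero]
    have key : ∀ t : FF K, δ t = 0 → DF 1 t = - dS (DF 0 t) ∧ DF 2 t = dS (dS (DF 0 t)) ∧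
        dS (dS (dS (DF 0 t))) = 0 := by
      intro t ht
      obtain ⟨a, b, c⟩ := d_DF δ hleib h1 h2 h3 t
      rw [ht, map_zero] at a b c
      have a' : DF 1 t = - dS (DF 0 t) := by linear_combination -a
      have b' : DF 2 t = dS (dS (DF 0 t)) := by
        rw [a', map_neg] at b; linear_combination -b
      exact ⟨a', b', by rw [← b', ← c]⟩
    have hr : V 0 * DF 0 (w - y) - V 1 * dS (DF 0 (w - y)) + V 2 * dS (dS (DF 0 (w - y))) = 0 := by
      obtain ⟨a', b', _⟩ := key _ hδ
      obtain ⟨a, b, c, e⟩ := ker_eL _ hk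
      rw [← b']
      have a'' : dS (DF 0 (w - y)) = - DF 1 (w - y) := by rw [a', neg_neg]
      rw [a'', e, DF_rep0, DF_rep1, DF_rep2]; ring
    obtain ⟨r, hp⟩ := M_main _ (key _ hδ).2.2 hr
    let z : FF K := ∑ i, ((rho (aeval ff (r i)) (cJ i) : J (K := K)) : FF K)
    have hz : z ∈ Algebra.adjoin K (GG K) := sum_mem (fun i _ => cJ_mem (r i) i)
    have hz0 : eL z = 0 := by
      simp only [z, map_sum]
      exact Finset.sum_eq_zero (fun i _ => (rho (aeval ff (r i)) (cJ i) : J (K := K)).2.1)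
    have hzD : DF 0 z = DF 0 (w - y) := by
      rw [hp]; simp only [z, map_sum, DF_rho, DF_cJ]
    have hδ2 : δ (w - y - z) = 0 := by rw [map_sub, hδ, hsub z hz, sub_zero]
    have hD : DF 0 (w - y - z) = 0 := by rw [map_sub, hzD, sub_self]
    obtain ⟨a', b', _⟩ := key _ hδ2
    rw [hD] at a' b'
    simp only [map_zero, neg_zero] at a' b'
    obtain ⟨a, b, c, e⟩ := ker_eL (w - y - z) (by rw [map_sub, hk, hz0, sub_zero])
    rw [e] at a' b'
    rw [rep_inj a b c a' b'] at e
    have : w = y + z := by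
      have e' : w - y - z = 0 := e
      rw [sub_sub, sub_eq_zero] at e'; exact e'
    rw [this]
    exact add_mem hy hz
  · intro y hy
    exact hsub y hy

end MetabAux
/-- For `d = 3` and the Weitzenböck derivation with `δ(x₁) = 0`,
`δ(x₂) = x₁`, `δ(x₃) = x₂`, the algebra of constants `F₃^δ` is generated as a unital
`K`-algebra by `{x₁, x₂² - (x₁x₃ + x₃x₁)} ∪ {c_j·f₅^p : j = 1,…,5, p ≥ 0}`. -/
theorem algebra_generators_d3_cell_3
    (K : Type*) [Field K] [CharZero K]
    (δ : FreeMetab K 3 →ₗ[K] FreeMetab K 3)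
    (hleib : ∀ a b : FreeMetab K 3, δ (a * b) = δ a * b + a * δ b)
    (h1 : δ (xg K 3 0) = 0) (h2 : δ (xg K 3 1) = xg K 3 0) (h3 : δ (xg K 3 2) = xg K 3 1) :
    {w : FreeMetab K 3 | δ w = 0}
      = ↑(Algebra.adjoin K
          ({xg K 3 0,
            xg K 3 1 * xg K 3 1 - (xg K 3 0 * xg K 3 2 + xg K 3 2 * xg K 3 0)} ∪
           {y : FreeMetab K 3 | ∃ (j : Fin 5) (p : ℕ),
             y = (f5Step K)^[p] (![c1 K, c2 K, c3 K, c4 K, c5 K] j)})) := by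
  have h := MetabAux.main_FF (K := K) δ hleib h1 h2 h3
  have hc : ∀ j, ![c1 K, c2 K, c3 K, c4 K, c5 K] j
      = ((MetabAux.cJ j : MetabAux.J (K := K)) : MetabAux.FF K) := by
    intro j
    fin_cases j <;>
      simp [MetabAux.cJ, MetabAux.rho_mul, MetabAux.rho_U, MetabAux.rho_V, MetabAux.kk] <;> rfl
  simp only [hc]
  exact h
end
end
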